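/- arXiv:1801.06416 — 5 statements merged into one kernel-verified Lean document; each statement's English description precedes it below -/
import Mathlib

section
/- Let 1 ≤ p < ∞ and let κ be an L_p-kernel which is strictly positive on (0,∞) and such that log κ is convex on (0,∞). Then for every γ < 0 there exists a unique L_p-kernel r such that r − κ = γ (κ ⋆ r), i.e. r(t) − κ(t) = γ ∫₀^t κ(t−s) r(s) ds for all t > 0. -/
open MeasureTheory Set Filter

/-- An `L_p`-kernel: a function `κ : [0,∞) → [0,∞)` (modeled on all of `ℝ`,
with conditions imposed on `[0,∞)`) which is continuous on `(0,∞)` and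
satisfies `∫₀^T κ(t)^p dt < ∞` for all `T > 0`. -/
def IsLpKernel (p : ℝ) (κ : ℝ → ℝ) : Prop :=
  (∀ t, 0 ≤ t → 0 ≤ κ t) ∧ ContinuousOn κ (Set.Ioi 0) ∧
    ∀ T > 0, MeasureTheory.IntegrableOn (fun t => κ t ^ p) (Set.Ioc 0 T)

theorem continuous_integral_mul_comp_sub {k g : ℝ → ℝ} {a C : ℝ} (hk : Integrable k)
    (hg : Measurable g) (hC : ∀ s, |g s| ≤ C) (hga : ∀ s, s ≠ a → ContinuousAt g s) :
    Continuous fun t => ∫ u, k u * g (t - u) := by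
  refine continuous_iff_continuousAt.2 fun t₀ => ?_
  refine continuousAt_of_dominated (bound := fun u => |k u| * C) ?_ ?_ ?_ ?_
  · exact Eventually.of_forall fun t =>
      hk.aestronglyMeasurable.mul (hg.comp (measurable_const.sub measurable_id)).aestronglyMeasurable
  · refine Eventually.of_forall fun t => Eventually.of_forall fun u => ?_
    rw [Real.norm_eq_abs, abs_mul]
    exact mul_le_mul_of_nonneg_left (hC _) (abs_nonneg _)
  · exact hk.abs.mul_const C
  · filter_upwards [compl_mem_ae_iff.2 (measure_singleton (μ := volume) (t₀ - a))] with u hu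
    have hne : t₀ - u ≠ a := fun h => hu (by rw [mem_singleton_iff]; linarith)
    exact continuousAt_const.mul
      (ContinuousAt.comp (g := g) (hga _ hne) (by fun_prop))

theorem exists_weight_lt {k : ℝ → ℝ} {L : ℝ} (hL : 0 ≤ L) (hk : IntervalIntegrable k volume 0 L)
    (c : ℝ) : ∃ σ : ℝ, c * (∫ u in (0 : ℝ)..L, |Real.exp (-σ * u) * k u|) < 1 := by
  have h : Tendsto (fun n : ℕ => ∫ u in (0 : ℝ)..L, |Real.exp (-(n : ℝ) * u) * k u|) atTop
      (nhds (∫ u in (0 : ℝ)..L, (0 : ℝ))) := by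
    refine intervalIntegral.tendsto_integral_filter_of_dominated_convergence (fun u => |k u|)
      ?_ ?_ hk.abs ?_
    · refine Eventually.of_forall fun n => ?_
      have h1 : Continuous fun u : ℝ => Real.exp (-(n : ℝ) * u) := by fun_prop
      exact (h1.aestronglyMeasurable.mul hk.def'.aestronglyMeasurable).norm
    · refine Eventually.of_forall fun n => Eventually.of_forall fun u hu => ?_
      rw [uIoc_of_le hL] at hu
      rw [Real.norm_eq_abs, abs_abs, abs_mul, Real.abs_exp]
      have : Real.exp (-(n : ℝ) * u) ≤ 1 := by
        rw [Real.exp_le_one_iff]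
        have := mul_nonneg (Nat.cast_nonneg (α := ℝ) n) hu.1.le
        linarith
      exact mul_le_of_le_one_left (abs_nonneg _) this
    · refine Eventually.of_forall fun u hu => ?_
      rw [uIoc_of_le hL] at hu
      have h1 : Tendsto (fun n : ℕ => Real.exp (-(n : ℝ) * u)) atTop (nhds 0) := by
        refine Real.tendsto_exp_atBot.comp ?_
        have := (tendsto_natCast_atTop_atTop (R := ℝ)).atTop_mul_const hu.1
        simpa [neg_mul] using this.const_mul_atTop_of_neg (r := -1) (by norm_num)
      simpa using (h1.mul_const (k u)).abs
  have h2 := (h.const_mul c).eventually_lt_const (u := 1) (by simp)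
  obtain ⟨n, hn⟩ := h2.exists
  exact ⟨n, hn⟩

/-- Solvability of a linear Volterra equation of convolution type with integrable kernel and
continuous forcing. -/
theorem exists_volterra_solution {k f : ℝ → ℝ} {a b : ℝ} (hab : a ≤ b)
    (hk : IntervalIntegrable k volume 0 (b - a)) (hf : ContinuousOn f (Icc a b)) (c : ℝ) :
    ∃ y : ℝ → ℝ, ContinuousOn y (Icc a b) ∧
      ∀ t ∈ Icc a b, y t = f t - c * ∫ s in a..t, k (t - s) * y s := by
  have hL : 0 ≤ b - a := sub_nonneg.2 hab
  obtain ⟨σ, hσ⟩ := exists_weight_lt hL hk |c|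
  set K : ℝ → ℝ := (Ioc 0 (b - a)).indicator fun u => Real.exp (-σ * u) * k u with hK
  have hKi : Integrable K := by
    rw [hK, integrable_indicator_iff measurableSet_Ioc,
      ← intervalIntegrable_iff_integrableOn_Ioc_of_le hL]
    exact hk.continuousOn_mul (Continuous.continuousOn (by fun_prop))
  have hKn : ∫ u, |K u| = ∫ u in (0 : ℝ)..(b - a), |Real.exp (-σ * u) * k u| := by
    rw [intervalIntegral.integral_of_le hL, ← integral_indicator measurableSet_Ioc]
    congr 1
    ext u
    by_cases hu : u ∈ Ioc 0 (b - a) <;> simp [hK, hu]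
  have hq0 : 0 ≤ |c| * ∫ u, |K u| :=
    mul_nonneg (abs_nonneg _) (integral_nonneg fun u => abs_nonneg _)
  rw [← hKn] at hσ
  obtain ⟨q, hq⟩ : ∃ q : NNReal, (q : ℝ) = |c| * ∫ u, |K u| := ⟨⟨_, hq0⟩, rfl⟩
  set φ : ℝ → ℝ := fun t => Real.exp (-σ * (projIcc a b hab t : ℝ)) * f (projIcc a b hab t)
    with hφ
  have hφc : Continuous φ := by
    have h1 : Continuous fun t => f (projIcc a b hab t) :=
      (continuousOn_iff_continuous_domRestrict.1 hf).comp continuous_projIcc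
    have h2 : Continuous fun t => (projIcc a b hab t : ℝ) :=
      continuous_subtype_val.comp continuous_projIcc
    exact (Real.continuous_exp.comp (continuous_const.mul h2)).mul h1
  obtain ⟨M, hM⟩ : ∃ M, ∀ t, |φ t| ≤ M := by
    obtain ⟨M, hM⟩ := (isCompact_Icc (a := a) (b := b)).exists_bound_of_continuousOn
      hφc.continuousOn
    refine ⟨M, fun t => ?_⟩
    have := hM _ (projIcc a b hab t).2
    simpa [hφ] using this
  have hmeas : ∀ z : BoundedContinuousFunction ℝ ℝ, Measurable ((Ici a).indicator z) :=
    fun z => z.continuous.measurable.indicator measurableSet_Ici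
  have hind : ∀ (z : ℝ → ℝ) {C : ℝ}, (∀ s, |z s| ≤ C) → ∀ s, |(Ici a).indicator z s| ≤ C := by
    intro z C hz s
    by_cases hs : s ∈ Ici a
    · simpa [hs] using hz s
    · simpa [hs] using (abs_nonneg _).trans (hz s)
  have hz : ∀ (z : BoundedContinuousFunction ℝ ℝ) s, |z s| ≤ ‖z‖ := fun z s => z.norm_coe_le_norm s
  have hconv : ∀ z : BoundedContinuousFunction ℝ ℝ,
      Continuous fun t => ∫ u, K u * (Ici a).indicator z (t - u) := by
    intro z
    refine continuous_integral_mul_comp_sub (a := a) hKi (hmeas z) (hind z (hz z)) ?_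
    intro s hs
    rcases lt_or_gt_of_ne hs with h | h
    · refine (continuousAt_const (y := (0 : ℝ))).congr ?_
      filter_upwards [Iio_mem_nhds h] with x hx
      exact (indicator_of_notMem (by simpa using hx) _).symm
    · refine z.continuous.continuousAt.congr ?_
      filter_upwards [Ioi_mem_nhds h] with x hx
      exact (indicator_of_mem (le_of_lt hx) _).symm
  have hint : ∀ (z : BoundedContinuousFunction ℝ ℝ) t,
      Integrable fun u => K u * (Ici a).indicator z (t - u) := by
    intro z t
    refine hKi.mul_bdd (c := ‖z‖)
      ((hmeas z).comp (measurable_const.sub measurable_id)).aestronglyMeasurable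
      (Eventually.of_forall fun u => hind z (hz z) _)
  have hbd : ∀ (z : ℝ → ℝ) {C : ℝ}, (∀ s, |z s| ≤ C) → ∀ t,
      |∫ u, K u * (Ici a).indicator z (t - u)| ≤ (∫ u, |K u|) * C := by
    intro z C hz t
    rw [← integral_mul_const, ← Real.norm_eq_abs]
    refine norm_integral_le_of_norm_le (hKi.abs.mul_const C) (Eventually.of_forall fun u => ?_)
    rw [Real.norm_eq_abs, abs_mul]
    exact mul_le_mul_of_nonneg_left (hind z hz _) (abs_nonneg _)
  let F : BoundedContinuousFunction ℝ ℝ → BoundedContinuousFunction ℝ ℝ := fun z =>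
    BoundedContinuousFunction.ofNormedAddCommGroup
      (fun t => φ t - c * ∫ u, K u * (Ici a).indicator z (t - u))
      (hφc.sub (continuous_const.mul (hconv z))) (M + |c| * ((∫ u, |K u|) * ‖z‖)) (by
        intro t
        refine (norm_sub_le _ _).trans (add_le_add (hM t) ?_)
        rw [Real.norm_eq_abs, abs_mul]
        exact mul_le_mul_of_nonneg_left (hbd z (hz z) t) (abs_nonneg _))
  have hF : ContractingWith q F := by
    refine ⟨by rw [← NNReal.coe_lt_coe, hq]; exact hσ, LipschitzWith.of_dist_le_mul fun z w => ?_⟩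
    rw [hq, BoundedContinuousFunction.dist_le (mul_nonneg hq0 dist_nonneg)]
    intro t
    have h1 : F z t - F w t
        = -(c * ∫ u, K u * (Ici a).indicator (fun s => z s - w s) (t - u)) := by
      have h2 : ∫ u, K u * (Ici a).indicator (fun s => z s - w s) (t - u)
          = (∫ u, K u * (Ici a).indicator z (t - u))
            - ∫ u, K u * (Ici a).indicator w (t - u) := by
        rw [← integral_sub (hint z t) (hint w t)]
        congr 1
        ext u
        by_cases hu : t - u ∈ Ici a
        · simp only [indicator_of_mem hu]; ring
        · simp only [indicator_of_notMem hu]; ring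
      rw [h2]
      simp only [F, BoundedContinuousFunction.coe_ofNormedAddCommGroup]
      ring
    rw [Real.dist_eq, h1, abs_neg, abs_mul]
    have h3 := hbd (fun s => z s - w s) (C := dist z w)
      (fun s => by rw [← Real.dist_eq]; exact BoundedContinuousFunction.dist_coe_le_dist s) t
    calc |c| * |∫ u, K u * (Ici a).indicator (fun s => z s - w s) (t - u)|
        ≤ |c| * ((∫ u, |K u|) * dist z w) := mul_le_mul_of_nonneg_left h3 (abs_nonneg _)
      _ = (|c| * ∫ u, |K u|) * dist z w := by ring
  set z := ContractingWith.fixedPoint F hF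
  have hfix : F z = z := hF.fixedPoint_isFixedPt
  refine ⟨fun t => Real.exp (σ * t) * z t,
    ((Real.continuous_exp.comp (continuous_const.mul continuous_id)).mul
      z.continuous).continuousOn, fun t ht => ?_⟩
  have h1 : z t = Real.exp (-σ * t) * f t - c * ∫ u, K u * (Ici a).indicator z (t - u) := by
    conv_lhs => rw [← hfix]
    simp [F, hφ, projIcc_of_mem hab ht]
  have h2 : ∫ u, K u * (Ici a).indicator z (t - u)
      = Real.exp (-σ * t) * ∫ s in a..t, k (t - s) * (Real.exp (σ * s) * z s) := by
    rw [← integral_sub_left_eq_self _ volume t, intervalIntegral.integral_of_le ht.1,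
      ← integral_Ico_eq_integral_Ioc, ← integral_const_mul, ← integral_indicator measurableSet_Ico]
    congr 1
    ext s
    rw [sub_sub_cancel]
    by_cases hs : s ∈ Ico a t
    · have hs' : t - s ∈ Ioc 0 (b - a) :=
        ⟨sub_pos.2 hs.2, by linarith [hs.1, ht.2]⟩
      have hs'' : s ∈ Ici a := hs.1
      rw [hK, indicator_of_mem hs, indicator_of_mem hs', indicator_of_mem hs'']
      have : Real.exp (-σ * (t - s)) = Real.exp (-σ * t) * Real.exp (σ * s) := by
        rw [← Real.exp_add]; ring_nf
      rw [this]; ring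
    · rw [indicator_of_notMem hs]
      by_cases hs' : s ∈ Ici a
      · have : t - s ∉ Ioc 0 (b - a) := fun h => hs ⟨hs', sub_pos.1 h.1⟩
        rw [hK, indicator_of_notMem this, zero_mul]
      · rw [indicator_of_notMem hs', mul_zero]
  have h3 : Real.exp (σ * t) * Real.exp (-σ * t) = 1 := by
    rw [← Real.exp_add]; simp
  simp only
  rw [h1, h2]
  linear_combination (f t - c * ∫ s in a..t, k (t - s) * (Real.exp (σ * s) * z s)) * h3

/-- A positive locally integrable kernel, continuous on `(0,∞)`, whose ratios
`κ (x + h) / κ x` are nondecreasing in `x`. -/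
structure IsLogConvexKernel (κ : ℝ → ℝ) : Prop where
  pos : ∀ t > 0, 0 < κ t
  continuousOn : ContinuousOn κ (Ioi 0)
  intervalIntegrable : ∀ T, 0 ≤ T → IntervalIntegrable κ volume 0 T
  mul_le_mul : ∀ x y h, 0 < x → x ≤ y → 0 ≤ h → κ (x + h) * κ y ≤ κ x * κ (y + h)

theorem mul_le_mul_of_convexOn_log {κ : ℝ → ℝ} (hpos : ∀ t > 0, 0 < κ t)
    (hlog : ConvexOn ℝ (Ioi 0) fun t => Real.log (κ t)) {x y h : ℝ} (hx : 0 < x) (hxy : x ≤ y)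
    (hh : 0 ≤ h) : κ (x + h) * κ y ≤ κ x * κ (y + h) := by
  rcases hh.eq_or_lt with rfl | hh
  · simp
  have hy : 0 < y := hx.trans_le hxy
  have hd : 0 < y - x + h := by linarith
  have hθ : h / (y - x + h) + (y - x) / (y - x + h) = 1 := by field_simp; ring
  have hθ0 : 0 ≤ h / (y - x + h) := by positivity
  have hθ1 : 0 ≤ (y - x) / (y - x + h) := div_nonneg (by linarith) hd.le
  have e1 := hlog.2 (mem_Ioi.2 hx) (mem_Ioi.2 (add_pos hy hh)) hθ1 hθ0 (by linarith)
  have e2 := hlog.2 (mem_Ioi.2 hx) (mem_Ioi.2 (add_pos hy hh)) hθ0 hθ1 hθ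
  simp only [smul_eq_mul] at e1 e2
  have c1 : (y - x) / (y - x + h) * x + h / (y - x + h) * (y + h) = x + h := by
    field_simp; ring
  have c2 : h / (y - x + h) * x + (y - x) / (y - x + h) * (y + h) = y := by
    field_simp; ring
  rw [c1] at e1
  rw [c2] at e2
  have p1 := hpos _ (add_pos hx hh)
  have p2 := hpos _ hy
  have p3 := hpos _ hx
  have p4 := hpos _ (add_pos hy hh)
  rw [← Real.log_le_log_iff (mul_pos p1 p2) (mul_pos p3 p4), Real.log_mul p1.ne' p2.ne',
    Real.log_mul p3.ne' p4.ne']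
  have : (h / (y - x + h) + (y - x) / (y - x + h)) * (Real.log (κ x) + Real.log (κ (y + h)))
      = 1 * (Real.log (κ x) + Real.log (κ (y + h))) := by rw [hθ]
  linarith

namespace IsLogConvexKernel

variable {κ : ℝ → ℝ}

theorem intervalIntegrable_comp_sub (hκ : IsLogConvexKernel κ) {a t : ℝ} (h : a ≤ t) :
    IntervalIntegrable (fun s => κ (t - s)) volume a t := by
  have := (hκ.intervalIntegrable (t - a) (sub_nonneg.2 h)).comp_sub_left t
  simpa using this.symm

theorem intervalIntegrable_mul (hκ : IsLogConvexKernel κ) {a t : ℝ} (h : a ≤ t) {d : ℝ → ℝ}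
    (hd : ContinuousOn d (Icc a t)) : IntervalIntegrable (fun s => κ (t - s) * d s) volume a t :=
  (hκ.intervalIntegrable_comp_sub h).mul_continuousOn (by rwa [uIcc_of_le h])

theorem continuousOn_comp_sub (hκ : IsLogConvexKernel κ) (t : ℝ) :
    ContinuousOn (fun s => κ (t - s)) (Iio t) :=
  hκ.continuousOn.comp (by fun_prop) fun s hs => mem_Ioi.2 (sub_pos.2 hs)

theorem pos_of_volterra (hκ : IsLogConvexKernel κ) {a b c : ℝ} (hc : 0 ≤ c)
    {d f : ℝ → ℝ} (hd : ContinuousOn d (Icc a b))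
    (heq : ∀ t ∈ Icc a b, d t = f t - c * ∫ s in a..t, κ (t - s) * d s) (hfa : 0 < f a)
    (hf : ∀ t t', a < t → t ≤ t' → t' ≤ b → f t * κ (t' - a) ≤ f t' * κ (t - a)) :
    ∀ t ∈ Icc a b, 0 < d t := by
  by_contra! hcon
  obtain ⟨t₁, ht₁, hdt₁⟩ := hcon
  have hcomp : IsCompact (Icc a b ∩ d ⁻¹' Iic 0) :=
    isCompact_Icc.of_isClosed_subset (hd.preimage_isClosed_of_isClosed isClosed_Icc isClosed_Iic)
      inter_subset_left
  obtain ⟨t₀, ⟨⟨hat₀, ht₀b⟩, hdt₀⟩, hmin⟩ := hcomp.exists_isLeast ⟨t₁, ht₁, hdt₁⟩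
  have hdt₀ : d t₀ ≤ 0 := hdt₀
  have hpos : ∀ s, a ≤ s → s < t₀ → 0 < d s := by
    intro s has hst
    by_contra! hs
    exact absurd (hmin ⟨⟨has, by linarith⟩, hs⟩) (not_le.2 hst)
  have hat₀ : a < t₀ := by
    rcases hat₀.eq_or_lt with h | h
    · have := heq t₀ ⟨hat₀, ht₀b⟩
      rw [← h, intervalIntegral.integral_same] at this
      rw [← h] at hdt₀
      linarith
    · exact h
  have hκ₀ : 0 < κ (t₀ - a) := hκ.pos _ (sub_pos.2 hat₀)
  have key : ∀ t, a < t → t < t₀ →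
      κ (t₀ - a) * d t ≤ c * κ (t - a) * ∫ s in t..t₀, κ (t₀ - s) * d s := by
    intro t hat htt₀
    have hda : ContinuousOn d (Icc a t) := hd.mono (Icc_subset_Icc_right (by linarith))
    have hda₀ : ContinuousOn d (Icc a t₀) := hd.mono (Icc_subset_Icc_right ht₀b)
    have hi := hκ.intervalIntegrable_mul hat₀.le hda₀
    have hi₁ : IntervalIntegrable (fun s => κ (t₀ - s) * d s) volume a t :=
      hi.mono_set (by rw [uIcc_of_le hat.le, uIcc_of_le hat₀.le]; exact Icc_subset_Icc_right htt₀.le)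
    have hi₂ : IntervalIntegrable (fun s => κ (t₀ - s) * d s) volume t t₀ :=
      hi.mono_set (by rw [uIcc_of_le htt₀.le, uIcc_of_le hat₀.le]; exact Icc_subset_Icc_left hat.le)
    have hsplit := intervalIntegral.integral_add_adjacent_intervals hi₁ hi₂
    have hmono : κ (t - a) * ∫ s in a..t, κ (t₀ - s) * d s
        ≤ κ (t₀ - a) * ∫ s in a..t, κ (t - s) * d s := by
      rw [← intervalIntegral.integral_const_mul, ← intervalIntegral.integral_const_mul]
      refine intervalIntegral.integral_mono_on_of_le_Ioo hat.le (hi₁.const_mul _)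
        ((hκ.intervalIntegrable_mul hat.le hda).const_mul _) fun s hs => ?_
      have h1 := hκ.mul_le_mul (t - s) (t - a) (t₀ - t) (sub_pos.2 hs.2) (by linarith [hs.1])
        (by linarith)
      rw [show t - s + (t₀ - t) = t₀ - s by ring, show t - a + (t₀ - t) = t₀ - a by ring] at h1
      have := mul_le_mul_of_nonneg_right h1 (hpos s hs.1.le (hs.2.trans htt₀)).le
      linarith
    have e₁ := heq t ⟨hat.le, by linarith⟩
    have e₂ := heq t₀ ⟨hat₀.le, ht₀b⟩
    rw [← hsplit] at e₂
    have h2 := hf t t₀ hat htt₀.le ht₀b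
    have hκt : 0 < κ (t - a) := hκ.pos _ (sub_pos.2 hat)
    have h3 := mul_le_mul_of_nonneg_left hmono hc
    have h4 : κ (t - a) * d t₀ ≤ 0 := mul_nonpos_of_nonneg_of_nonpos hκt.le hdt₀
    rw [e₂] at h4
    rw [e₁]
    linarith
  -- near `t₀` the remaining integral is too small
  have hlim₁ : Tendsto (fun m => ∫ u in (0 : ℝ)..(t₀ - m), κ u) (nhdsWithin t₀ (Iio t₀))
      (nhds 0) := by
    have h1 : ContinuousOn (fun x => ∫ u in (0 : ℝ)..x, κ u) (uIcc 0 (t₀ - a)) := by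
      refine intervalIntegral.continuousOn_primitive_interval ?_
      rw [uIcc_of_le (by linarith), integrableOn_Icc_iff_integrableOn_Ioc,
        ← intervalIntegrable_iff_integrableOn_Ioc_of_le (by linarith)]
      exact hκ.intervalIntegrable _ (by linarith)
    have h2 := h1 0 left_mem_uIcc
    rw [ContinuousWithinAt, intervalIntegral.integral_same] at h2
    refine h2.comp (tendsto_nhdsWithin_iff.2 ⟨?_, ?_⟩)
    · have : Tendsto (fun m => t₀ - m) (nhds t₀) (nhds (t₀ - t₀)) := by
        exact (continuous_const.sub continuous_id).tendsto t₀
      rw [sub_self] at this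
      exact this.mono_left nhdsWithin_le_nhds
    · filter_upwards [Ioo_mem_nhdsLT hat₀] with m hm
      rw [uIcc_of_le (by linarith)]
      exact ⟨by linarith [hm.2], by linarith [hm.1]⟩
  have hlim₂ : ∀ᶠ m in nhdsWithin t₀ (Iio t₀),
      c * (2 * κ (t₀ - a)) * (∫ u in (0 : ℝ)..(t₀ - m), κ u) < κ (t₀ - a) := by
    refine (hlim₁.const_mul _).eventually_lt_const ?_
    simpa using hκ₀
  have hcont : ∀ᶠ m in nhds t₀, κ (m - a) < 2 * κ (t₀ - a) := by
    have : ContinuousAt (fun m => κ (m - a)) t₀ :=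
      ContinuousAt.comp (g := κ)
        (hκ.continuousOn.continuousAt (Ioi_mem_nhds (sub_pos.2 hat₀))) (by fun_prop)
    exact this.eventually_lt_const (by linarith)
  obtain ⟨l, hl, hl'⟩ := (mem_nhdsLE_iff_exists_Ioc_subset' hat₀).1
    (mem_nhdsWithin_of_mem_nhds hcont)
  obtain ⟨m, hm, hm₁, hm₂⟩ := (hlim₂.and (Ioo_mem_nhdsLT (max_lt hat₀ hl))).exists
  have ham : a < m := (le_max_left _ _).trans_lt hm₁
  have hlm : l < m := (le_max_right _ _).trans_lt hm₁
  obtain ⟨t, ht, htmax⟩ := (isCompact_Icc (a := m) (b := t₀)).exists_isMaxOn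
    (nonempty_Icc.2 hm₂.le) (hd.mono (Icc_subset_Icc ham.le ht₀b))
  have hdm : 0 < d m := hpos m ham.le hm₂
  have hdt : 0 < d t := hdm.trans_le (htmax (left_mem_Icc.2 hm₂.le))
  have htt₀ : t < t₀ := lt_of_le_of_ne ht.2 fun h => by rw [h] at hdt; linarith
  have hat : a < t := ham.trans_le ht.1
  have hκt : 0 < κ (t - a) := hκ.pos _ (sub_pos.2 hat)
  have hκt2 : κ (t - a) < 2 * κ (t₀ - a) := hl' ⟨by linarith [ht.1], ht.2⟩
  have hI : ∫ s in t..t₀, κ (t₀ - s) * d s ≤ d t * ∫ u in (0 : ℝ)..(t₀ - m), κ u := by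
    have h1 : ∫ s in t..t₀, κ (t₀ - s) * d s ≤ ∫ s in t..t₀, κ (t₀ - s) * d t := by
      refine intervalIntegral.integral_mono_on_of_le_Ioo htt₀.le
        (hκ.intervalIntegrable_mul htt₀.le (hd.mono (Icc_subset_Icc hat.le ht₀b)))
        ((hκ.intervalIntegrable_comp_sub htt₀.le).mul_const _) fun s hs => ?_
      exact mul_le_mul_of_nonneg_left (htmax ⟨ht.1.trans hs.1.le, hs.2.le⟩)
        (hκ.pos _ (sub_pos.2 hs.2)).le
    have h2 : ∫ s in t..t₀, κ (t₀ - s) * d t = d t * ∫ u in (0 : ℝ)..(t₀ - t), κ u := by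
      rw [intervalIntegral.integral_mul_const,
        intervalIntegral.integral_comp_sub_left (fun u => κ u) t₀, sub_self, mul_comm]
    have h3 : ∫ u in (0 : ℝ)..(t₀ - t), κ u ≤ ∫ u in (0 : ℝ)..(t₀ - m), κ u := by
      refine intervalIntegral.integral_mono_interval le_rfl (by linarith) (by linarith [ht.1]) ?_
        (hκ.intervalIntegrable _ (by linarith))
      filter_upwards [ae_restrict_mem measurableSet_Ioc] with u hu using (hκ.pos u hu.1).le
    rw [h2] at h1
    exact h1.trans (mul_le_mul_of_nonneg_left h3 hdt.le)
  have hJ : 0 ≤ ∫ u in (0 : ℝ)..(t₀ - m), κ u :=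
    intervalIntegral.integral_nonneg_of_ae_restrict (by linarith) (by
      filter_upwards [ae_restrict_mem measurableSet_Icc, ae_restrict_of_ae
        (compl_mem_ae_iff.2 (measure_singleton (0 : ℝ)))] with u hu hu0
      exact (hκ.pos u (lt_of_le_of_ne hu.1 (Ne.symm hu0))).le)
  have h5 := key t hat htt₀
  have h6 := mul_le_mul_of_nonneg_left hI (mul_nonneg hc hκt.le)
  have h7 : c * κ (t - a) * (d t * ∫ u in (0 : ℝ)..(t₀ - m), κ u)
      ≤ c * (2 * κ (t₀ - a)) * (d t * ∫ u in (0 : ℝ)..(t₀ - m), κ u) :=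
    mul_le_mul_of_nonneg_right (mul_le_mul_of_nonneg_left hκt2.le hc) (mul_nonneg hdt.le hJ)
  have h8 := mul_lt_mul_of_pos_right hm hdt
  linarith

end IsLogConvexKernel

namespace IsLogConvexKernel

variable {κ : ℝ → ℝ}

theorem intervalIntegrable_mul_self (hκ : IsLogConvexKernel κ) {t : ℝ} (ht : 0 < t) :
    IntervalIntegrable (fun s => κ (t - s) * κ s) volume 0 t := by
  have h1 : IntervalIntegrable (fun s => κ (t - s) * κ s) volume 0 (t / 2) := by
    refine (hκ.intervalIntegrable _ (by linarith)).continuousOn_mul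
      ((hκ.continuousOn_comp_sub t).mono ?_)
    rw [uIcc_of_le (by linarith)]
    intro s hs
    exact mem_Iio.2 (by linarith [hs.2])
  have h2 := h1.comp_sub_left t
  simp only [sub_sub_cancel, sub_zero, sub_half] at h2
  refine h1.trans ?_
  simpa only [mul_comm] using h2.symm

theorem intervalIntegrable_mul_of_le (hκ : IsLogConvexKernel κ) {b t : ℝ} {r : ℝ → ℝ}
    (hm : AEStronglyMeasurable r (volume.restrict (Ioc 0 b)))
    (hr : ∀ s ∈ Ioc 0 b, 0 ≤ r s ∧ r s ≤ κ s) (ht : 0 < t) (htb : t ≤ b) :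
    IntervalIntegrable (fun s => κ (t - s) * r s) volume 0 t := by
  refine (hκ.intervalIntegrable_mul_self ht).mono_fun' ?_ ?_
  · refine (hκ.intervalIntegrable_comp_sub ht.le).def'.aestronglyMeasurable.mul ?_
    rw [uIoc_of_le ht.le]
    exact hm.mono_measure (Measure.restrict_mono_set _ (Ioc_subset_Ioc_right htb))
  · rw [uIoc_of_le ht.le]
    filter_upwards [ae_restrict_mem measurableSet_Ioc, ae_restrict_of_ae
      (compl_mem_ae_iff.2 (measure_singleton t))] with s hs hst
    have hst : s < t := lt_of_le_of_ne hs.2 hst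
    have h1 := hr s ⟨hs.1, hs.2.trans htb⟩
    have h2 := hκ.pos _ (sub_pos.2 hst)
    rw [Real.norm_of_nonneg (mul_nonneg h2.le h1.1)]
    exact mul_le_mul_of_nonneg_left h1.2 h2.le

theorem integral_nonneg_of_nonneg (hκ : IsLogConvexKernel κ) {a t : ℝ} (h : a ≤ t) {r : ℝ → ℝ}
    (hr : ∀ s ∈ Ioc a t, 0 ≤ r s) : 0 ≤ ∫ s in a..t, κ (t - s) * r s := by
  rw [intervalIntegral.integral_of_le h]
  refine integral_nonneg_of_ae ?_
  filter_upwards [ae_restrict_mem measurableSet_Ioc, ae_restrict_of_ae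
    (compl_mem_ae_iff.2 (measure_singleton t))] with s hs hst
  exact mul_nonneg (hκ.pos _ (sub_pos.2 (lt_of_le_of_ne hs.2 hst))).le (hr s hs)

/-- A nonnegative solution of the resolvent equation started at time `0` lies below the solution
started at a positive time. -/
theorem le_of_volterra (hκ : IsLogConvexKernel κ) {ε b c : ℝ} (hε : 0 < ε) (hc : 0 ≤ c)
    {y r : ℝ → ℝ} (hy : ContinuousOn y (Icc ε b))
    (hyeq : ∀ t ∈ Icc ε b, y t = κ t - c * ∫ s in ε..t, κ (t - s) * y s)
    (hm : AEStronglyMeasurable r (volume.restrict (Ioc 0 b)))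
    (hr : ∀ s ∈ Ioc 0 b, 0 ≤ r s ∧ r s ≤ κ s) (hrc : ContinuousOn r (Icc ε b))
    (hreq : ∀ t ∈ Icc ε b, r t = κ t - c * ∫ s in (0 : ℝ)..t, κ (t - s) * r s) :
    ∀ t ∈ Icc ε b, r t ≤ y t := by
  have hi : ∀ t ∈ Icc ε b, IntervalIntegrable (fun s => κ (t - s) * r s) volume 0 ε := by
    intro t ht
    refine (hκ.intervalIntegrable_mul_of_le hm hr (hε.trans_le ht.1) ht.2).mono_set ?_
    rw [uIcc_of_le hε.le, uIcc_of_le (hε.le.trans ht.1)]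
    exact Icc_subset_Icc_right ht.1
  have key : ∀ η > 0, ∀ t ∈ Icc ε b, 0 < (1 + η) * y t - r t := by
    intro η hη
    by_cases hεb : ε ≤ b
    swap
    · intro t ht
      exact absurd (ht.1.trans ht.2) hεb
    refine hκ.pos_of_volterra hc
      (f := fun t => η * κ t + c * ∫ s in (0 : ℝ)..ε, κ (t - s) * r s)
      ((continuousOn_const.mul hy).sub hrc) ?_ ?_ ?_
    · intro t ht
      have hrt := hrc.mono (Icc_subset_Icc_right ht.2)
      have hyt := hy.mono (Icc_subset_Icc_right ht.2)
      have h1 : ∫ s in ε..t, κ (t - s) * ((1 + η) * y s - r s)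
          = (1 + η) * (∫ s in ε..t, κ (t - s) * y s) - ∫ s in ε..t, κ (t - s) * r s := by
        rw [← intervalIntegral.integral_const_mul, ← intervalIntegral.integral_sub
          ((hκ.intervalIntegrable_mul ht.1 hyt).const_mul _) (hκ.intervalIntegrable_mul ht.1 hrt)]
        congr 1
        ext s
        ring
      have h2 := intervalIntegral.integral_add_adjacent_intervals (hi t ht)
        (hκ.intervalIntegrable_mul ht.1 hrt)
      rw [h1, hyeq t ht, hreq t ht, ← h2]
      ring
    · have h1 : 0 ≤ ∫ s in (0 : ℝ)..ε, κ (ε - s) * r s :=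
        hκ.integral_nonneg_of_nonneg hε.le fun s hs => (hr s ⟨hs.1, hs.2.trans hεb⟩).1
      have h2 := mul_pos hη (hκ.pos ε hε)
      have h3 := mul_nonneg hc h1
      linarith
    · intro t t' hat htt' htb
      have h1 : κ t * κ (t' - ε) ≤ κ t' * κ (t - ε) := by
        have := hκ.mul_le_mul (t - ε) t (t' - t) (sub_pos.2 hat) (by linarith) (by linarith)
        rw [show t - ε + (t' - t) = t' - ε by ring, show t + (t' - t) = t' by ring] at this
        linarith
      have h2 : (∫ s in (0 : ℝ)..ε, κ (t - s) * r s) * κ (t' - ε)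
          ≤ (∫ s in (0 : ℝ)..ε, κ (t' - s) * r s) * κ (t - ε) := by
        rw [← intervalIntegral.integral_mul_const, ← intervalIntegral.integral_mul_const]
        refine intervalIntegral.integral_mono_on_of_le_Ioo hε.le
          ((hi t ⟨hat.le, htt'.trans htb⟩).mul_const _)
          ((hi t' ⟨hat.le.trans htt', htb⟩).mul_const _) fun s hs => ?_
        have h3 := hκ.mul_le_mul (t - ε) (t - s) (t' - t) (sub_pos.2 hat) (by linarith [hs.2])
          (by linarith)
        rw [show t - ε + (t' - t) = t' - ε by ring, show t - s + (t' - t) = t' - s by ring] at h3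
        have := mul_le_mul_of_nonneg_right h3 (hr s ⟨hs.1, hs.2.le.trans hεb⟩).1
        linarith
      have h4 := mul_le_mul_of_nonneg_left h1 hη.le
      have h5 := mul_le_mul_of_nonneg_left h2 hc
      linarith
  intro t ht
  refine le_of_forall_pos_lt_add fun e he => ?_
  have h1 : 0 < |y t| + 1 := by positivity
  have h2 := key (e / (|y t| + 1)) (by positivity) t ht
  have h3 : e / (|y t| + 1) * y t ≤ e / (|y t| + 1) * (|y t| + 1) :=
    mul_le_mul_of_nonneg_left (by linarith [le_abs_self (y t)]) (by positivity)
  rw [div_mul_cancel₀ _ h1.ne'] at h3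
  linarith

theorem exists_truncated_solution (hκ : IsLogConvexKernel κ) {ε b c : ℝ} (hε : 0 < ε)
    (hεb : ε ≤ b) (hc : 0 ≤ c) :
    ∃ r : ℝ → ℝ, AEStronglyMeasurable r (volume.restrict (Ioc 0 b)) ∧
      (∀ s ∈ Ioc 0 b, 0 ≤ r s ∧ r s ≤ κ s) ∧ ContinuousOn r (Icc ε b) ∧
      (∀ t ∈ Icc ε b, r t = κ t - c * ∫ s in ε..t, κ (t - s) * r s) ∧
      ∀ t ∈ Icc ε b, r t = κ t - c * ∫ s in (0 : ℝ)..t, κ (t - s) * r s := by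
  obtain ⟨y, hy, hyeq⟩ := exists_volterra_solution hεb
    (hκ.intervalIntegrable _ (sub_nonneg.2 hεb))
    (hκ.continuousOn.mono fun t ht => mem_Ioi.2 (hε.trans_le ht.1)) c
  have hpos : ∀ t ∈ Icc ε b, 0 < y t := by
    refine hκ.pos_of_volterra hc hy hyeq (hκ.pos ε hε) fun t t' hat htt' htb => ?_
    have := hκ.mul_le_mul (t - ε) t (t' - t) (sub_pos.2 hat) (by linarith) (by linarith)
    rw [show t - ε + (t' - t) = t' - ε by ring, show t + (t' - t) = t' by ring] at this
    linarith
  have hle : ∀ t ∈ Icc ε b, y t ≤ κ t := by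
    intro t ht
    have := mul_nonneg hc (hκ.integral_nonneg_of_nonneg ht.1
      fun s hs => (hpos s ⟨hs.1.le, hs.2.trans ht.2⟩).le)
    linarith [hyeq t ht]
  have hmem : ∀ s, s ∈ Icc ε b → (Icc ε b).indicator y s = y s :=
    fun s hs => indicator_of_mem hs y
  have heq : ∀ t ∈ Icc ε b, (Icc ε b).indicator y t
      = κ t - c * ∫ s in ε..t, κ (t - s) * (Icc ε b).indicator y s := by
    intro t ht
    rw [hmem t ht, hyeq t ht]
    congr 2
    refine intervalIntegral.integral_congr fun s hs => ?_
    rw [uIcc_of_le ht.1] at hs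
    rw [hmem s ⟨hs.1, hs.2.trans ht.2⟩]
  have hmeas : AEStronglyMeasurable ((Icc ε b).indicator y) (volume.restrict (Ioc 0 b)) :=
    ((aestronglyMeasurable_indicator_iff measurableSet_Icc).2
      (hy.aestronglyMeasurable measurableSet_Icc)).restrict
  have hbd : ∀ s ∈ Ioc 0 b,
      0 ≤ (Icc ε b).indicator y s ∧ (Icc ε b).indicator y s ≤ κ s := by
    intro s hs
    by_cases h : s ∈ Icc ε b
    · rw [hmem s h]
      exact ⟨(hpos s h).le, hle s h⟩
    · rw [indicator_of_notMem h]
      exact ⟨le_rfl, (hκ.pos s hs.1).le⟩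
  refine ⟨_, hmeas, hbd, hy.congr hmem, heq, fun t ht => ?_⟩
  have hi := hκ.intervalIntegrable_mul_of_le hmeas hbd (hε.trans_le ht.1) ht.2
  rw [heq t ht, ← intervalIntegral.integral_add_adjacent_intervals (a := 0) (b := ε) (c := t)
    (hi.mono_set (by
      rw [uIcc_of_le hε.le, uIcc_of_le (hε.le.trans ht.1)]; exact Icc_subset_Icc_right ht.1))
    (hi.mono_set (by
      rw [uIcc_of_le ht.1, uIcc_of_le (hε.le.trans ht.1)]; exact Icc_subset_Icc_left hε.le))]
  have : ∫ s in (0 : ℝ)..ε, κ (t - s) * (Icc ε b).indicator y s = 0 := by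
    rw [intervalIntegral.integral_of_le hε.le,
      ← integral_Ico_eq_integral_Ioc]
    refine setIntegral_eq_zero_of_forall_eq_zero fun s hs => ?_
    rw [indicator_of_notMem fun h => absurd h.1 (not_le.2 hs.2), mul_zero]
  rw [this, zero_add]

theorem continuousOn_convolution_of_le (hκ : IsLogConvexKernel κ) {b : ℝ} {r : ℝ → ℝ}
    (hm : AEStronglyMeasurable r (volume.restrict (Ioc 0 b)))
    (hr : ∀ s ∈ Ioc 0 b, 0 ≤ r s ∧ r s ≤ κ s) :
    ContinuousOn (fun t => ∫ s in (0 : ℝ)..t, κ (t - s) * r s) (Ioc 0 b) := by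
  refine continuousOn_of_locally_uniform_approx_of_continuousWithinAt fun x hx u hu => ?_
  obtain ⟨e, he, heu⟩ := Metric.mem_uniformity_dist.1 hu
  have hx0 : 0 < x := hx.1
  have hb0 : 0 ≤ b := hx.1.le.trans hx.2
  obtain ⟨M, hM⟩ := (isCompact_Icc (a := x / 4) (b := b)).exists_bound_of_continuousOn
    (hκ.continuousOn.mono fun t ht => mem_Ioi.2 (by linarith [ht.1]))
  obtain ⟨δ, hδe, hδ0, hδx⟩ : ∃ δ, M * (∫ u in (0 : ℝ)..δ, κ u) < e ∧ 0 < δ ∧ δ < x / 4 := by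
    have h1 : ContinuousOn (fun x => ∫ u in (0 : ℝ)..x, κ u) (uIcc 0 b) := by
      refine intervalIntegral.continuousOn_primitive_interval ?_
      rw [uIcc_of_le hb0, integrableOn_Icc_iff_integrableOn_Ioc,
        ← intervalIntegrable_iff_integrableOn_Ioc_of_le hb0]
      exact hκ.intervalIntegrable _ hb0
    have h2 := h1 0 left_mem_uIcc
    rw [ContinuousWithinAt, intervalIntegral.integral_same, uIcc_of_le hb0] at h2
    have h3 : nhdsWithin (0 : ℝ) (Ioi 0) ≤ nhdsWithin 0 (Icc 0 b) := by
      rw [← nhdsWithin_Ioo_eq_nhdsGT (hx0.trans_le hx.2)]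
      exact nhdsWithin_mono _ Ioo_subset_Icc_self
    have h4 := ((h2.mono_left h3).const_mul M).eventually_lt_const (u := e) (by simpa using he)
    obtain ⟨δ, h5, h6⟩ := (h4.and (Ioo_mem_nhdsGT (show 0 < x / 4 by linarith))).exists
    exact ⟨δ, h5, h6.1, h6.2⟩
  have hδb : δ ≤ b := by linarith [hx.2]
  set g : ℝ → ℝ := (Ioc 0 b).indicator r with hg
  set K : ℝ → ℝ := (Ici δ).indicator fun u => κ (max δ (min u b)) with hK
  have hclamp : ∀ u, max δ (min u b) ∈ Icc δ b :=
    fun u => ⟨le_max_left _ _, max_le hδb (min_le_right _ _)⟩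
  have hKc : Continuous fun u => κ (max δ (min u b)) := by
    refine hκ.continuousOn.comp_continuous (by fun_prop) fun u => ?_
    exact mem_Ioi.2 (hδ0.trans_le (hclamp u).1)
  obtain ⟨C, hC⟩ := (isCompact_Icc (a := δ) (b := b)).exists_bound_of_continuousOn
    (hκ.continuousOn.mono fun t ht => mem_Ioi.2 (hδ0.trans_le ht.1))
  have hgi : Integrable g := by
    rw [hg, integrable_indicator_iff measurableSet_Ioc]
    refine Integrable.mono' ((intervalIntegrable_iff_integrableOn_Ioc_of_le hb0).1
      (hκ.intervalIntegrable _ hb0)) hm ?_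
    filter_upwards [ae_restrict_mem measurableSet_Ioc] with s hs
    rw [Real.norm_of_nonneg (hr s hs).1]
    exact (hr s hs).2
  have hF : Continuous fun t => ∫ s, g s * K (t - s) := by
    refine continuous_integral_mul_comp_sub (a := δ) (C := C) hgi
      (hKc.measurable.indicator measurableSet_Ici) (fun s => ?_) fun s hs => ?_
    · have h1 := hC _ (hclamp s)
      by_cases h : s ∈ Ici δ
      · rw [hK, indicator_of_mem h]
        exact h1
      · rw [hK, indicator_of_notMem h, abs_zero]
        exact (norm_nonneg _).trans h1
    · rcases lt_or_gt_of_ne hs with h | h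
      · refine (continuousAt_const (y := (0 : ℝ))).congr ?_
        filter_upwards [Iio_mem_nhds h] with x hx
        exact (indicator_of_notMem (by simpa using hx) _).symm
      · refine hKc.continuousAt.congr ?_
        filter_upwards [Ioi_mem_nhds h] with x hx
        rw [hK, indicator_of_mem (mem_Ici.2 (mem_Ioi.1 hx).le)]
  refine ⟨Ioc (x / 2) b, ?_, _, hF.continuousWithinAt, fun t ht => heu ?_⟩
  · filter_upwards [self_mem_nhdsWithin, mem_nhdsWithin_of_mem_nhds
      (Ioi_mem_nhds (show x / 2 < x by linarith))] with t ht ht'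
    exact ⟨ht', ht.2⟩
  · have ht0 : 0 < t := by linarith [ht.1]
    have hδt : 0 ≤ t - δ := by linarith [ht.1]
    have h1 : ∫ s, g s * K (t - s) = ∫ s in (0 : ℝ)..(t - δ), κ (t - s) * r s := by
      rw [intervalIntegral.integral_of_le hδt, ← integral_indicator measurableSet_Ioc]
      congr 1
      ext s
      by_cases hs : s ∈ Ioc 0 (t - δ)
      · have hs1 : s ∈ Ioc 0 b := ⟨hs.1, by linarith [hs.2, ht.2]⟩
        have hs2 : t - s ∈ Ici δ := mem_Ici.2 (by linarith [hs.2])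
        rw [indicator_of_mem hs, hg, indicator_of_mem hs1, hK, indicator_of_mem hs2,
          min_eq_left (by linarith [hs.1, ht.2]), max_eq_right hs2, mul_comm]
      · rw [indicator_of_notMem hs]
        by_cases hs1 : s ∈ Ioc 0 b
        · have hs2 : t - s ∉ Ici δ := fun h => hs ⟨hs1.1, by linarith [mem_Ici.1 h]⟩
          rw [hK, indicator_of_notMem hs2, mul_zero]
        · rw [hg, indicator_of_notMem hs1, zero_mul]
    have hi := hκ.intervalIntegrable_mul_of_le hm hr ht0 ht.2
    have hi₂ : IntervalIntegrable (fun s => κ (t - s) * r s) volume (t - δ) t :=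
      hi.mono_set (by
        rw [uIcc_of_le (by linarith), uIcc_of_le ht0.le]; exact Icc_subset_Icc_left hδt)
    have h2 := intervalIntegral.integral_add_adjacent_intervals (hi.mono_set (by
        rw [uIcc_of_le hδt, uIcc_of_le ht0.le]; exact Icc_subset_Icc_right (by linarith))) hi₂
    have h3 : 0 ≤ ∫ s in (t - δ)..t, κ (t - s) * r s :=
      hκ.integral_nonneg_of_nonneg (by linarith) fun s hs =>
        (hr s ⟨by linarith [hs.1], hs.2.trans ht.2⟩).1
    have h4 : ∫ s in (t - δ)..t, κ (t - s) * r s ≤ M * ∫ u in (0 : ℝ)..δ, κ u := by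
      have h5 : ∫ s in (t - δ)..t, κ (t - s) * M = M * ∫ u in (0 : ℝ)..δ, κ u := by
        rw [intervalIntegral.integral_mul_const,
          intervalIntegral.integral_comp_sub_left (fun u => κ u) t, sub_self, sub_sub_cancel,
          mul_comm]
      rw [← h5]
      refine intervalIntegral.integral_mono_on_of_le_Ioo (by linarith) hi₂
        ((hκ.intervalIntegrable_comp_sub (by linarith)).mul_const _) fun s hs => ?_
      have hs1 : s ∈ Ioc 0 b := ⟨by linarith [hs.1], hs.2.le.trans ht.2⟩
      refine mul_le_mul_of_nonneg_left ((hr s hs1).2.trans ?_) (hκ.pos _ (sub_pos.2 hs.2)).le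
      exact (le_abs_self _).trans (hM s ⟨by linarith [hs.1, ht.1], hs1.2⟩)
    rw [h1, ← h2, Real.dist_eq, add_sub_cancel_left, abs_of_nonneg h3]
    exact h4.trans_lt hδe

end IsLogConvexKernel

/-- `r` is a nonnegative continuous solution of `r + c (κ ⋆ r) = κ` on `(0, b]`. -/
structure IsResolventOn (κ : ℝ → ℝ) (c b : ℝ) (r : ℝ → ℝ) : Prop where
  nonneg : ∀ t ∈ Ioc 0 b, 0 ≤ r t
  continuousOn : ContinuousOn r (Ioc 0 b)
  eq : ∀ t ∈ Ioc 0 b, r t = κ t - c * ∫ s in (0 : ℝ)..t, κ (t - s) * r s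

namespace IsResolventOn

variable {κ r : ℝ → ℝ} {b c : ℝ}

theorem mono (h : IsResolventOn κ c b r) {b' : ℝ} (hb : b' ≤ b) : IsResolventOn κ c b' r :=
  ⟨fun t ht => h.nonneg t ⟨ht.1, ht.2.trans hb⟩, h.continuousOn.mono (Ioc_subset_Ioc_right hb),
    fun t ht => h.eq t ⟨ht.1, ht.2.trans hb⟩⟩

theorem bounds (h : IsResolventOn κ c b r) (hκ : IsLogConvexKernel κ) (hc : 0 ≤ c) :
    ∀ t ∈ Ioc 0 b, 0 ≤ r t ∧ r t ≤ κ t := by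
  intro t ht
  refine ⟨h.nonneg t ht, ?_⟩
  have := mul_nonneg hc (hκ.integral_nonneg_of_nonneg ht.1.le
    fun s hs => h.nonneg s ⟨hs.1, hs.2.trans ht.2⟩)
  linarith [h.eq t ht]

theorem aestronglyMeasurable (h : IsResolventOn κ c b r) :
    AEStronglyMeasurable r (volume.restrict (Ioc 0 b)) :=
  h.continuousOn.aestronglyMeasurable measurableSet_Ioc

end IsResolventOn

namespace IsLogConvexKernel

variable {κ : ℝ → ℝ}

theorem exists_unique_isResolventOn (hκ : IsLogConvexKernel κ) {b c : ℝ} (hb : 0 < b)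
    (hc : 0 ≤ c) :
    ∃ r, IsResolventOn κ c b r ∧ ∀ ρ, IsResolventOn κ c b ρ → ∀ t ∈ Ioc 0 b, ρ t = r t := by
  set ε : ℕ → ℝ := fun n => b / (n + 1) with hεdef
  have hε0 : ∀ n, 0 < ε n := fun n => by positivity
  have hεb : ∀ n, ε n ≤ b := fun n => div_le_self hb.le (by
    have : (0 : ℝ) ≤ n := n.cast_nonneg
    linarith)
  have hεanti : Antitone ε := fun n m hnm => by
    refine div_le_div_of_nonneg_left hb.le (by positivity) ?_
    have : (n : ℝ) ≤ m := by exact_mod_cast hnm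
    linarith
  have hεev : ∀ t > 0, ∀ᶠ n in atTop, ε n ≤ t := by
    intro t ht
    have : Tendsto ε atTop (nhds 0) :=
      tendsto_const_div_atTop_nhds_zero_nat b |>.comp (tendsto_add_atTop_nat 1) |>.congr
        fun n => by simp [hεdef]
    exact (this.eventually_lt_const ht).mono fun n hn => hn.le
  choose y hym hyb hyc hyε hy0 using
    fun n => hκ.exists_truncated_solution (c := c) (hε0 n) (hεb n) hc
  have hanti : ∀ t ∈ Ioc 0 b, ∀ n m, n ≤ m → ε n ≤ t → y m t ≤ y n t := by
    intro t ht n m hnm hnt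
    refine hκ.le_of_volterra (hε0 n) hc (hyc n) (hyε n) (hym m) (hyb m)
      ((hyc m).mono (Icc_subset_Icc_left (hεanti hnm)))
      (fun s hs => hy0 m s ⟨(hεanti hnm).trans hs.1, hs.2⟩) t ⟨hnt, ht.2⟩
  have hlim : ∀ t ∈ Ioc 0 b, ∃ l, Tendsto (fun n => y n t) atTop (nhds l) := by
    intro t ht
    obtain ⟨N, hN⟩ := eventually_atTop.1 (hεev t ht.1)
    refine ⟨⨅ n, y (n + N) t, (tendsto_add_atTop_iff_nat N).1 (tendsto_atTop_ciInf ?_ ?_)⟩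
    · intro n m hnm
      exact hanti t ht _ _ (by omega) (hN _ (by omega))
    · exact ⟨0, by rintro _ ⟨n, rfl⟩; exact (hyb (n + N) t ht).1⟩
  choose! r hr using hlim
  have hrm : AEStronglyMeasurable r (volume.restrict (Ioc 0 b)) := by
    refine aestronglyMeasurable_of_tendsto_ae atTop hym ?_
    filter_upwards [ae_restrict_mem measurableSet_Ioc] with t ht using hr t ht
  have hrb : ∀ t ∈ Ioc 0 b, 0 ≤ r t ∧ r t ≤ κ t := fun t ht =>
    ⟨ge_of_tendsto' (hr t ht) fun n => (hyb n t ht).1,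
      le_of_tendsto' (hr t ht) fun n => (hyb n t ht).2⟩
  have hreq : ∀ t ∈ Ioc 0 b, r t = κ t - c * ∫ s in (0 : ℝ)..t, κ (t - s) * r s := by
    intro t ht
    have h1 : Tendsto (fun n => ∫ s in (0 : ℝ)..t, κ (t - s) * y n s) atTop
        (nhds (∫ s in (0 : ℝ)..t, κ (t - s) * r s)) := by
      refine intervalIntegral.tendsto_integral_filter_of_dominated_convergence
        (fun s => κ (t - s) * κ s) ?_ ?_ (hκ.intervalIntegrable_mul_self ht.1) ?_
      · exact Eventually.of_forall fun n =>
          (hκ.intervalIntegrable_mul_of_le (hym n) (hyb n) ht.1 ht.2).def'.aestronglyMeasurable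
      · refine Eventually.of_forall fun n => ?_
        filter_upwards [compl_mem_ae_iff.2 (measure_singleton (μ := volume) t)] with s hst hs
        rw [uIoc_of_le ht.1.le] at hs
        have h2 := hyb n s ⟨hs.1, hs.2.trans ht.2⟩
        have h3 := (hκ.pos _ (sub_pos.2 (lt_of_le_of_ne hs.2 hst))).le
        rw [Real.norm_of_nonneg (mul_nonneg h3 h2.1)]
        exact mul_le_mul_of_nonneg_left h2.2 h3
      · refine Eventually.of_forall fun s hs => ?_
        rw [uIoc_of_le ht.1.le] at hs
        exact (hr s ⟨hs.1, hs.2.trans ht.2⟩).const_mul _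
    refine tendsto_nhds_unique (hr t ht) (((h1.const_mul c).const_sub (κ t)).congr' ?_)
    filter_upwards [hεev t ht.1] with n hn
    exact (hy0 n t ⟨hn, ht.2⟩).symm
  have hrc : ContinuousOn r (Ioc 0 b) := by
    refine ContinuousOn.congr ?_ hreq
    exact (hκ.continuousOn.mono fun t ht => ht.1).sub
      (continuousOn_const.mul (hκ.continuousOn_convolution_of_le hrm hrb))
  refine ⟨r, ⟨fun t ht => (hrb t ht).1, hrc, hreq⟩, fun ρ hρ => ?_⟩
  have hρb := hρ.bounds hκ hc
  have hle : ∀ t ∈ Ioc 0 b, ρ t ≤ r t := by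
    intro t ht
    refine ge_of_tendsto (hr t ht) ?_
    filter_upwards [hεev t ht.1] with n hn
    exact hκ.le_of_volterra (hε0 n) hc (hyc n) (hyε n) hρ.aestronglyMeasurable hρb
      (hρ.continuousOn.mono fun s hs => ⟨(hε0 n).trans_le hs.1, hs.2⟩)
      (fun s hs => hρ.eq s ⟨(hε0 n).trans_le hs.1, hs.2⟩) t ⟨hn, ht.2⟩
  intro t ht
  refine le_antisymm (hle t ht) ?_
  rw [hreq t ht, hρ.eq t ht]
  refine sub_le_sub_left (mul_le_mul_of_nonneg_left ?_ hc) _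
  refine intervalIntegral.integral_mono_on_of_le_Ioo ht.1.le
    (hκ.intervalIntegrable_mul_of_le hρ.aestronglyMeasurable hρb ht.1 ht.2)
    (hκ.intervalIntegrable_mul_of_le hrm hrb ht.1 ht.2) fun s hs => ?_
  exact mul_le_mul_of_nonneg_left (hle s ⟨hs.1, hs.2.le.trans ht.2⟩)
    (hκ.pos _ (sub_pos.2 hs.2)).le

end IsLogConvexKernel

theorem IsLpKernel.intervalIntegrable {p : ℝ} (hp : 1 ≤ p) {κ : ℝ → ℝ} (hκ : IsLpKernel p κ)
    {T : ℝ} (hT : 0 ≤ T) : IntervalIntegrable κ volume 0 T := by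
  rcases hT.eq_or_lt with rfl | hT
  · exact IntervalIntegrable.refl
  rw [intervalIntegrable_iff_integrableOn_Ioc_of_le hT.le]
  refine Integrable.mono' ((integrable_const (1 : ℝ)).add (hκ.2.2 T hT))
    ((hκ.2.1.mono fun t ht => ht.1).aestronglyMeasurable measurableSet_Ioc) ?_
  filter_upwards [ae_restrict_mem measurableSet_Ioc] with t ht
  have h0 := hκ.1 t ht.1.le
  rw [Real.norm_of_nonneg h0, Pi.add_apply]
  rcases le_total (κ t) 1 with h | h
  · exact h.trans (le_add_of_nonneg_right (Real.rpow_nonneg h0 p))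
  · exact (Real.self_le_rpow_of_one_le h hp).trans (by linarith)

theorem IsLpKernel.of_le {p : ℝ} (hp : 0 ≤ p) {κ r : ℝ → ℝ} (hκ : IsLpKernel p κ)
    (hr : ∀ t, 0 ≤ t → 0 ≤ r t) (hrc : ContinuousOn r (Ioi 0)) (hle : ∀ t > 0, r t ≤ κ t) :
    IsLpKernel p r := by
  refine ⟨hr, hrc, fun T hT => Integrable.mono' (hκ.2.2 T hT) ?_ ?_⟩
  · exact ((hrc.mono fun t ht => ht.1).rpow_const fun t _ => Or.inr hp).aestronglyMeasurable
      measurableSet_Ioc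
  · filter_upwards [ae_restrict_mem measurableSet_Ioc] with t ht
    have h0 := hr t ht.1.le
    rw [Real.norm_of_nonneg (Real.rpow_nonneg h0 p)]
    exact Real.rpow_le_rpow h0 (hle t ht.1) hp

/-- For `1 ≤ p < ∞`, an `L_p`-kernel `κ` which is strictly positive on `(0,∞)`
with `log κ` convex on `(0,∞)`, and `γ < 0`, there is a unique `L_p`-kernel `r`
with `r - κ = γ (κ ⋆ r)` on `(0,∞)`. -/
theorem gamma_resolvent_exists_unique_of_neg_logconvex
    (p : ℝ) (hp : 1 ≤ p) (κ : ℝ → ℝ) (hκ : IsLpKernel p κ)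
    (hpos : ∀ t > 0, 0 < κ t)
    (hlog : ConvexOn ℝ (Set.Ioi 0) (fun t => Real.log (κ t)))
    (γ : ℝ) (hγ : γ < 0) :
    ∃ r : ℝ → ℝ,
      (IsLpKernel p r ∧
        ∀ t > 0, r t - κ t = γ * ∫ s in (0:ℝ)..t, κ (t - s) * r s) ∧
      ∀ r' : ℝ → ℝ,
        (IsLpKernel p r' ∧
          ∀ t > 0, r' t - κ t = γ * ∫ s in (0:ℝ)..t, κ (t - s) * r' s) →
        ∀ t > 0, r' t = r t := by
  have hker : IsLogConvexKernel κ := ⟨hpos, hκ.2.1, fun T hT => hκ.intervalIntegrable hp hT,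
    fun x y h hx hxy hh => mul_le_mul_of_convexOn_log hpos hlog hx hxy hh⟩
  have hc : 0 ≤ -γ := by linarith
  have hex : ∀ b > 0, ∃ r, IsResolventOn κ (-γ) b r ∧
      ∀ ρ, IsResolventOn κ (-γ) b ρ → ∀ t ∈ Ioc 0 b, ρ t = r t :=
    fun b hb => hker.exists_unique_isResolventOn hb hc
  choose! R hR hRu using hex
  set r : ℝ → ℝ := (Ioi 0).indicator fun t => R t t with hrdef
  have hr : ∀ b > 0, ∀ t ∈ Ioc 0 b, r t = R b t := by
    intro b hb t ht
    rw [hrdef, indicator_of_mem (mem_Ioi.2 ht.1)]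
    exact (hRu t ht.1 _ ((hR b hb).mono ht.2) t (right_mem_Ioc.2 ht.1)).symm
  refine ⟨r, ⟨hκ.of_le (by linarith) (fun t ht => ?_) (fun t ht => ?_) fun t ht => ?_,
    fun t ht => ?_⟩, ?_⟩
  · rcases ht.eq_or_lt with rfl | ht
    · simp [hrdef]
    · rw [hr t ht t (right_mem_Ioc.2 ht)]
      exact (hR t ht).nonneg t (right_mem_Ioc.2 ht)
  · have ht : 0 < t := ht
    have hmem : Ioc 0 (t + 1) ∈ nhds t := Ioc_mem_nhds ht (by linarith)
    refine (((hR (t + 1) (by linarith)).continuousOn.congr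
      (hr (t + 1) (by linarith))).continuousAt hmem).continuousWithinAt
  · rw [hr t ht t (right_mem_Ioc.2 ht)]
    exact ((hR t ht).bounds hker hc t (right_mem_Ioc.2 ht)).2
  · have h1 : ∫ s in (0 : ℝ)..t, κ (t - s) * r s = ∫ s in (0 : ℝ)..t, κ (t - s) * R t s := by
      rw [intervalIntegral.integral_of_le ht.le, intervalIntegral.integral_of_le ht.le]
      refine setIntegral_congr_fun measurableSet_Ioc fun s hs => ?_
      simp only [hr t ht s hs]
    rw [h1, hr t ht t (right_mem_Ioc.2 ht), (hR t ht).eq t (right_mem_Ioc.2 ht)]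
    ring
  · rintro r' ⟨hr', hr'eq⟩ t ht
    rw [hr t ht t (right_mem_Ioc.2 ht)]
    refine hRu t ht r' ⟨fun s hs => hr'.1 s hs.1.le, hr'.2.1.mono fun s hs => hs.1,
      fun s hs => ?_⟩ t (right_mem_Ioc.2 ht)
    linarith [hr'eq s hs.1]
end

section
/- Let κ be a decreasing L1-kernel, let ρ ∈ [−1,1], and let u ∈ [0,1]. Then the convolution Riccati equation g(t) = R_V(u, (κ ⋆ g)(t)) = R_V(u, ∫₀^t κ(t−s) g(s) ds), t ≥ 0, has a unique global continuous solution g(·,u) : [0,∞) → (−∞,0]. Moreover g(t,u) = R_V(u, f(t,u)), where f(·,u) is the unique global continuous solution of the nonlinear Volterra equation f(t,u) = ∫₀^t κ(t−s) R_V(u, f(s,u)) ds. For u ∈ {0,1} the solution is g ≡ 0. -/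
open MeasureTheory Set Filter

/-- `R_V(u,w) = ½(u² − u) + ρ u w + ½ w²`. -/
noncomputable def RV (ρ u w : ℝ) : ℝ := (u ^ 2 - u) / 2 + ρ * u * w + w ^ 2 / 2

theorem convolution_eq_setIntegral_indicator (k H : ℝ → ℝ) {t : ℝ} (ht : 0 ≤ t) :
    ∫ s in (0:ℝ)..t, k (t - s) * H s =
      ∫ r in Ioi (0:ℝ), (Iic t).indicator (fun r => k r * H (t - r)) r := by
  have h := intervalIntegral.integral_comp_sub_left (a := 0) (b := t)
    (fun r => k r * H (t - r)) t
  simp only [sub_sub_cancel, sub_self, sub_zero] at h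
  rw [h, intervalIntegral.integral_of_le ht, setIntegral_indicator measurableSet_Iic,
    Ioi_inter_Iic]

theorem norm_indicator_mul_comp_sub_le {k H : ℝ → ℝ} {C : ℝ} (hC : ∀ s, |H s| ≤ C) (t r : ℝ) :
    ‖(Iic t).indicator (fun r => k r * H (t - r)) r‖ ≤ |k r| * C := by
  refine (norm_indicator_le_norm_self _ _).trans ?_
  rw [Real.norm_eq_abs, abs_mul]
  exact mul_le_mul_of_nonneg_left (hC _) (abs_nonneg _)

theorem aestronglyMeasurable_indicator_mul_comp_sub {k H : ℝ → ℝ} (hk : IntegrableOn k (Ioi 0))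
    (hH : Continuous H) (t : ℝ) :
    AEStronglyMeasurable ((Iic t).indicator (fun r => k r * H (t - r)))
      (volume.restrict (Ioi 0)) :=
  (hk.aestronglyMeasurable.mul (hH.comp (by fun_prop)).aestronglyMeasurable).indicator
    measurableSet_Iic

theorem integrableOn_indicator_mul_comp_sub {k H : ℝ → ℝ} {C : ℝ} (hk : IntegrableOn k (Ioi 0))
    (hH : Continuous H) (hC : ∀ s, |H s| ≤ C) (t : ℝ) :
    IntegrableOn ((Iic t).indicator (fun r => k r * H (t - r))) (Ioi 0) :=
  (hk.abs.mul_const C).mono' (aestronglyMeasurable_indicator_mul_comp_sub hk hH t)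
    (ae_of_all _ (norm_indicator_mul_comp_sub_le hC t))

/-- The convolution of an integrable kernel with a bounded continuous function is continuous. -/
theorem continuous_setIntegral_indicator_mul_comp_sub {k H : ℝ → ℝ} {C : ℝ}
    (hk : IntegrableOn k (Ioi 0)) (hH : Continuous H) (hC : ∀ s, |H s| ≤ C) :
    Continuous fun t => ∫ r in Ioi (0:ℝ), (Iic t).indicator (fun r => k r * H (t - r)) r := by
  rw [continuous_iff_continuousAt]
  intro t
  refine continuousAt_of_dominated (bound := fun r => |k r| * C)
    (.of_forall (aestronglyMeasurable_indicator_mul_comp_sub hk hH))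
    (.of_forall fun s => ae_of_all _ (norm_indicator_mul_comp_sub_le hC s))
    (hk.abs.mul_const C) ?_
  have hne : ∀ᵐ r ∂(volume.restrict (Ioi (0:ℝ))), r ≠ t :=
    ae_restrict_of_ae (measure_eq_zero_iff_ae_notMem.1 (measure_singleton t))
  filter_upwards [hne] with r hr
  rcases lt_or_gt_of_ne hr with h | h
  · have hc : ContinuousAt (fun s => k r * H (s - r)) t := by fun_prop
    refine hc.congr ?_
    filter_upwards [lt_mem_nhds h] with s hs
    rw [indicator_of_mem (mem_Iic.2 hs.le)]
  · refine (continuousAt_const (y := (0:ℝ))).congr ?_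
    filter_upwards [gt_mem_nhds h] with s hs
    rw [indicator_of_notMem (by simpa using hs)]

theorem intervalIntegrable_comp_sub_mul {κ g : ℝ → ℝ} {t T : ℝ} (ht : 0 ≤ t) (htT : t ≤ T)
    (hκ : ∀ T > 0, IntegrableOn κ (Ioc 0 T)) (hg : ContinuousOn g (Icc 0 t)) :
    IntervalIntegrable (fun s => κ (T - s) * g s) volume 0 t := by
  have h : IntervalIntegrable κ volume (T - 0) (T - t) := by
    rw [sub_zero]
    refine IntervalIntegrable.symm
      ((intervalIntegrable_iff_integrableOn_Ioc_of_le (by linarith)).2 ?_)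
    exact (hκ (T + 1) (by linarith)).mono_set (Ioc_subset_Ioc (by linarith) (by linarith))
  have h2 := h.comp_sub_left T
  simp only [sub_sub_cancel] at h2
  exact h2.mul_continuousOn (by rwa [uIcc_of_le ht])

/-- The convolution of a locally integrable kernel with a function continuous on `[0,∞)`
is continuous on `[0,∞)`. -/
theorem continuousOn_convolution {κ g : ℝ → ℝ} (hκ : ∀ T > 0, IntegrableOn κ (Ioc 0 T))
    (hg : ContinuousOn g (Ici 0)) :
    ContinuousOn (fun t => ∫ s in (0:ℝ)..t, κ (t - s) * g s) (Ici 0) := by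
  intro t₀ ht₀
  set T := t₀ + 1
  have hT : 0 < T := by have : 0 ≤ t₀ := ht₀; positivity
  set H : ℝ → ℝ := fun s => g (max 0 (min s T))
  have hH : Continuous H := hg.comp_continuous (by fun_prop) fun s => mem_Ici.2 (le_max_left _ _)
  obtain ⟨C, hC⟩ := isCompact_Icc.exists_bound_of_continuousOn
    (hg.mono (Icc_subset_Ici_self : Icc 0 T ⊆ Ici 0))
  have hHC : ∀ s, |H s| ≤ C := fun s =>
    hC _ ⟨le_max_left _ _, max_le hT.le (min_le_right _ _)⟩
  have hk : IntegrableOn ((Iic T).indicator κ) (Ioi 0) := by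
    rw [integrableOn_indicator_iff measurableSet_Iic, Iic_inter_Ioi]
    exact hκ T hT
  have key : ∀ t ∈ Icc 0 T, ∫ s in (0:ℝ)..t, κ (t - s) * g s =
      ∫ r in Ioi (0:ℝ), (Iic t).indicator (fun r => (Iic T).indicator κ r * H (t - r)) r := by
    intro t ht
    rw [← convolution_eq_setIntegral_indicator _ _ ht.1]
    refine intervalIntegral.integral_congr fun s hs => ?_
    rw [uIcc_of_le ht.1] at hs
    have hs' : t - s ∈ Iic T := by have := hs.1; have := ht.2; simp only [mem_Iic]; linarith
    simp only [H, indicator_of_mem hs', min_eq_left (hs.2.trans ht.2), max_eq_right hs.1]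
  refine ((continuous_setIntegral_indicator_mul_comp_sub hk hH hHC).continuousWithinAt
    (s := Ici 0) (x := t₀)).congr_of_eventuallyEq ?_ (key t₀ ⟨ht₀, by simp [T]⟩)
  filter_upwards [self_mem_nhdsWithin, mem_nhdsWithin_of_mem_nhds (gt_mem_nhds (lt_add_one t₀))]
    with t h0 h1
  exact key t ⟨h0, le_of_lt h1⟩

theorem integrableOn_mul_exp_neg_of_antitoneOn {κ : ℝ → ℝ} (hpos : ∀ t, 0 ≤ t → 0 ≤ κ t)
    (hcont : ContinuousOn κ (Ioi 0)) (hκ : IntegrableOn κ (Ioc 0 1))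
    (hdec : AntitoneOn κ (Ioi 0)) {l : ℝ} (hl : 0 < l) :
    IntegrableOn (fun r => κ r * Real.exp (-l * r)) (Ioi 0) := by
  have hmeas : ContinuousOn (fun r => κ r * Real.exp (-l * r)) (Ioi 0) :=
    hcont.mul (by fun_prop)
  rw [← Ioc_union_Ioi_eq_Ioi zero_le_one]
  refine IntegrableOn.union ?_ ?_
  · refine Integrable.mono' hκ
      ((hmeas.mono Ioc_subset_Ioi_self).aestronglyMeasurable measurableSet_Ioc) ?_
    refine (ae_restrict_iff' measurableSet_Ioc).2 (ae_of_all _ fun r hr => ?_)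
    rw [Real.norm_eq_abs, abs_of_nonneg (mul_nonneg (hpos r hr.1.le) (Real.exp_pos _).le)]
    refine mul_le_of_le_one_right (hpos r hr.1.le) (Real.exp_le_one_iff.2 ?_)
    nlinarith [hr.1]
  · refine Integrable.mono' ((exp_neg_integrableOn_Ioi 1 hl).const_mul (κ 1))
      ((hmeas.mono (Ioi_subset_Ioi zero_le_one)).aestronglyMeasurable measurableSet_Ioi) ?_
    refine (ae_restrict_iff' measurableSet_Ioi).2 (ae_of_all _ fun r hr => ?_)
    have hr0 : 0 < r := zero_lt_one.trans hr
    rw [Real.norm_eq_abs, abs_of_nonneg (mul_nonneg (hpos r hr0.le) (Real.exp_pos _).le)]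
    exact mul_le_mul_of_nonneg_right (hdec (mem_Ioi.2 one_pos) hr0 (le_of_lt hr))
      (Real.exp_pos _).le

/-- The Laplace transform of a decreasing integrable kernel is arbitrarily small at infinity. -/
theorem exists_laplace_lt {κ : ℝ → ℝ} (hpos : ∀ t, 0 ≤ t → 0 ≤ κ t)
    (hcont : ContinuousOn κ (Ioi 0)) (hκ : IntegrableOn κ (Ioc 0 1))
    (hdec : AntitoneOn κ (Ioi 0)) {ε : ℝ} (hε : 0 < ε) :
    ∃ l : ℝ, 0 ≤ l ∧ IntegrableOn (fun r => κ r * Real.exp (-l * r)) (Ioi 0) ∧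
      ∫ r in Ioi 0, κ r * Real.exp (-l * r) < ε := by
  have hint := fun {l : ℝ} (hl : 0 < l) =>
    integrableOn_mul_exp_neg_of_antitoneOn hpos hcont hκ hdec hl
  have hlim : Tendsto (fun l : ℝ => ∫ r in Ioi 0, κ r * Real.exp (-l * r)) atTop
      (nhds (∫ _ in Ioi (0:ℝ), (0:ℝ))) := by
    refine tendsto_integral_filter_of_dominated_convergence
      (fun r => κ r * Real.exp (-1 * r)) ?_ ?_ (hint one_pos) ?_
    · filter_upwards [eventually_gt_atTop 0] with l hl
      exact (hint hl).aestronglyMeasurable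
    · filter_upwards [eventually_ge_atTop 1] with l hl
      refine (ae_restrict_iff' measurableSet_Ioi).2 (ae_of_all _ fun r hr => ?_)
      have hr0 : 0 < r := hr
      rw [Real.norm_eq_abs, abs_of_nonneg (mul_nonneg (hpos r hr0.le) (Real.exp_pos _).le)]
      refine mul_le_mul_of_nonneg_left (Real.exp_le_exp.2 ?_) (hpos r hr0.le)
      nlinarith
    · refine (ae_restrict_iff' measurableSet_Ioi).2 (ae_of_all _ fun r hr => ?_)
      have hr0 : 0 < r := hr
      have h1 : Tendsto (fun l : ℝ => -l * r) atTop atBot :=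
        tendsto_neg_atTop_atBot.atBot_mul_const hr0
      simpa using (Real.tendsto_exp_atBot.comp h1).const_mul (κ r)
  rw [integral_zero] at hlim
  obtain ⟨l, hl, h1⟩ := ((hlim.eventually (gt_mem_nhds hε)).and (eventually_gt_atTop 0)).exists
  exact ⟨l, h1.le, hint h1, hl⟩

open scoped BoundedContinuousFunction in
/-- Global existence for a Volterra equation with bounded Lipschitz nonlinearity. -/
theorem exists_volterra_solution_s2 {κ φ : ℝ → ℝ} {l L C : ℝ} (hpos : ∀ t, 0 ≤ t → 0 ≤ κ t)
    (hk : IntegrableOn (fun r => κ r * Real.exp (-l * r)) (Ioi 0)) (hL : 0 ≤ L) (hl : 0 ≤ l)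
    (hsmall : L * ∫ r in Ioi 0, κ r * Real.exp (-l * r) < 1)
    (hφ : ∀ x y, |φ x - φ y| ≤ L * |x - y|) (hC : ∀ x, |φ x| ≤ C) :
    ∃ f : ℝ → ℝ, Continuous f ∧ ∀ t ≥ 0, f t = ∫ s in (0:ℝ)..t, κ (t - s) * φ (f s) := by
  set k : ℝ → ℝ := fun r => κ r * Real.exp (-l * r) with hkdef
  have hk0 : ∀ r ∈ Ioi (0:ℝ), 0 ≤ k r := fun r hr =>
    mul_nonneg (hpos r (le_of_lt hr)) (Real.exp_pos _).le
  have hφc : Continuous φ :=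
    (LipschitzWith.of_dist_le_mul (K := ⟨L, hL⟩) fun x y => hφ x y).continuous
  -- the nonlinearity in the exponentially weighted unknown `h t = exp (-l t) f t`
  set N : (ℝ →ᵇ ℝ) → ℝ → ℝ := fun h s =>
    Real.exp (-l * max s 0) * φ (Real.exp (l * max s 0) * h s) with hN
  have hNc : ∀ h, Continuous (N h) := fun h => by
    have := h.continuous
    fun_prop
  have hexp : ∀ s : ℝ, Real.exp (-l * max s 0) ≤ 1 := fun s => by
    rw [Real.exp_le_one_iff]
    nlinarith [le_max_right s 0]
  have hNC : ∀ h s, |N h s| ≤ C := fun h s => by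
    rw [hN, abs_mul, abs_of_pos (Real.exp_pos _)]
    exact (mul_le_of_le_one_left (abs_nonneg _) (hexp s)).trans (hC _)
  have hNL : ∀ h₁ h₂ : ℝ →ᵇ ℝ, ∀ s, |N h₁ s - N h₂ s| ≤ L * dist h₁ h₂ := fun h₁ h₂ s => by
    have hprod : Real.exp (-l * max s 0) * Real.exp (l * max s 0) = 1 := by
      rw [← Real.exp_add]; simp
    calc |N h₁ s - N h₂ s|
        = Real.exp (-l * max s 0) * |φ (Real.exp (l * max s 0) * h₁ s) -
            φ (Real.exp (l * max s 0) * h₂ s)| := by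
          rw [hN, ← mul_sub, abs_mul, abs_of_pos (Real.exp_pos _)]
      _ ≤ Real.exp (-l * max s 0) * (L * |Real.exp (l * max s 0) * h₁ s -
            Real.exp (l * max s 0) * h₂ s|) :=
          mul_le_mul_of_nonneg_left (hφ _ _) (Real.exp_pos _).le
      _ = (Real.exp (-l * max s 0) * Real.exp (l * max s 0)) * (L * |h₁ s - h₂ s|) := by
          rw [← mul_sub, abs_mul, abs_of_pos (Real.exp_pos _)]; ring
      _ = L * dist (h₁ s) (h₂ s) := by rw [hprod, one_mul, Real.dist_eq]
      _ ≤ L * dist h₁ h₂ :=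
          mul_le_mul_of_nonneg_left (BoundedContinuousFunction.dist_coe_le_dist s) hL
  set Φ : (ℝ →ᵇ ℝ) → (ℝ →ᵇ ℝ) := fun h => BoundedContinuousFunction.ofNormedAddCommGroup
    (fun t => ∫ r in Ioi (0:ℝ), (Iic t).indicator (fun r => k r * N h (t - r)) r)
    (continuous_setIntegral_indicator_mul_comp_sub hk (hNc h) (hNC h))
    (∫ r in Ioi (0:ℝ), |k r| * C)
    (fun t => norm_integral_le_of_norm_le (hk.abs.mul_const C)
      (ae_of_all _ (norm_indicator_mul_comp_sub_le (hNC h) t)))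
  have hI : 0 ≤ ∫ r in Ioi (0:ℝ), k r := setIntegral_nonneg measurableSet_Ioi hk0
  have hcontr : ContractingWith ⟨L * ∫ r in Ioi 0, k r, mul_nonneg hL hI⟩ Φ := by
    refine ⟨hsmall, LipschitzWith.of_dist_le_mul fun h₁ h₂ => ?_⟩
    refine (BoundedContinuousFunction.dist_le
      (mul_nonneg (mul_nonneg hL hI) dist_nonneg)).2 fun t => ?_
    change dist (∫ r in Ioi (0:ℝ), (Iic t).indicator (fun r => k r * N h₁ (t - r)) r)
      (∫ r in Ioi (0:ℝ), (Iic t).indicator (fun r => k r * N h₂ (t - r)) r) ≤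
      L * (∫ r in Ioi 0, k r) * dist h₁ h₂
    rw [dist_eq_norm, ← integral_sub (integrableOn_indicator_mul_comp_sub hk (hNc h₁) (hNC h₁) t)
      (integrableOn_indicator_mul_comp_sub hk (hNc h₂) (hNC h₂) t)]
    have heq : L * (∫ r in Ioi 0, k r) * dist h₁ h₂ =
        ∫ r in Ioi 0, k r * (L * dist h₁ h₂) := by
      rw [integral_mul_const]; ring
    rw [heq]
    refine norm_integral_le_of_norm_le (hk.mul_const _)
      ((ae_restrict_iff' measurableSet_Ioi).2 (ae_of_all _ fun r hr => ?_))
    rw [← Pi.sub_apply, ← indicator_sub']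
    refine (norm_indicator_le_norm_self _ _).trans ?_
    rw [Pi.sub_apply, ← mul_sub, norm_mul, Real.norm_eq_abs, abs_of_nonneg (hk0 r hr)]
    exact mul_le_mul_of_nonneg_left (hNL h₁ h₂ _) (hk0 r hr)
  set h := hcontr.fixedPoint
  have hfix : Φ h = h := hcontr.fixedPoint_isFixedPt
  refine ⟨fun t => Real.exp (l * t) * h t, by have := h.continuous; fun_prop, fun t ht => ?_⟩
  have h1 : h t = ∫ s in (0:ℝ)..t, k (t - s) * N h s := by
    rw [convolution_eq_setIntegral_indicator _ _ ht]
    conv_lhs => rw [← hfix]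
    rfl
  beta_reduce
  rw [h1, ← intervalIntegral.integral_const_mul]
  refine intervalIntegral.integral_congr fun s hs => ?_
  rw [uIcc_of_le ht] at hs
  have hprod : Real.exp (l * t) * (Real.exp (-l * (t - s)) * Real.exp (-l * s)) = 1 := by
    rw [← Real.exp_add, ← Real.exp_add, Real.exp_eq_one_iff]; ring
  simp only [hkdef, hN, max_eq_left hs.1]
  linear_combination (κ (t - s) * φ (Real.exp (l * s) * h s)) * hprod

/-- Uniqueness for a Volterra equation with locally Lipschitz nonlinearity. -/
theorem volterra_solution_unique {κ φ f f' : ℝ → ℝ} {T l L : ℝ} (hpos : ∀ t, 0 ≤ t → 0 ≤ κ t)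
    (hκ : ∀ T > 0, IntegrableOn κ (Ioc 0 T))
    (hk : IntegrableOn (fun r => κ r * Real.exp (-l * r)) (Ioi 0)) (hL : 0 ≤ L)
    (hsmall : L * ∫ r in Ioi 0, κ r * Real.exp (-l * r) < 1) (hφc : Continuous φ) (hT : 0 ≤ T)
    (hφ : ∀ s ∈ Icc 0 T, |φ (f s) - φ (f' s)| ≤ L * |f s - f' s|)
    (hfc : ContinuousOn f (Icc 0 T)) (hfc' : ContinuousOn f' (Icc 0 T))
    (hf : ∀ t ∈ Icc 0 T, f t = ∫ s in (0:ℝ)..t, κ (t - s) * φ (f s))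
    (hf' : ∀ t ∈ Icc 0 T, f' t = ∫ s in (0:ℝ)..t, κ (t - s) * φ (f' s)) :
    ∀ t ∈ Icc 0 T, f t = f' t := by
  have hdc : ContinuousOn (fun t => Real.exp (-l * t) * |f t - f' t|) (Icc 0 T) :=
    ContinuousOn.mul (by fun_prop) (hfc.sub hfc').abs
  obtain ⟨t, ht, hmax⟩ := isCompact_Icc.exists_isMaxOn (nonempty_Icc.2 hT) hdc
  set m := Real.exp (-l * t) * |f t - f' t|
  have hm0 : 0 ≤ m := by positivity
  have hsub : Icc 0 t ⊆ Icc 0 T := Icc_subset_Icc_right ht.2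
  have hint : |f t - f' t| ≤
      ∫ s in (0:ℝ)..t, κ (t - s) * Real.exp (-l * (t - s)) * (L * Real.exp (l * t) * m) := by
    rw [hf t ht, hf' t ht, ← intervalIntegral.integral_sub
      (intervalIntegrable_comp_sub_mul (g := fun s => φ (f s)) ht.1 le_rfl hκ
        (hφc.comp_continuousOn (hfc.mono hsub)))
      (intervalIntegrable_comp_sub_mul (g := fun s => φ (f' s)) ht.1 le_rfl hκ
        (hφc.comp_continuousOn (hfc'.mono hsub)))]
    rw [← Real.norm_eq_abs]
    refine intervalIntegral.norm_integral_le_of_norm_le ht.1 (ae_of_all _ fun s hs => ?_) ?_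
    · have hs' : s ∈ Icc 0 T := ⟨hs.1.le, hs.2.trans ht.2⟩
      have hd : |f s - f' s| ≤ Real.exp (l * s) * m := by
        have hms : Real.exp (-l * s) * |f s - f' s| ≤ m := hmax hs'
        calc |f s - f' s| = Real.exp (l * s) * (Real.exp (-l * s) * |f s - f' s|) := by
              rw [← mul_assoc, ← Real.exp_add]; simp
          _ ≤ _ := mul_le_mul_of_nonneg_left hms (Real.exp_pos _).le
      have hκs := hpos (t - s) (by linarith [hs.2])
      have he : Real.exp (-l * (t - s)) * Real.exp (l * t) = Real.exp (l * s) := by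
        rw [← Real.exp_add]; congr 1; ring
      rw [← mul_sub, norm_mul, Real.norm_eq_abs, Real.norm_eq_abs, abs_of_nonneg hκs]
      calc κ (t - s) * |φ (f s) - φ (f' s)| ≤ κ (t - s) * (L * (Real.exp (l * s) * m)) :=
            mul_le_mul_of_nonneg_left
              ((hφ s hs').trans (mul_le_mul_of_nonneg_left hd hL)) hκs
        _ = _ := by rw [← he]; ring
    · have := intervalIntegrable_comp_sub_mul (g := fun s => Real.exp (-l * (t - s)) *
        (L * Real.exp (l * t) * m)) ht.1 le_rfl hκ (by fun_prop)
      simpa only [mul_assoc] using this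
  have hle : ∫ s in (0:ℝ)..t, κ (t - s) * Real.exp (-l * (t - s)) ≤
      ∫ r in Ioi 0, κ r * Real.exp (-l * r) := by
    rw [intervalIntegral.integral_comp_sub_left (fun r => κ r * Real.exp (-l * r)) t, sub_self,
      sub_zero, intervalIntegral.integral_of_le ht.1]
    refine setIntegral_mono_set hk ?_ Ioc_subset_Ioi_self.eventuallyLE
    exact (ae_restrict_iff' measurableSet_Ioi).2 (ae_of_all _ fun r hr =>
      mul_nonneg (hpos r (le_of_lt hr)) (Real.exp_pos _).le)
  have hmm : m ≤ (L * ∫ r in Ioi 0, κ r * Real.exp (-l * r)) * m := by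
    have he : Real.exp (-l * t) * Real.exp (l * t) = 1 := by rw [← Real.exp_add]; simp
    rw [intervalIntegral.integral_mul_const] at hint
    calc m ≤ Real.exp (-l * t) * _ := mul_le_mul_of_nonneg_left hint (Real.exp_pos _).le
      _ = (∫ s in (0:ℝ)..t, κ (t - s) * Real.exp (-l * (t - s))) * (L * m) := by
        linear_combination ((∫ s in (0:ℝ)..t, κ (t - s) * Real.exp (-l * (t - s))) * (L * m)) * he
      _ ≤ _ := (mul_le_mul_of_nonneg_right hle (mul_nonneg hL hm0)).trans_eq (by ring)
  have hmz : m ≤ 0 := by nlinarith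
  intro s hs
  have h0 : Real.exp (-l * s) * |f s - f' s| ≤ 0 := (hmax hs).trans hmz
  have h1 : |f s - f' s| ≤ 0 := nonpos_of_mul_nonpos_right h0 (Real.exp_pos _)
  exact sub_eq_zero.1 (abs_nonpos_iff.1 h1)

/-- A lower bound for solutions of Volterra equations with a decreasing kernel: if the
nonpositive nonlinearity vanishes below the level `a ≤ 0`, solutions stay above `a`. -/
theorem le_volterra_solution {κ φ f : ℝ → ℝ} {a : ℝ} (hκ : ∀ T > 0, IntegrableOn κ (Ioc 0 T))
    (hdec : AntitoneOn κ (Ioi 0)) (hφc : Continuous φ) (hφ : ∀ x, φ x ≤ 0) (ha : a ≤ 0)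
    (hφa : ∀ x < a, φ x = 0) (hfc : Continuous f)
    (hf : ∀ t ≥ 0, f t = ∫ s in (0:ℝ)..t, κ (t - s) * φ (f s)) :
    ∀ t ≥ 0, a ≤ f t := by
  intro t ht
  have hcomp : IsCompact (Icc 0 t ∩ f ⁻¹' Ici a) :=
    isCompact_Icc.inter_right (isClosed_Ici.preimage hfc)
  have hf0 : f 0 = 0 := by simpa using hf 0 le_rfl
  obtain ⟨t₀, ⟨ht₀, hat₀⟩, hmax⟩ := hcomp.exists_isGreatest
    ⟨0, ⟨le_rfl, ht⟩, by simpa [hf0] using ha⟩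
  refine le_trans hat₀ ?_
  have hII := fun {t₁ T : ℝ} (h0 : 0 ≤ t₁) (h1 : t₁ ≤ T) =>
    intervalIntegrable_comp_sub_mul (g := fun s => φ (f s)) h0 h1 hκ
      (hφc.comp hfc).continuousOn
  have hzero : ∫ s in t₀..t, κ (t - s) * φ (f s) = 0 := by
    refine intervalIntegral.integral_zero_ae (ae_of_all _ fun s hs => ?_)
    rw [uIoc_of_le ht₀.2] at hs
    have hlt : f s < a := by
      by_contra! hge
      exact absurd (hmax ⟨⟨ht₀.1.trans hs.1.le, hs.2⟩, hge⟩) (not_le.2 hs.1)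
    rw [hφa _ hlt, mul_zero]
  have hsplit : f t = ∫ s in (0:ℝ)..t₀, κ (t - s) * φ (f s) := by
    rw [hf t ht, ← intervalIntegral.integral_add_adjacent_intervals (hII ht₀.1 ht₀.2)
      ((hII ht₀.1 ht₀.2).symm.trans (hII ht le_rfl)), hzero, add_zero]
  rw [hsplit, hf t₀ ht₀.1]
  refine intervalIntegral.integral_mono_on_of_le_Ioo ht₀.1 (hII ht₀.1 le_rfl)
    (hII ht₀.1 ht₀.2) fun s hs => ?_
  refine mul_le_mul_of_nonpos_right (hdec ?_ ?_ ?_) (hφ _)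
  · exact sub_pos.2 hs.2
  · exact sub_pos.2 (hs.2.trans_le ht₀.2)
  · linarith [ht₀.2]

theorem continuous_RV (ρ u : ℝ) : Continuous (RV ρ u) := by
  unfold RV; fun_prop

theorem abs_RV_sub_le {ρ u M x y : ℝ} (hx : |x| ≤ M) (hy : |y| ≤ M) :
    |RV ρ u x - RV ρ u y| ≤ (|ρ * u| + M) * |x - y| := by
  have h : RV ρ u x - RV ρ u y = (ρ * u + (x + y) / 2) * (x - y) := by unfold RV; ring
  rw [h, abs_mul]
  refine mul_le_mul_of_nonneg_right ((abs_add_le _ _).trans ?_) (abs_nonneg _)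
  gcongr
  rw [abs_le] at *
  constructor <;> linarith

/-- `RV ρ u` has a nonpositive root above which, up to `0`, it is nonpositive. -/
theorem exists_RV_root {ρ u : ℝ} (hu : u ∈ Icc (0 : ℝ) 1) :
    ∃ a ≤ 0, RV ρ u a = 0 ∧ ∀ x ∈ Icc a 0, RV ρ u x ≤ 0 := by
  set D := Real.sqrt ((ρ * u) ^ 2 + (u - u ^ 2)) with hD
  have hu2 : 0 ≤ u - u ^ 2 := by nlinarith [hu.1, hu.2]
  have hDs : D ^ 2 = (ρ * u) ^ 2 + (u - u ^ 2) := Real.sq_sqrt (by positivity)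
  have hDge : |ρ * u| ≤ D := Real.abs_le_sqrt (by linarith)
  rw [abs_le] at hDge
  refine ⟨-(ρ * u) - D, by linarith, ?_, fun x hx => ?_⟩
  · unfold RV; linear_combination hDs / 2
  · have h : RV ρ u x = (x - (-(ρ * u) - D)) * (x - (-(ρ * u) + D)) / 2 := by
      unfold RV; linear_combination hDs / 2
    rw [h]
    have h1 := hx.1
    have h2 := hx.2
    have := mul_nonpos_of_nonneg_of_nonpos (sub_nonneg.2 h1)
      (show x - (-(ρ * u) + D) ≤ 0 by linarith)
    linarith

/-- For a decreasing `L₁`-kernel `κ`, `ρ ∈ [−1,1]` and `u ∈ [0,1]`, the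
convolution Riccati equation `g(t) = R_V(u, (κ ⋆ g)(t))` has a unique global
continuous solution `g : [0,∞) → (−∞,0]`; moreover `g(t) = R_V(u, f(t))` where
`f` is the unique global continuous solution of
`f(t) = ∫₀^t κ(t−s) R_V(u, f(s)) ds`, and for `u ∈ {0,1}` the solution is `g ≡ 0`. -/
theorem convolution_riccati_RV_exists_unique
    (κ : ℝ → ℝ) (hκ : IsLpKernel 1 κ) (hdec : AntitoneOn κ (Set.Ioi 0))
    (ρ : ℝ) (hρ : ρ ∈ Set.Icc (-1 : ℝ) 1) (u : ℝ) (hu : u ∈ Set.Icc (0 : ℝ) 1) :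
    ∃ g : ℝ → ℝ,
      (ContinuousOn g (Set.Ici 0) ∧ (∀ t ≥ 0, g t ≤ 0) ∧
        (∀ t ≥ 0, g t = RV ρ u (∫ s in (0:ℝ)..t, κ (t - s) * g s))) ∧
      (∀ g' : ℝ → ℝ,
        (ContinuousOn g' (Set.Ici 0) ∧ (∀ t ≥ 0, g' t ≤ 0) ∧
          (∀ t ≥ 0, g' t = RV ρ u (∫ s in (0:ℝ)..t, κ (t - s) * g' s))) →
        ∀ t ≥ 0, g' t = g t) ∧
      (∃ f : ℝ → ℝ,
        (ContinuousOn f (Set.Ici 0) ∧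
          (∀ t ≥ 0, f t = ∫ s in (0:ℝ)..t, κ (t - s) * RV ρ u (f s))) ∧
        (∀ f' : ℝ → ℝ,
          (ContinuousOn f' (Set.Ici 0) ∧
            (∀ t ≥ 0, f' t = ∫ s in (0:ℝ)..t, κ (t - s) * RV ρ u (f' s))) →
          ∀ t ≥ 0, f' t = f t) ∧
        (∀ t ≥ 0, g t = RV ρ u (f t))) ∧
      ((u = 0 ∨ u = 1) → ∀ t ≥ 0, g t = 0) := by
  obtain ⟨hpos, hcont, hint⟩ := hκ
  simp only [Real.rpow_one] at hint
  have hlap := fun {ε : ℝ} (hε : 0 < ε) =>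
    exists_laplace_lt hpos hcont (hint 1 one_pos) hdec hε
  have hunique : ∀ f f' : ℝ → ℝ, ContinuousOn f (Ici 0) → ContinuousOn f' (Ici 0) →
      (∀ t ≥ 0, f t = ∫ s in (0:ℝ)..t, κ (t - s) * RV ρ u (f s)) →
      (∀ t ≥ 0, f' t = ∫ s in (0:ℝ)..t, κ (t - s) * RV ρ u (f' s)) →
      ∀ t ≥ 0, f' t = f t := by
    intro f f' hfc hfc' hf hf' T hT
    have hfT := hfc.mono (Icc_subset_Ici_self : Icc 0 T ⊆ Ici 0)
    have hfT' := hfc'.mono (Icc_subset_Ici_self : Icc 0 T ⊆ Ici 0)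
    obtain ⟨M, hM⟩ := isCompact_Icc.exists_bound_of_continuousOn hfT
    obtain ⟨M', hM'⟩ := isCompact_Icc.exists_bound_of_continuousOn hfT'
    have hB0 : 0 ≤ max M M' :=
      ((norm_nonneg _).trans (hM 0 ⟨le_rfl, hT⟩)).trans (le_max_left _ _)
    have hL : 0 < |ρ * u| + max M M' + 1 := by positivity
    obtain ⟨l, -, hk, hsmall⟩ := hlap (inv_pos.2 hL)
    refine (volterra_solution_unique (L := |ρ * u| + max M M' + 1) hpos hint hk hL.le
      ((lt_inv_mul_iff₀ hL).1 (by rwa [mul_one])) (continuous_RV ρ u) hT (fun s hs => ?_) hfT hfT'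
      (fun t ht => hf t ht.1) (fun t ht => hf' t ht.1) T ⟨hT, le_rfl⟩).symm
    refine (abs_RV_sub_le ((hM s hs).trans (le_max_left _ _))
      ((hM' s hs).trans (le_max_right _ _))).trans ?_
    exact mul_le_mul_of_nonneg_right (by linarith) (abs_nonneg _)
  obtain ⟨a, ha, hRa, hRneg⟩ := exists_RV_root (ρ := ρ) hu
  -- truncation of the nonlinearity outside `[a, 0]`
  set c : ℝ → ℝ := fun x => max a (min x 0) with hc
  have hcmem : ∀ x, c x ∈ Icc a 0 := fun x => ⟨le_max_left _ _, max_le ha (min_le_right _ _)⟩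
  have hcabs : ∀ x, |c x| ≤ -a := fun x =>
    abs_le.2 ⟨by linarith [(hcmem x).1], by linarith [(hcmem x).2]⟩
  have hclip : ∀ x y, |c x - c y| ≤ |x - y| := fun x y =>
    (abs_max_sub_max_le_max _ _ _ _).trans (by
      rw [sub_self, abs_zero, max_eq_right (abs_nonneg _)]
      exact (abs_min_sub_min_le_max _ _ _ _).trans (by simp))
  set φ : ℝ → ℝ := fun x => RV ρ u (c x) with hφ
  have hφc : Continuous φ := (continuous_RV ρ u).comp (by fun_prop)
  have hφneg : ∀ x, φ x ≤ 0 := fun x => hRneg _ (hcmem x)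
  obtain ⟨C, hC⟩ := isCompact_Icc.exists_bound_of_continuousOn
    (continuous_RV ρ u).continuousOn (s := Icc a 0)
  have hL : 0 < |ρ * u| + -a + 1 := by linarith [abs_nonneg (ρ * u)]
  have hφL : ∀ x y, |φ x - φ y| ≤ (|ρ * u| + -a + 1) * |x - y| := fun x y => by
    refine (abs_RV_sub_le (hcabs x) (hcabs y)).trans ?_
    exact mul_le_mul (by linarith) (hclip x y) (abs_nonneg _) hL.le
  obtain ⟨l, hl, hk, hsmall⟩ := hlap (inv_pos.2 hL)
  obtain ⟨f, hfc, hf⟩ := exists_volterra_solution_s2 hpos hk hL.le hl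
    ((lt_inv_mul_iff₀ hL).1 (by rwa [mul_one])) hφL (fun x => hC _ (hcmem x))
  have hfa : ∀ t ≥ 0, a ≤ f t := le_volterra_solution hint hdec hφc hφneg ha
    (fun x hx => by
      rw [hφ, hc]
      simp only [max_eq_left ((min_le_left x 0).trans hx.le), hRa]) hfc hf
  have hf0 : ∀ t ≥ 0, f t ≤ 0 := fun t ht => by
    rw [hf t ht, ← neg_nonneg, ← intervalIntegral.integral_neg]
    refine intervalIntegral.integral_nonneg ht fun s hs => ?_
    exact neg_nonneg.2 (mul_nonpos_of_nonneg_of_nonpos (hpos _ (sub_nonneg.2 hs.2)) (hφneg _))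
  have hfRV : ∀ t ≥ 0, f t = ∫ s in (0:ℝ)..t, κ (t - s) * RV ρ u (f s) := fun t ht => by
    rw [hf t ht]
    refine intervalIntegral.integral_congr fun s hs => ?_
    rw [uIcc_of_le ht] at hs
    simp only [hφ, hc, min_eq_left (hf0 s hs.1), max_eq_right (hfa s hs.1)]
  refine ⟨fun t => RV ρ u (f t), ⟨((continuous_RV ρ u).comp hfc).continuousOn,
    fun t ht => hRneg _ ⟨hfa t ht, hf0 t ht⟩, fun t ht => congrArg (RV ρ u) (hfRV t ht)⟩, ?_,
    ⟨f, ⟨hfc.continuousOn, hfRV⟩,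
      fun f' hf' => hunique f f' hfc.continuousOn hf'.1 hfRV hf'.2, fun _ _ => rfl⟩, ?_⟩
  · rintro g' ⟨hgc, -, hg⟩ t ht
    have heq := hunique f (fun t => ∫ s in (0:ℝ)..t, κ (t - s) * g' s) hfc.continuousOn
      (continuousOn_convolution hint hgc) hfRV (fun t ht => by
        refine intervalIntegral.integral_congr fun s hs => ?_
        rw [uIcc_of_le ht] at hs
        simp only [← hg s hs.1]) t ht
    rw [hg t ht, heq]
  · intro hu01 t ht
    have hR0 : RV ρ u 0 = 0 := by rcases hu01 with rfl | rfl <;> simp [RV]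
    have hz : 0 = f t := hunique f (fun _ => 0) hfc.continuousOn continuousOn_const hfRV
      (fun t _ => by simp [hR0]) t ht
    simp only [← hz, hR0]
end

section
/- Let ζ₊, ζ₋ be probability measures on [0,∞) with ∫₀^∞ e^x ζ±(dx) < ∞ and ∫₀^∞ x² ζ₊(dx) + ∫₀^∞ x² ζ₋(dx) > 0, and let γ₊, γ₋ > 0. Then for every u ∈ (0,1) the function w ↦ R_λ(u,w) is finite and strictly convex on (−∞,0], satisfies R_λ(u,0) < 0 and lim_{w → −∞} R_λ(u,w) = +∞, and hence has a unique root w_*(u) in (−∞,0], which satisfies w_*(u) < 0. -/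
open MeasureTheory Set Filter

/-- `ψ(u) = ∫₀^∞ (e^{ux} − 1) ζ(dx)`. -/
noncomputable def psiM (ζ : MeasureTheory.Measure ℝ) (u : ℝ) : ℝ :=
  ∫ x, (Real.exp (u * x) - 1) ∂ζ

/-- `R_λ(u,w) = ψ₊(u + wγ₊) + ψ₋(−u + wγ₋) − u m_X − w(γ₊ m₊ + γ₋ m₋)`,
with `m_X = ψ₊(1) + ψ₋(−1)` and `m± = ∫ x ζ±(dx)`. -/
noncomputable def Rlam (ζp ζm : MeasureTheory.Measure ℝ) (γp γm u w : ℝ) : ℝ :=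
  psiM ζp (u + w * γp) + psiM ζm (-u + w * γm)
    - u * (psiM ζp 1 + psiM ζm (-1))
    - w * (γp * (∫ x, x ∂ζp) + γm * (∫ x, x ∂ζm))

section PsiM

variable {ζ : Measure ℝ}

lemma ae_nonneg_of_measure_Iio_zero (hs : ζ (Iio 0) = 0) : ∀ᵐ x ∂ζ, 0 ≤ x := by
  rw [ae_iff]
  simpa [not_le, Iio] using hs

lemma integrable_exp_mul_of_le_one (hs : ζ (Iio 0) = 0)
    (hi : Integrable (fun x => Real.exp x) ζ) {v : ℝ} (hv : v ≤ 1) :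
    Integrable (fun x => Real.exp (v * x)) ζ := by
  refine hi.mono (by fun_prop) ?_
  filter_upwards [ae_nonneg_of_measure_Iio_zero hs] with x hx
  rw [Real.norm_eq_abs, Real.norm_eq_abs, Real.abs_exp, Real.abs_exp]
  exact Real.exp_le_exp.2 (by nlinarith)

lemma integrable_id_of_integrable_exp (hs : ζ (Iio 0) = 0)
    (hi : Integrable (fun x => Real.exp x) ζ) : Integrable (fun x => x) ζ := by
  refine hi.mono (by fun_prop) ?_
  filter_upwards [ae_nonneg_of_measure_Iio_zero hs] with x hx
  rw [Real.norm_eq_abs, Real.norm_eq_abs, Real.abs_exp, abs_of_nonneg hx]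
  linarith [Real.add_one_le_exp x]

lemma psiM_zero : psiM ζ 0 = 0 := by simp [psiM]

lemma exp_combo_mul_le (x : ℝ) {s t a b : ℝ} (ha : 0 ≤ a) (hb : 0 ≤ b) (hab : a + b = 1) :
    Real.exp ((a * s + b * t) * x) ≤ a * Real.exp (s * x) + b * Real.exp (t * x) := by
  have := convexOn_exp.2 (mem_univ (s * x)) (mem_univ (t * x)) ha hb hab
  simp only [smul_eq_mul] at this
  rwa [show (a * s + b * t) * x = a * (s * x) + b * (t * x) by ring]

lemma exp_combo_mul_lt {x s t a b : ℝ} (hx : x ≠ 0) (hst : s ≠ t) (ha : 0 < a) (hb : 0 < b)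
    (hab : a + b = 1) :
    Real.exp ((a * s + b * t) * x) < a * Real.exp (s * x) + b * Real.exp (t * x) := by
  have := strictConvexOn_exp.2 (mem_univ (s * x)) (mem_univ (t * x))
    (fun h => hst (mul_right_cancel₀ hx h)) ha hb hab
  simp only [smul_eq_mul] at this
  rwa [show (a * s + b * t) * x = a * (s * x) + b * (t * x) by ring]

lemma measure_setOf_ne_zero_pos (h2 : 0 < ∫ x, x ^ 2 ∂ζ) :
    0 < ζ {x | x ≠ 0} := by
  refine pos_iff_ne_zero.2 fun h => h2.ne' ?_
  have h0 : ∀ᵐ x ∂ζ, x = 0 := by rwa [ae_iff]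
  refine integral_eq_zero_of_ae ?_
  filter_upwards [h0] with x hx
  simp [hx]

lemma integral_id_nonneg (hs : ζ (Iio 0) = 0) : 0 ≤ ∫ x, x ∂ζ :=
  integral_nonneg_of_ae (ae_nonneg_of_measure_Iio_zero hs)

lemma integral_id_pos (hs : ζ (Iio 0) = 0) (hi : Integrable (fun x => Real.exp x) ζ)
    (h2 : 0 < ∫ x, x ^ 2 ∂ζ) : 0 < ∫ x, x ∂ζ := by
  rw [integral_pos_iff_support_of_nonneg_ae (ae_nonneg_of_measure_Iio_zero hs)
    (integrable_id_of_integrable_exp hs hi)]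
  exact measure_setOf_ne_zero_pos h2

variable [IsProbabilityMeasure ζ]

lemma psiM_eq_integral_exp_sub_one (hs : ζ (Iio 0) = 0)
    (hi : Integrable (fun x => Real.exp x) ζ) {v : ℝ} (hv : v ≤ 1) :
    psiM ζ v = (∫ x, Real.exp (v * x) ∂ζ) - 1 := by
  rw [psiM, integral_sub (integrable_exp_mul_of_le_one hs hi hv) (integrable_const _)]
  simp

lemma neg_one_le_psiM (hs : ζ (Iio 0) = 0)
    (hi : Integrable (fun x => Real.exp x) ζ) {v : ℝ} (hv : v ≤ 1) : -1 ≤ psiM ζ v := by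
  rw [psiM_eq_integral_exp_sub_one hs hi hv]
  have : 0 ≤ ∫ x, Real.exp (v * x) ∂ζ := integral_nonneg fun x => (Real.exp_pos _).le
  linarith

lemma convexOn_psiM (hs : ζ (Iio 0) = 0) (hi : Integrable (fun x => Real.exp x) ζ) :
    ConvexOn ℝ (Iic 1) (psiM ζ) := by
  refine ⟨convex_Iic 1, fun s hs1 t ht1 a b ha hb hab => ?_⟩
  have hc : a * s + b * t ≤ 1 := convex_Iic (1 : ℝ) hs1 ht1 ha hb hab
  have is := (integrable_exp_mul_of_le_one hs hi hs1).const_mul a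
  have it := (integrable_exp_mul_of_le_one hs hi ht1).const_mul b
  have key : ∫ x, Real.exp ((a * s + b * t) * x) ∂ζ
      ≤ ∫ x, (a * Real.exp (s * x) + b * Real.exp (t * x)) ∂ζ :=
    integral_mono (integrable_exp_mul_of_le_one hs hi hc) (is.add it)
      fun x => exp_combo_mul_le x ha hb hab
  rw [integral_add is it, integral_const_mul, integral_const_mul] at key
  simp only [smul_eq_mul]
  rw [psiM_eq_integral_exp_sub_one hs hi hc, psiM_eq_integral_exp_sub_one hs hi hs1,
    psiM_eq_integral_exp_sub_one hs hi ht1]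
  linear_combination key + hab

lemma strictConvexOn_psiM (hs : ζ (Iio 0) = 0) (hi : Integrable (fun x => Real.exp x) ζ)
    (h2 : 0 < ∫ x, x ^ 2 ∂ζ) : StrictConvexOn ℝ (Iic 1) (psiM ζ) := by
  refine ⟨convex_Iic 1, fun s hs1 t ht1 hst a b ha hb hab => ?_⟩
  have hc : a * s + b * t ≤ 1 := convex_Iic (1 : ℝ) hs1 ht1 ha.le hb.le hab
  have is := (integrable_exp_mul_of_le_one hs hi hs1).const_mul a
  have it := (integrable_exp_mul_of_le_one hs hi ht1).const_mul b
  have ic := integrable_exp_mul_of_le_one hs hi hc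
  have key : 0 < ∫ x, (a * Real.exp (s * x) + b * Real.exp (t * x)
      - Real.exp ((a * s + b * t) * x)) ∂ζ := by
    rw [integral_pos_iff_support_of_nonneg
      (fun x => sub_nonneg.2 (exp_combo_mul_le x ha.le hb.le hab)) ((is.add it).sub ic)]
    exact (measure_setOf_ne_zero_pos h2).trans_le (measure_mono fun x hx =>
      (sub_pos.2 (exp_combo_mul_lt hx hst ha hb hab)).ne')
  rw [integral_sub (by exact is.add it) ic, integral_add is it, integral_const_mul,
    integral_const_mul] at key
  simp only [smul_eq_mul]
  rw [psiM_eq_integral_exp_sub_one hs hi hc, psiM_eq_integral_exp_sub_one hs hi hs1,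
    psiM_eq_integral_exp_sub_one hs hi ht1]
  linear_combination key + hab

lemma convexOn_psiM_affine (hs : ζ (Iio 0) = 0) (hi : Integrable (fun x => Real.exp x) ζ)
    {c γ : ℝ} (hc : c ≤ 1) (hγ : 0 < γ) :
    ConvexOn ℝ (Iic 0) (fun w => psiM ζ (c + w * γ)) := by
  refine ⟨convex_Iic 0, fun x hx y hy a b ha hb hab => ?_⟩
  rw [mem_Iic] at hx hy
  have := (convexOn_psiM hs hi).2 (show c + x * γ ∈ Iic 1 by rw [mem_Iic]; nlinarith)
    (show c + y * γ ∈ Iic 1 by rw [mem_Iic]; nlinarith) ha hb hab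
  convert this using 2
  simp only [smul_eq_mul]
  linear_combination -c * hab

lemma strictConvexOn_psiM_affine (hs : ζ (Iio 0) = 0)
    (hi : Integrable (fun x => Real.exp x) ζ) (h2 : 0 < ∫ x, x ^ 2 ∂ζ)
    {c γ : ℝ} (hc : c ≤ 1) (hγ : 0 < γ) :
    StrictConvexOn ℝ (Iic 0) (fun w => psiM ζ (c + w * γ)) := by
  refine ⟨convex_Iic 0, fun x hx y hy hxy a b ha hb hab => ?_⟩
  rw [mem_Iic] at hx hy
  have := (strictConvexOn_psiM hs hi h2).2 (show c + x * γ ∈ Iic 1 by rw [mem_Iic]; nlinarith)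
    (show c + y * γ ∈ Iic 1 by rw [mem_Iic]; nlinarith)
    (fun h => hxy (mul_right_cancel₀ hγ.ne' (add_left_cancel h))) ha hb hab
  convert this using 2
  simp only [smul_eq_mul]
  linear_combination -c * hab

lemma psiM_mul_le (hs : ζ (Iio 0) = 0) (hi : Integrable (fun x => Real.exp x) ζ)
    {u v : ℝ} (hu : u ∈ Ioo (0 : ℝ) 1) (hv : v ≤ 1) : psiM ζ (u * v) ≤ u * psiM ζ v := by
  have := (convexOn_psiM hs hi).2 (show v ∈ Iic 1 from hv)
    (show (0 : ℝ) ∈ Iic 1 from zero_le_one' ℝ) hu.1.le (sub_nonneg.2 hu.2.le) (by ring)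
  simpa [psiM_zero] using this

lemma psiM_mul_lt (hs : ζ (Iio 0) = 0) (hi : Integrable (fun x => Real.exp x) ζ)
    (h2 : 0 < ∫ x, x ^ 2 ∂ζ) {u v : ℝ} (hu : u ∈ Ioo (0 : ℝ) 1) (hv : v ≤ 1) (hv0 : v ≠ 0) :
    psiM ζ (u * v) < u * psiM ζ v := by
  have := (strictConvexOn_psiM hs hi h2).2 (show v ∈ Iic 1 from hv)
    (show (0 : ℝ) ∈ Iic 1 from zero_le_one' ℝ) hv0 hu.1 (sub_pos.2 hu.2) (by ring)
  simpa [psiM_zero] using this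

lemma continuousOn_psiM (hs : ζ (Iio 0) = 0) (hi : Integrable (fun x => Real.exp x) ζ) :
    ContinuousOn (psiM ζ) (Iio 1) :=
  ((convexOn_psiM hs hi).subset Iio_subset_Iic_self (convex_Iio 1)).continuousOn isOpen_Iio

lemma continuousOn_psiM_affine (hs : ζ (Iio 0) = 0)
    (hi : Integrable (fun x => Real.exp x) ζ) {c γ : ℝ} (hc : c < 1) (hγ : 0 < γ) :
    ContinuousOn (fun w => psiM ζ (c + w * γ)) (Iic 0) :=
  (continuousOn_psiM hs hi).comp (by fun_prop) fun w hw => by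
    rw [mem_Iic] at hw
    rw [mem_Iio]
    nlinarith

end PsiM

/-- A strictly convex function on `(-∞, 0]` that is negative at `0` and tends to `+∞` at `-∞`
has a unique root, and this root is negative. -/
lemma StrictConvexOn.exists_unique_neg_root {f : ℝ → ℝ} (hf : StrictConvexOn ℝ (Iic 0) f)
    (hc : ContinuousOn f (Iic 0)) (h0 : f 0 < 0) (hlim : Tendsto f atBot atTop) :
    ∃ r < 0, f r = 0 ∧ ∀ w ≤ 0, f w = 0 → w = r := by
  have no_two : ∀ a b, a < b → b ≤ 0 → f a = 0 → f b = 0 → False := fun a b hab hb ha hb0 => by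
    have hb' : b < 0 := hb.lt_of_ne fun h => by rw [h] at hb0; exact h0.ne hb0
    have := hf.lt_on_openSegment (show a ∈ Iic 0 from (hab.trans hb').le)
      (show (0 : ℝ) ∈ Iic 0 from le_refl (0 : ℝ)) (hab.trans hb').ne
      (show b ∈ openSegment ℝ a 0 by
        rw [openSegment_eq_Ioo (hab.trans hb')]; exact ⟨hab, hb'⟩)
    rw [ha, hb0, max_eq_left h0.le] at this
    exact this.false
  obtain ⟨b, hb, hb0⟩ := ((hlim.eventually_gt_atTop 0).and (eventually_le_atBot 0)).exists
  obtain ⟨r, hr, hr0⟩ := intermediate_value_Icc' hb0 (hc.mono Icc_subset_Iic_self) ⟨h0.le, hb.le⟩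
  have hr' : r < 0 := hr.2.lt_of_ne fun h => by rw [h] at hr0; exact h0.ne hr0
  refine ⟨r, hr', hr0, fun w hw hw0 => ?_⟩
  rcases lt_trichotomy w r with h | h | h
  · exact (no_two w r h hr'.le hw0 hr0).elim
  · exact h
  · exact (no_two r w h hw hr0 hw0).elim

/-- For probability measures `ζ±` on `[0,∞)` with `∫ e^x dζ± < ∞` and positive
total second moment, and `γ± > 0`: for every `u ∈ (0,1)`, `w ↦ R_λ(u,w)` is
strictly convex on `(−∞,0]`, satisfies `R_λ(u,0) < 0`, tends to `+∞` as
`w → −∞`, and has a unique root `w_*(u)` in `(−∞,0]`, which satisfies `w_*(u) < 0`. -/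
theorem Rlam_strictConvex_and_unique_root
    (ζp ζm : MeasureTheory.Measure ℝ)
    [IsProbabilityMeasure ζp] [IsProbabilityMeasure ζm]
    (hsp : ζp (Set.Iio 0) = 0) (hsm : ζm (Set.Iio 0) = 0)
    (hip : Integrable (fun x => Real.exp x) ζp)
    (him : Integrable (fun x => Real.exp x) ζm)
    (hvar : 0 < (∫ x, x ^ 2 ∂ζp) + ∫ x, x ^ 2 ∂ζm)
    (γp γm : ℝ) (hγp : 0 < γp) (hγm : 0 < γm)
    (u : ℝ) (hu : u ∈ Set.Ioo (0 : ℝ) 1) :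
    StrictConvexOn ℝ (Set.Iic 0) (fun w => Rlam ζp ζm γp γm u w) ∧
    Rlam ζp ζm γp γm u 0 < 0 ∧
    Tendsto (fun w => Rlam ζp ζm γp γm u w) atBot atTop ∧
    ∃ wstar : ℝ, wstar < 0 ∧ Rlam ζp ζm γp γm u wstar = 0 ∧
      ∀ w ≤ (0 : ℝ), Rlam ζp ζm γp γm u w = 0 → w = wstar := by
  have hu1 : u < 1 := hu.2
  have hu2 : -u < 1 := by linarith [hu.1]
  have hcases : 0 < (∫ x, x ^ 2 ∂ζp) ∨ 0 < ∫ x, x ^ 2 ∂ζm := by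
    by_contra! h
    linarith [h.1, h.2]
  set M := γp * (∫ x, x ∂ζp) + γm * (∫ x, x ∂ζm) with hM
  have hMpos : 0 < M := by
    rcases hcases with h | h
    · exact add_pos_of_pos_of_nonneg (mul_pos hγp (integral_id_pos hsp hip h))
        (mul_nonneg hγm.le (integral_id_nonneg hsm))
    · exact add_pos_of_nonneg_of_pos (mul_nonneg hγp.le (integral_id_nonneg hsp))
        (mul_pos hγm (integral_id_pos hsm him h))
  have hconv : StrictConvexOn ℝ (Iic 0) (fun w => Rlam ζp ζm γp γm u w) := by
    have hsum : StrictConvexOn ℝ (Iic 0)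
        ((fun w => psiM ζp (u + w * γp)) + fun w => psiM ζm (-u + w * γm)) := by
      rcases hcases with h | h
      · exact (strictConvexOn_psiM_affine hsp hip h hu1.le hγp).add_convexOn
          (convexOn_psiM_affine hsm him hu2.le hγm)
      · exact (convexOn_psiM_affine hsp hip hu1.le hγp).add_strictConvexOn
          (strictConvexOn_psiM_affine hsm him h hu2.le hγm)
    refine ⟨convex_Iic 0, fun x hx y hy hxy a b ha hb hab => ?_⟩
    have := hsum.2 hx hy hxy ha hb hab
    simp only [Pi.add_apply, smul_eq_mul] at this
    simp only [Rlam, smul_eq_mul, ← hM]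
    linear_combination this + u * (psiM ζp 1 + psiM ζm (-1)) * hab
  have hneg : Rlam ζp ζm γp γm u 0 < 0 := by
    have e : Rlam ζp ζm γp γm u 0 = (psiM ζp (u * 1) - u * psiM ζp 1)
        + (psiM ζm (u * -1) - u * psiM ζm (-1)) := by
      simp only [Rlam, zero_mul, add_zero, mul_one, mul_neg]
      ring
    have hp := psiM_mul_le hsp hip hu le_rfl
    have hm := psiM_mul_le hsm him hu (show (-1 : ℝ) ≤ 1 by norm_num)
    rw [e]
    rcases hcases with h | h
    · linarith [psiM_mul_lt hsp hip h hu le_rfl one_ne_zero]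
    · linarith [psiM_mul_lt hsm him h hu (show (-1 : ℝ) ≤ 1 by norm_num) (by norm_num)]
  have hlim : Tendsto (fun w => Rlam ζp ζm γp γm u w) atBot atTop := by
    have hlin : Tendsto (fun w : ℝ => (-2 - u * (psiM ζp 1 + psiM ζm (-1))) + -w * M)
        atBot atTop :=
      tendsto_atTop_add_const_left _ _ (tendsto_neg_atBot_atTop.atTop_mul_const hMpos)
    refine tendsto_atTop_mono' _ ?_ hlin
    filter_upwards [eventually_le_atBot 0] with w hw
    have hp := neg_one_le_psiM hsp hip (show u + w * γp ≤ 1 by nlinarith)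
    have hm := neg_one_le_psiM hsm him (show -u + w * γm ≤ 1 by nlinarith)
    simp only [Rlam, ← hM]
    linarith
  have hcont : ContinuousOn (fun w => Rlam ζp ζm γp γm u w) (Iic 0) :=
    (((continuousOn_psiM_affine hsp hip hu1 hγp).add
      (continuousOn_psiM_affine hsm him hu2 hγm)).sub continuousOn_const).sub (by fun_prop)
  exact ⟨hconv, hneg, hlim, hconv.exists_unique_neg_root hcont hneg hlim⟩
end

section
/- Let ζ₊, ζ₋ be probability measures on [0,∞) with ∫₀^∞ e^x ζ±(dx) < ∞, normalized so that ∫₀^∞ x² ζ₊(dx) + ∫₀^∞ x² ζ₋(dx) = 1, let p = ∫₀^∞ x² ζ₊(dx), let γ₊, γ₋ > 0, and set c = √(p γ₊² + (1−p) γ₋²) and ρ = (p γ₊ − (1−p) γ₋)/c. Then for every u ∈ [0,1] and w ≤ 0, lim_{ε → 0⁺} (1/ε) R^ε(u,w) = ½(u² − u) + c ρ u w + ½ c² w² = R_V(u, cw). -/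
open MeasureTheory Set Filter

/-- The rescaled function
`R^ε(u,w) = ψ₊(√ε(u + wγ₊)) + ψ₋(√ε(−u + wγ₋)) − u(ψ₊(√ε) + ψ₋(−√ε)) − w√ε(γ₊m₊ + γ₋m₋)`. -/
noncomputable def Reps (ζp ζm : MeasureTheory.Measure ℝ) (γp γm ε u w : ℝ) : ℝ :=
  psiM ζp (Real.sqrt ε * (u + w * γp)) + psiM ζm (Real.sqrt ε * (-u + w * γm))
    - u * (psiM ζp (Real.sqrt ε) + psiM ζm (-Real.sqrt ε))
    - w * Real.sqrt ε * (γp * (∫ x, x ∂ζp) + γm * (∫ x, x ∂ζm))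

open ProbabilityTheory in
/-- A measure on `[0, ∞)` with a finite exponential moment of order `1` has finite exponential
moments in a neighbourhood of `0`. -/
lemma zero_mem_interior_integrableExpSet (ζ : Measure ℝ) [IsFiniteMeasure ζ]
    (hs : ζ (Iio 0) = 0) (hi : Integrable (fun x => Real.exp x) ζ) :
    (0 : ℝ) ∈ interior (integrableExpSet id ζ) := by
  refine mem_interior.2 ⟨Iio 1, fun t ht => ?_, isOpen_Iio, by simp⟩
  have hnonneg : ∀ᵐ x ∂ζ, 0 ≤ x := by simpa [ae_iff, Iio] using hs
  refine (hi.add (integrable_const 1)).mono' (by fun_prop) ?_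
  filter_upwards [hnonneg] with x hx
  have hle : t * x ≤ x := mul_le_of_le_one_left hx (mem_Iio.1 ht).le
  simpa using (Real.exp_le_exp.2 hle).trans (le_add_of_nonneg_right zero_le_one)

open ProbabilityTheory in
lemma psiM_eq_mgf_sub_one (ζ : Measure ℝ) [IsProbabilityMeasure ζ] {t : ℝ}
    (ht : t ∈ integrableExpSet id ζ) : psiM ζ t = mgf id ζ t - 1 := by
  have hint : Integrable (fun x => Real.exp (t * x)) ζ := ht
  simp [psiM, mgf, integral_sub hint (integrable_const 1)]

open ProbabilityTheory in
/-- Second-order expansion of `psiM` at `0`. -/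
lemma tendsto_psiM_sub_div_sq (ζ : Measure ℝ) [IsProbabilityMeasure ζ]
    (h : (0 : ℝ) ∈ interior (integrableExpSet id ζ)) :
    Tendsto (fun t => (psiM ζ t - t * ∫ x, x ∂ζ) / t ^ 2) (nhdsWithin 0 {0}ᶜ)
      (nhds ((∫ x, x ^ 2 ∂ζ) / 2)) := by
  have hmem : ∀ᶠ t in nhds (0 : ℝ), t ∈ interior (integrableExpSet id ζ) :=
    isOpen_interior.eventually_mem h
  have hderiv : ∀ t ∈ interior (integrableExpSet id ζ),
      HasDerivAt (fun t => psiM ζ t - t * ∫ x, x ∂ζ)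
        ((∫ x, x * Real.exp (t * x) ∂ζ) - ∫ x, x ∂ζ) t := by
    intro t ht
    have hmgf : psiM ζ =ᶠ[nhds t] fun t => mgf id ζ t - 1 := by
      filter_upwards [isOpen_interior.eventually_mem ht] with r hr
      exact psiM_eq_mgf_sub_one ζ (interior_subset hr)
    have hpsi := ((hasDerivAt_mgf ht).sub_const 1).congr_of_eventuallyEq hmgf
    simpa using hpsi.fun_sub ((hasDerivAt_id t).mul_const (∫ x, x ∂ζ))
  have hsecond : HasDerivAt (fun t => ∫ x, x * Real.exp (t * x) ∂ζ) (∫ x, x ^ 2 ∂ζ) 0 := by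
    simpa using hasDerivAt_integral_pow_mul_exp_real h 1
  refine HasDerivAt.lhopital_zero_nhdsNE (f' := fun t => (∫ x, x * Real.exp (t * x) ∂ζ) - ∫ x, x ∂ζ)
    (g' := fun t => 2 * t) ((hmem.mono hderiv).filter_mono nhdsWithin_le_nhds)
    (.of_forall fun t => by simpa using hasDerivAt_pow 2 t) ?_ ?_ ?_ ?_
  · filter_upwards [self_mem_nhdsWithin] with t ht
    simpa using ht
  · have hcont := (hderiv 0 h).continuousAt.tendsto
    simp only [psiM, zero_mul, Real.exp_zero, sub_self, integral_zero] at hcont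
    exact hcont.mono_left nhdsWithin_le_nhds
  · have hcont := (continuous_pow 2 : Continuous fun t : ℝ => t ^ 2).tendsto 0
    rw [zero_pow two_ne_zero] at hcont
    exact hcont.mono_left nhdsWithin_le_nhds
  · refine ((hasDerivAt_iff_tendsto_slope.1 hsecond).div_const 2).congr fun t => ?_
    simp only [slope_def_field, zero_mul, Real.exp_zero, mul_one, sub_zero]
    rw [div_div, mul_comm t]

lemma tendsto_psiM_mul_sub_div_sq (ζ : Measure ℝ) [IsProbabilityMeasure ζ]
    (hs : ζ (Iio 0) = 0) (hi : Integrable (fun x => Real.exp x) ζ) (a : ℝ) :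
    Tendsto (fun t => (psiM ζ (t * a) - t * a * ∫ x, x ∂ζ) / t ^ 2) (nhdsWithin 0 {0}ᶜ)
      (nhds (a ^ 2 * ((∫ x, x ^ 2 ∂ζ) / 2))) := by
  rcases eq_or_ne a 0 with rfl | ha
  · simp [psiM]
  have hscale : Tendsto (fun t : ℝ => t * a) (nhdsWithin 0 {0}ᶜ) (nhdsWithin 0 {0}ᶜ) := by
    refine tendsto_nhdsWithin_iff.2 ⟨?_, ?_⟩
    · exact ((continuous_mul_const a).tendsto' 0 0 (zero_mul a)).mono_left nhdsWithin_le_nhds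
    · filter_upwards [self_mem_nhdsWithin] with t ht
      exact mul_ne_zero ht ha
  refine (((tendsto_psiM_sub_div_sq ζ (zero_mem_interior_integrableExpSet ζ hs hi)).comp
    hscale).const_mul (a ^ 2)).congr fun t => ?_
  simp only [Function.comp_apply]
  rw [mul_pow, mul_comm (t ^ 2), ← mul_div_assoc, mul_div_mul_left _ _ (pow_ne_zero 2 ha)]

/-- High-frequency limit: with `p = ∫ x² ζ₊(dx)`, `c = √(pγ₊² + (1−p)γ₋²)`,
`ρ = (pγ₊ − (1−p)γ₋)/c`, one has `(1/ε) R^ε(u,w) → ½(u²−u) + cρuw + ½c²w² = R_V(u,cw)`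
as `ε → 0⁺`, for `u ∈ [0,1]` and `w ≤ 0`. -/
theorem Reps_tendsto_RV
    (ζp ζm : MeasureTheory.Measure ℝ)
    [IsProbabilityMeasure ζp] [IsProbabilityMeasure ζm]
    (hsp : ζp (Set.Iio 0) = 0) (hsm : ζm (Set.Iio 0) = 0)
    (hip : Integrable (fun x => Real.exp x) ζp)
    (him : Integrable (fun x => Real.exp x) ζm)
    (hnorm : (∫ x, x ^ 2 ∂ζp) + ∫ x, x ^ 2 ∂ζm = 1)
    (γp γm : ℝ) (hγp : 0 < γp) (hγm : 0 < γm)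
    (u w : ℝ) (hu : u ∈ Set.Icc (0 : ℝ) 1) (hw : w ≤ 0) :
    let p : ℝ := ∫ x, x ^ 2 ∂ζp
    let c : ℝ := Real.sqrt (p * γp ^ 2 + (1 - p) * γm ^ 2)
    let ρ : ℝ := (p * γp - (1 - p) * γm) / c
    Tendsto (fun ε => (1 / ε) * Reps ζp ζm γp γm ε u w)
      (nhdsWithin 0 (Set.Ioi 0))
      (nhds ((u ^ 2 - u) / 2 + c * ρ * u * w + c ^ 2 * w ^ 2 / 2)) ∧
    (u ^ 2 - u) / 2 + c * ρ * u * w + c ^ 2 * w ^ 2 / 2 = RV ρ u (c * w) := by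
  intro p c ρ
  have hp0 : 0 ≤ p := integral_nonneg fun x => sq_nonneg x
  have hq0 : 0 ≤ ∫ x, x ^ 2 ∂ζm := integral_nonneg fun x => sq_nonneg x
  have hq : ∫ x, x ^ 2 ∂ζm = 1 - p := eq_sub_of_add_eq' hnorm
  rw [hq] at hq0
  have hpos : 0 < p * γp ^ 2 + (1 - p) * γm ^ 2 := by
    rcases hp0.eq_or_lt with hp | hp
    · rw [← hp]
      simpa using pow_pos hγm 2
    · positivity
  have hc2 : c ^ 2 = p * γp ^ 2 + (1 - p) * γm ^ 2 := Real.sq_sqrt hpos.le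
  have hcρ : c * ρ = p * γp - (1 - p) * γm := mul_div_cancel₀ _ (Real.sqrt_pos.2 hpos).ne'
  refine ⟨?_, by rw [RV]; ring⟩
  have hsqrt : Tendsto Real.sqrt (nhdsWithin 0 (Ioi 0)) (nhdsWithin 0 {0}ᶜ) := by
    refine tendsto_nhdsWithin_iff.2 ⟨?_, ?_⟩
    · exact (Real.continuous_sqrt.tendsto' 0 0 Real.sqrt_zero).mono_left nhdsWithin_le_nhds
    · filter_upwards [self_mem_nhdsWithin] with ε hε
      exact (Real.sqrt_pos.2 hε).ne'
  have hP := fun a => (tendsto_psiM_mul_sub_div_sq ζp hsp hip a).comp hsqrt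
  have hM := fun a => (tendsto_psiM_mul_sub_div_sq ζm hsm him a).comp hsqrt
  have hlim := ((hP (u + w * γp)).add (hM (-u + w * γm))).sub
    (((hP 1).add (hM (-1))).const_mul u)
  rw [hq] at hlim
  change Tendsto _ _ (nhds ((u + w * γp) ^ 2 * (p / 2) + (-u + w * γm) ^ 2 * ((1 - p) / 2)
    - u * (1 ^ 2 * (p / 2) + (-1) ^ 2 * ((1 - p) / 2)))) at hlim
  rw [hcρ, hc2]
  convert hlim.congr' ?_ using 2
  · ring
  · filter_upwards [self_mem_nhdsWithin] with ε hε
    simp only [Function.comp_apply, Reps, Real.sq_sqrt (mem_Ioi.1 hε).le, mul_one, mul_neg]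
    ring
end

section
/- Let H satisfy Assumption (H), let w₀ be the leftmost minimizer of H on (−∞, w_max], let κ be a decreasing L1-kernel which is not identically zero, and let a : [0,∞) → (w_*, w₀] be continuous and increasing. Then the nonlinear Volterra equation f(t) = a(t) + ∫₀^t κ(t−s) H(f(s)) ds has a unique global continuous solution f on [0,∞), and this solution satisfies w_* < Q₁⁻¹(∫₀^t κ(s) ds, a(0)) ≤ f(t) < a(t) for all t > 0. -/
open MeasureTheory Set Filter

/-- Assumption (H): `H : (−∞, w_max] → ℝ` (modeled on all of `ℝ`, with all
conditions imposed on `(−∞, w_max]`) is continuously differentiable and convex,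
has a unique root `w_*` in `(−∞, w_max]`, `H′(w_*) < 0` and `H(w_max) < 0`. -/
def AssumptionH (wmax wstar : ℝ) (H : ℝ → ℝ) : Prop :=
  wstar ≤ wmax ∧
  ContDiffOn ℝ 1 H (Set.Iic wmax) ∧
  ConvexOn ℝ (Set.Iic wmax) H ∧
  H wstar = 0 ∧
  (∀ w ∈ Set.Iic wmax, H w = 0 → w = wstar) ∧
  derivWithin H (Set.Iic wmax) wstar < 0 ∧
  H wmax < 0

lemma integral_nonpos_of_nonpos_on {g : ℝ → ℝ} {b c : ℝ} (hbc : b ≤ c)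
    (hg : ∀ s ∈ Icc b c, g s ≤ 0) : ∫ s in b..c, g s ≤ 0 := by
  have h := intervalIntegral.integral_nonneg (μ := volume) hbc fun s hs => neg_nonneg.2 (hg s hs)
  rwa [intervalIntegral.integral_neg, neg_nonneg] at h

/-- A nonnegative locally integrable convolution kernel on `[0,∞)`. -/
structure VolterraKernel (κ : ℝ → ℝ) : Prop where
  nonneg : ∀ t, 0 ≤ t → 0 ≤ κ t
  intervalIntegrable : ∀ T, 0 ≤ T → IntervalIntegrable κ volume 0 T

namespace VolterraKernel

variable {κ : ℝ → ℝ}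

lemma intervalIntegrable_of_nonneg (hκ : VolterraKernel κ) {b c : ℝ} (hb : 0 ≤ b) (hc : 0 ≤ c) :
    IntervalIntegrable κ volume b c :=
  (hκ.intervalIntegrable b hb).symm.trans (hκ.intervalIntegrable c hc)

lemma intervalIntegrable_comp_sub (hκ : VolterraKernel κ) {t b c : ℝ} (hb : b ≤ t) (hc : c ≤ t) :
    IntervalIntegrable (fun s => κ (t - s)) volume b c := by
  simpa using (hκ.intervalIntegrable_of_nonneg (sub_nonneg.2 hb) (sub_nonneg.2 hc)).comp_sub_left t

lemma intervalIntegrable_conv (hκ : VolterraKernel κ) {h : ℝ → ℝ} {t b c : ℝ} (hb : b ≤ t)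
    (hc : c ≤ t) (hh : ContinuousOn h (uIcc b c)) :
    IntervalIntegrable (fun s => κ (t - s) * h s) volume b c :=
  (hκ.intervalIntegrable_comp_sub hb hc).mul_continuousOn hh

lemma integral_conv_comm (h : ℝ → ℝ) (t : ℝ) :
    ∫ s in (0:ℝ)..t, κ (t - s) * h s = ∫ u in (0:ℝ)..t, κ u * h (t - u) := by
  simpa using intervalIntegral.integral_comp_sub_left (a := 0) (b := t)
    (fun u => κ u * h (t - u)) t

lemma integral_comp_sub (t b : ℝ) :
    ∫ s in b..t, κ (t - s) = ∫ u in (0:ℝ)..(t - b), κ u := by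
  simp

lemma integral_mono_right (hκ : VolterraKernel κ) {b c : ℝ} (hb : 0 ≤ b) (hbc : b ≤ c) :
    ∫ u in (0:ℝ)..b, κ u ≤ ∫ u in (0:ℝ)..c, κ u := by
  rw [← intervalIntegral.integral_add_adjacent_intervals (hκ.intervalIntegrable b hb)
    (hκ.intervalIntegrable_of_nonneg hb (hb.trans hbc))]
  have : 0 ≤ ∫ u in b..c, κ u :=
    intervalIntegral.integral_nonneg hbc fun u hu => hκ.nonneg u (hb.trans hu.1)
  linarith

lemma integral_nonneg (hκ : VolterraKernel κ) {b : ℝ} (hb : 0 ≤ b) :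
    0 ≤ ∫ u in (0:ℝ)..b, κ u :=
  intervalIntegral.integral_nonneg hb fun u hu => hκ.nonneg u hu.1

lemma exists_integral_lt (hκ : VolterraKernel κ) {ε : ℝ} (hε : 0 < ε) :
    ∃ δ > 0, ∫ u in (0:ℝ)..δ, κ u < ε := by
  have hc : ContinuousWithinAt (fun x => ∫ u in (0:ℝ)..x, κ u) (Icc 0 1) 0 := by
    have := intervalIntegral.continuousOn_primitive_interval (μ := volume) (f := κ) (a := 0) (b := 1)
      (by
        rw [uIcc_of_le zero_le_one, integrableOn_Icc_iff_integrableOn_Ioc]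
        exact (hκ.intervalIntegrable 1 zero_le_one).1)
    rw [uIcc_of_le zero_le_one] at this
    exact this 0 (by simp)
  have h0 : ∀ᶠ x in nhdsWithin (0:ℝ) (Icc 0 1), ∫ u in (0:ℝ)..x, κ u < ε :=
    hc.eventually (gt_mem_nhds (by simpa using hε))
  have h1 : ∀ᶠ x in nhdsWithin (0:ℝ) (Ioo 0 1), ∫ u in (0:ℝ)..x, κ u < ε :=
    nhdsWithin_mono _ Ioo_subset_Icc_self h0
  have hne : (nhdsWithin (0:ℝ) (Ioo 0 1)).NeBot := by
    rw [nhdsWithin_Ioo_eq_nhdsGT zero_lt_one]; infer_instance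
  obtain ⟨x, hx, hx'⟩ := (h1.and self_mem_nhdsWithin).exists
  exact ⟨x, hx'.1, hx⟩

lemma exp_mul (hκ : VolterraKernel κ) (l : ℝ) :
    VolterraKernel fun u => κ u * Real.exp (-(l * u)) where
  nonneg t ht := mul_nonneg (hκ.nonneg t ht) (Real.exp_pos _).le
  intervalIntegrable T hT := (hκ.intervalIntegrable T hT).mul_continuousOn (by fun_prop)

/-- The truncated Laplace transform of a decreasing kernel is uniformly small at some rate. -/
lemma exists_laplace_le (hκ : VolterraKernel κ) (hdec : AntitoneOn κ (Ioi 0)) {ε : ℝ}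
    (hε : 0 < ε) :
    ∃ l > 0, ∀ T, 0 ≤ T → ∫ u in (0:ℝ)..T, κ u * Real.exp (-(l * u)) ≤ ε := by
  obtain ⟨δ, hδ, hδε⟩ := hκ.exists_integral_lt (half_pos hε)
  have hκδ := hκ.nonneg δ hδ.le
  refine ⟨2 * (κ δ + 1) / ε, by positivity, fun T hT => ?_⟩
  set l := 2 * (κ δ + 1) / ε with hl
  have hl0 : 0 < l := by positivity
  have hκl := hκ.exp_mul l
  refine (hκl.integral_mono_right hT (le_max_left T δ)).trans ?_
  have hM : δ ≤ max T δ := le_max_right _ _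
  rw [← intervalIntegral.integral_add_adjacent_intervals (hκl.intervalIntegrable δ hδ.le)
    (hκl.intervalIntegrable_of_nonneg hδ.le (hδ.le.trans hM))]
  have h1 : ∫ u in (0:ℝ)..δ, κ u * Real.exp (-(l * u)) ≤ ∫ u in (0:ℝ)..δ, κ u := by
    refine intervalIntegral.integral_mono_on hδ.le (hκl.intervalIntegrable δ hδ.le)
      (hκ.intervalIntegrable δ hδ.le) fun u hu => ?_
    refine mul_le_of_le_one_right (hκ.nonneg u hu.1) (Real.exp_le_one_iff.2 ?_)
    have := mul_nonneg hl0.le hu.1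
    linarith
  have h2 : ∫ u in δ..max T δ, κ u * Real.exp (-(l * u))
      ≤ ∫ u in δ..max T δ, κ δ * Real.exp (-(l * u)) := by
    refine intervalIntegral.integral_mono_on hM
      (hκl.intervalIntegrable_of_nonneg hδ.le (hδ.le.trans hM))
      (Continuous.intervalIntegrable (by fun_prop) _ _) fun u hu => ?_
    exact mul_le_mul_of_nonneg_right (hdec hδ (hδ.trans_le hu.1) hu.1) (Real.exp_pos _).le
  have h3 : ∫ u in δ..max T δ, κ δ * Real.exp (-(l * u)) ≤ κ δ / l := by
    have hd : ∀ u ∈ uIcc δ (max T δ), HasDerivAt (fun u => -(κ δ / l) * Real.exp (-(l * u)))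
        (κ δ * Real.exp (-(l * u))) u := by
      intro u _
      have := (((hasDerivAt_id u).const_mul l).neg.exp).const_mul (-(κ δ / l))
      refine this.congr_deriv ?_
      simp only [id, Pi.neg_apply]
      field_simp
    rw [intervalIntegral.integral_eq_sub_of_hasDerivAt hd
      (Continuous.intervalIntegrable (by fun_prop) _ _)]
    have e1 : Real.exp (-(l * δ)) ≤ 1 := Real.exp_le_one_iff.2 (by nlinarith)
    have e2 := Real.exp_pos (-(l * max T δ))
    have hq : 0 ≤ κ δ / l := by positivity
    nlinarith
  have h4 : κ δ / l ≤ ε / 2 := by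
    rw [div_le_iff₀ hl0, hl]
    field_simp
    linarith
  linarith

/-- A Gronwall-type inequality: a nonnegative function dominated by a multiple of its own
convolution with the kernel vanishes. -/
lemma eq_zero_of_le_conv (hκ : VolterraKernel κ) (hdec : AntitoneOn κ (Ioi 0)) {d : ℝ → ℝ}
    {T L : ℝ} (hL : 0 ≤ L) (hd : ContinuousOn d (Icc 0 T)) (hd0 : ∀ t ∈ Icc 0 T, 0 ≤ d t)
    (hle : ∀ t ∈ Icc 0 T, d t ≤ L * ∫ s in (0:ℝ)..t, κ (t - s) * d s) :
    ∀ t ∈ Icc 0 T, d t = 0 := by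
  intro t ht
  obtain ⟨l, hl, hint⟩ := hκ.exists_laplace_le hdec (ε := 1 / (2 * (L + 1))) (by positivity)
  obtain ⟨m, hm, hmax⟩ := isCompact_Icc.exists_isMaxOn ⟨t, ht⟩
    (hd.mul (f := d) (g := fun s => Real.exp (-(l * s))) (by fun_prop))
  set M := d m * Real.exp (-(l * m)) with hMdef
  have hdm := hd0 m hm
  have hM : 0 ≤ M := mul_nonneg hdm (Real.exp_pos _).le
  have hds : ∀ s ∈ Icc 0 T, d s ≤ M * Real.exp (l * s) := by
    intro s hs
    have h1 : d s * Real.exp (-(l * s)) ≤ M := hmax hs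
    have h2 := mul_le_mul_of_nonneg_right h1 (Real.exp_pos (l * s)).le
    rwa [mul_assoc, ← Real.exp_add, neg_add_cancel, Real.exp_zero, mul_one] at h2
  have hsub : uIcc 0 m ⊆ Icc 0 T := by
    rw [uIcc_of_le hm.1]; exact Icc_subset_Icc_right hm.2
  have h1 : ∫ s in (0:ℝ)..m, κ (m - s) * d s
      ≤ ∫ s in (0:ℝ)..m, κ (m - s) * (M * Real.exp (l * s)) := by
    refine intervalIntegral.integral_mono_on hm.1
      (hκ.intervalIntegrable_conv hm.1 le_rfl (hd.mono hsub))
      (hκ.intervalIntegrable_conv hm.1 le_rfl (by fun_prop)) fun s hs => ?_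
    exact mul_le_mul_of_nonneg_left (hds s ⟨hs.1, hs.2.trans hm.2⟩)
      (hκ.nonneg _ (sub_nonneg.2 hs.2))
  have h2 : ∫ s in (0:ℝ)..m, κ (m - s) * (M * Real.exp (l * s))
      = d m * ∫ u in (0:ℝ)..m, κ u * Real.exp (-(l * u)) := by
    rw [integral_conv_comm, ← intervalIntegral.integral_const_mul]
    refine intervalIntegral.integral_congr fun u _ => ?_
    have : Real.exp (-(l * m)) * Real.exp (l * (m - u)) = Real.exp (-(l * u)) := by
      rw [← Real.exp_add]; ring_nf
    simp only [hMdef, ← this]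
    ring
  have h3 : d m ≤ L * (d m * (1 / (2 * (L + 1)))) :=
    (hle m hm).trans (mul_le_mul_of_nonneg_left
      (h1.trans (h2.le.trans (mul_le_mul_of_nonneg_left (hint m hm.1) hdm))) hL)
  have h4 : d m ≤ 0 := by
    have h5 : L * (d m * (1 / (2 * (L + 1)))) ≤ d m / 2 := by
      rw [mul_one_div, ← mul_div_assoc, div_le_div_iff₀ (by positivity) (by positivity)]
      nlinarith
    linarith
  have h5 : M = 0 := by rw [hMdef, le_antisymm h4 hdm, zero_mul]
  exact le_antisymm (by simpa [h5] using hds t ht) (hd0 t ht)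

lemma continuousOn_conv (hκ : VolterraKernel κ) {g : ℝ → ℝ} (hg : ContinuousOn g (Ici 0)) :
    ContinuousOn (fun t => ∫ s in (0:ℝ)..t, κ (t - s) * g s) (Ici 0) := by
  have key : ∀ T : ℝ, 0 ≤ T →
      ContinuousOn (fun t => ∫ s in (0:ℝ)..t, κ (t - s) * g s) (Icc 0 T) := by
    intro T hT
    set g' : ℝ → ℝ := fun v => g (projIcc 0 T hT v) with hg'
    have hgT : ContinuousOn g (Icc 0 T) := hg.mono Icc_subset_Ici_self
    have hg'c : Continuous g' :=
      hgT.comp_continuous (continuous_subtype_val.comp continuous_projIcc)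
        fun v => (projIcc 0 T hT v).2
    obtain ⟨M, hM⟩ := isCompact_Icc.exists_bound_of_continuousOn hgT
    have hg'M : ∀ v, ‖g' v‖ ≤ M := fun v => hM _ (projIcc 0 T hT v).2
    have hκT := hκ.intervalIntegrable T hT
    have hF : Continuous fun t => ∫ u in (0:ℝ)..T, κ u * g' (t - u) := by
      refine intervalIntegral.continuous_of_dominated_interval (bound := fun u => ‖κ u‖ * M)
        (fun t => ?_) (fun t => ?_) (hκT.norm.mul_const M) ?_
      · rw [uIoc_of_le hT]
        exact hκT.1.aestronglyMeasurable.mul (by fun_prop)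
      · refine Eventually.of_forall fun u _ => ?_
        rw [norm_mul]
        exact mul_le_mul_of_nonneg_left (hg'M _) (norm_nonneg _)
      · exact Eventually.of_forall fun u _ => by fun_prop
    have hP : ContinuousOn (fun t => ∫ u in (0:ℝ)..t, κ u) (Icc 0 T) := by
      have := intervalIntegral.continuousOn_primitive_interval (μ := volume) (f := κ)
        (a := 0) (b := T)
        (by rw [uIcc_of_le hT, integrableOn_Icc_iff_integrableOn_Ioc]; exact hκT.1)
      rwa [uIcc_of_le hT] at this
    refine ((hF.continuousOn.sub (((continuousOn_const (c := ∫ u in (0:ℝ)..T, κ u)).sub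
      hP).mul_const (g 0)))).congr fun t ht => ?_
    have i1 : IntervalIntegrable (fun u => κ u * g' (t - u)) volume 0 t :=
      (hκ.intervalIntegrable t ht.1).mul_continuousOn (by fun_prop)
    have i2 : IntervalIntegrable (fun u => κ u * g' (t - u)) volume t T :=
      (hκ.intervalIntegrable_of_nonneg ht.1 hT).mul_continuousOn (by fun_prop)
    have e1 : ∫ u in (0:ℝ)..t, κ u * g (t - u) = ∫ u in (0:ℝ)..t, κ u * g' (t - u) := by
      refine intervalIntegral.integral_congr fun u hu => ?_
      rw [uIcc_of_le ht.1] at hu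
      have : t - u ∈ Icc 0 T := ⟨by linarith [hu.2], by linarith [hu.1, ht.2]⟩
      simp only [hg', projIcc_of_mem hT this]
    have e2 : ∫ u in t..T, κ u * g' (t - u) = (∫ u in t..T, κ u) * g 0 := by
      rw [← intervalIntegral.integral_mul_const]
      refine intervalIntegral.integral_congr fun u hu => ?_
      rw [uIcc_of_le ht.2] at hu
      have : t - u ≤ 0 := by linarith [hu.1]
      simp only [hg', projIcc_of_le_left hT this]
    have e3 := intervalIntegral.integral_add_adjacent_intervals i1 i2
    have e4 := intervalIntegral.integral_add_adjacent_intervals (hκ.intervalIntegrable t ht.1)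
      (hκ.intervalIntegrable_of_nonneg ht.1 hT)
    simp only [integral_conv_comm, Pi.sub_apply]
    rw [e1, ← e3, e2, ← e4]
    ring
  intro t ht
  have h := key (t + 1) (by linarith [mem_Ici.1 ht]) t ⟨ht, by linarith⟩
  refine h.mono_of_mem_nhdsWithin ?_
  have : Ici (0:ℝ) ∩ Iio (t + 1) ∈ nhdsWithin t (Ici 0) :=
    inter_mem self_mem_nhdsWithin (mem_nhdsWithin_of_mem_nhds (Iio_mem_nhds (by linarith)))
  exact mem_of_superset this fun x hx => ⟨hx.1, hx.2.le⟩

/-- Positivity of solutions to a Volterra inequality with decreasing kernel and increasing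
forcing term. -/
lemma pos_of_eq_sub_conv (hκ : VolterraKernel κ) (hdec : AntitoneOn κ (Ioi 0))
    {x g h : ℝ → ℝ} {C : ℝ} (hC : 0 ≤ C) (hx : ContinuousOn x (Ici 0))
    (hh : ContinuousOn h (Ici 0)) (hx0 : 0 < x 0)
    (hg : ∀ t t', 0 < t → t ≤ t' → t' ≤ 2 * t → g t ≤ g t')
    (hhx : ∀ t, 0 ≤ t → 0 ≤ x t → 0 ≤ h t ∧ h t ≤ C * x t)
    (heq : ∀ t, 0 ≤ t → x t = g t - ∫ s in (0:ℝ)..t, κ (t - s) * h s) :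
    ∀ t, 0 ≤ t → 0 < x t := by
  by_contra! hcon
  obtain ⟨t₁, ht₁, hxt₁⟩ := hcon
  set S : Set ℝ := Ici 0 ∩ x ⁻¹' Iic 0 with hS
  have hScl : IsClosed S := hx.preimage_isClosed_of_isClosed isClosed_Ici isClosed_Iic
  have hSbdd : BddBelow S := ⟨0, fun y hy => hy.1⟩
  have hmem : sInf S ∈ S := hScl.csInf_mem ⟨t₁, ht₁, hxt₁⟩ hSbdd
  set b := sInf S with hb
  have hxb : x b ≤ 0 := hmem.2
  have hb0 : 0 < b := lt_of_le_of_ne hmem.1 fun h => by rw [← h] at hxb; linarith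
  have hpos : ∀ s, 0 ≤ s → s < b → 0 < x s := by
    intro s hs hsb
    by_contra! hxs
    exact absurd (csInf_le hSbdd (⟨hs, hxs⟩ : s ∈ S)) (not_le.2 hsb)
  obtain ⟨δ, hδ, hδC⟩ := hκ.exists_integral_lt (ε := 1 / (C + 1)) (by positivity)
  set η := min δ (b / 2) with hη
  have hη0 : 0 < η := lt_min hδ (half_pos hb0)
  have hηb : η ≤ b / 2 := min_le_right _ _
  have hsubI : Icc (b - η) b ⊆ Ici 0 := fun y hy => by
    have := hy.1; simp only [mem_Ici]; linarith
  obtain ⟨m, hm, hmax⟩ := isCompact_Icc.exists_isMaxOn ⟨b - η, by constructor <;> linarith⟩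
    (hx.mono hsubI)
  have hm0 : 0 < m := by linarith [hm.1]
  have hxm : 0 < x m := by
    refine (hpos (b - η) (by linarith) (by linarith)).trans_le
      (hmax ⟨le_rfl, by linarith⟩)
  have hmb : m < b := lt_of_le_of_ne hm.2 fun h => by rw [h] at hxm; linarith
  have hcont : ∀ {p q : ℝ}, 0 ≤ p → 0 ≤ q → ContinuousOn h (uIcc p q) := fun hp hq =>
    hh.mono fun y hy => (le_min hp hq).trans hy.1
  have j1 := hκ.intervalIntegrable_conv hb0.le hm.2 (hcont le_rfl hm0.le)
  have j2 := hκ.intervalIntegrable_conv hm.2 le_rfl (hcont hm0.le hb0.le)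
  have j3 := hκ.intervalIntegrable_conv hm0.le le_rfl (hcont le_rfl hm0.le)
  have k1 : ∫ s in (0:ℝ)..m, κ (b - s) * h s ≤ ∫ s in (0:ℝ)..m, κ (m - s) * h s := by
    refine intervalIntegral.integral_mono_on_of_le_Ioo hm0.le j1 j3 fun s hs => ?_
    refine mul_le_mul_of_nonneg_right (hdec ?_ ?_ ?_)
      (hhx s hs.1.le (hpos s hs.1.le (hs.2.trans hmb)).le).1
    · simpa using hs.2
    · simpa using hs.2.trans hmb
    · linarith
  have k2 : ∫ s in m..b, κ (b - s) * h s ≤ ∫ s in m..b, κ (b - s) * (C * x m) := by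
    refine intervalIntegral.integral_mono_on_of_le_Ioo hm.2 j2
      ((hκ.intervalIntegrable_comp_sub hm.2 le_rfl).mul_const _) fun s hs => ?_
    have hs0 : 0 ≤ s := hm0.le.trans hs.1.le
    refine mul_le_mul_of_nonneg_left ?_ (hκ.nonneg _ (sub_nonneg.2 hs.2.le))
    refine (hhx s hs0 (hpos s hs0 hs.2).le).2.trans (mul_le_mul_of_nonneg_left ?_ hC)
    exact hmax ⟨by linarith [hm.1, hs.1], hs.2.le⟩
  rw [intervalIntegral.integral_mul_const, integral_comp_sub] at k2
  have k3 : ∫ u in (0:ℝ)..(b - m), κ u ≤ 1 / (C + 1) :=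
    (hκ.integral_mono_right (by linarith)
      (by linarith [hm.1, min_le_left δ (b / 2)])).trans hδC.le
  have k4 : (∫ u in (0:ℝ)..(b - m), κ u) * (C * x m) ≤ 1 / (C + 1) * (C * x m) :=
    mul_le_mul_of_nonneg_right k3 (by positivity)
  have k5 : 1 / (C + 1) * (C * x m) < x m := by
    rw [one_div_mul_eq_div, div_lt_iff₀ (by positivity)]
    nlinarith
  have k6 := intervalIntegral.integral_add_adjacent_intervals j1 j2
  have k7 := heq b hb0.le
  have k8 := heq m hm0.le
  have k9 := hg m b hm0 hm.2 (by linarith [hm.1])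
  linarith

/-- Global solvability of a Volterra equation with bounded forcing term and bounded Lipschitz
nonlinearity. -/
lemma exists_solution (hκ : VolterraKernel κ) (hdec : AntitoneOn κ (Ioi 0)) {a φ : ℝ → ℝ}
    {A B : ℝ} {L : NNReal} (ha : ContinuousOn a (Ici 0)) (haA : ∀ t, 0 ≤ t → |a t| ≤ A)
    (hφ : LipschitzWith L φ) (hφB : ∀ x, |φ x| ≤ B) :
    ∃ f : ℝ → ℝ, Continuous f ∧
      ∀ t, 0 ≤ t → f t = a t + ∫ s in (0:ℝ)..t, κ (t - s) * φ (f s) := by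
  obtain ⟨l, hl, hint⟩ := hκ.exists_laplace_le hdec (ε := 1 / (2 * ((L:ℝ) + 1))) (by positivity)
  set k : ℝ → ℝ := fun u => κ u * Real.exp (-(l * u)) with hk
  have hkV : VolterraKernel k := hκ.exp_mul l
  set G : ℝ → ℝ → ℝ := fun s y => Real.exp (-(l * s)) * φ (Real.exp (l * s) * y) with hG
  have hφc := hφ.continuous
  have hGc : ∀ y : ℝ → ℝ, Continuous y → Continuous fun s => G s (y s) := fun y hy => by
    simp only [hG]; fun_prop
  have hexp : ∀ s, 0 ≤ s → Real.exp (-(l * s)) ≤ 1 := fun s hs =>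
    Real.exp_le_one_iff.2 (by have := mul_nonneg hl.le hs; linarith)
  have hB : 0 ≤ B := (abs_nonneg _).trans (hφB 0)
  have hA : 0 ≤ A := (abs_nonneg _).trans (haA 0 le_rfl)
  have hGB : ∀ s, 0 ≤ s → ∀ y, |G s y| ≤ B := by
    intro s hs y
    rw [hG, abs_mul, abs_of_pos (Real.exp_pos _)]
    exact (mul_le_of_le_one_left (abs_nonneg _) (hexp s hs)).trans (hφB _)
  have hGL : ∀ s y z, |G s y - G s z| ≤ L * |y - z| := by
    intro s y z
    have h1 := hφ.dist_le_mul (Real.exp (l * s) * y) (Real.exp (l * s) * z)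
    rw [Real.dist_eq, Real.dist_eq, ← mul_sub, abs_mul, abs_of_pos (Real.exp_pos _)] at h1
    simp only [hG]
    rw [← mul_sub, abs_mul, abs_of_pos (Real.exp_pos _)]
    refine (mul_le_mul_of_nonneg_left h1 (Real.exp_pos _).le).trans_eq ?_
    have : Real.exp (-(l * s)) * Real.exp (l * s) = 1 := by rw [← Real.exp_add]; simp
    linear_combination (L * |y - z|) * this
  set E : ℝ := 1 / (2 * ((L:ℝ) + 1)) with hE
  have hE0 : 0 ≤ E := by positivity
  have hconv : ∀ (h : ℝ → ℝ) (D t : ℝ), 0 ≤ t → (∀ s, 0 ≤ s → |h s| ≤ D) → 0 ≤ D →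
      |∫ s in (0:ℝ)..t, k (t - s) * h s| ≤ E * D := by
    intro h D t ht hD hD0
    have h1 : ‖∫ s in (0:ℝ)..t, k (t - s) * h s‖ ≤ ∫ s in (0:ℝ)..t, k (t - s) * D := by
      refine intervalIntegral.norm_integral_le_of_norm_le ht
        (Eventually.of_forall fun s hs => ?_)
        ((hkV.intervalIntegrable_comp_sub ht le_rfl).mul_const D)
      have hks := hkV.nonneg (t - s) (sub_nonneg.2 hs.2)
      rw [norm_mul, Real.norm_of_nonneg hks]
      exact mul_le_mul_of_nonneg_left (hD s hs.1.le) hks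
    rw [intervalIntegral.integral_mul_const, integral_comp_sub, sub_zero] at h1
    exact h1.trans (mul_le_mul_of_nonneg_right (hint t ht) hD0)
  set F : (ℝ → ℝ) → ℝ → ℝ := fun y t => Real.exp (-(l * t)) * a t +
    ∫ s in (0:ℝ)..t, k (t - s) * G s (y s) with hF
  have hFc : ∀ y : ℝ → ℝ, Continuous y → Continuous fun t => F y (max t 0) := by
    intro y hy
    have h1 : ContinuousOn (F y) (Ici 0) :=
      (ContinuousOn.mul (by fun_prop) ha).add (hkV.continuousOn_conv (hGc y hy).continuousOn)
    exact h1.comp_continuous (by fun_prop) fun t => le_max_right t 0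
  have hFB : ∀ (y : ℝ → ℝ) t, ‖F y (max t 0)‖ ≤ A + E * B := by
    intro y t
    have ht : 0 ≤ max t 0 := le_max_right t 0
    refine (norm_add_le _ _).trans (add_le_add ?_
      (hconv _ B _ ht (fun s hs => hGB s hs _) hB))
    rw [norm_mul, Real.norm_of_nonneg (Real.exp_pos _).le]
    exact (mul_le_of_le_one_left (norm_nonneg _) (hexp _ ht)).trans (haA _ ht)
  let Φ : BoundedContinuousFunction ℝ ℝ → BoundedContinuousFunction ℝ ℝ := fun y =>
    BoundedContinuousFunction.ofNormedAddCommGroup (fun t => F y (max t 0)) (hFc y y.continuous)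
      (A + E * B) (hFB y)
  have hΦ : ContractingWith (1 / 2) Φ := by
    refine ⟨by rw [← NNReal.coe_lt_coe]; norm_num, LipschitzWith.of_dist_le_mul fun y z => ?_⟩
    rw [BoundedContinuousFunction.dist_le (by positivity)]
    intro t
    have ht : 0 ≤ max t 0 := le_max_right t 0
    have hcI : ∀ y : BoundedContinuousFunction ℝ ℝ,
        IntervalIntegrable (fun s => k (max t 0 - s) * G s (y s)) volume 0 (max t 0) := fun y =>
      hkV.intervalIntegrable_conv ht le_rfl (hGc y y.continuous).continuousOn
    have h1 : Φ y t - Φ z t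
        = ∫ s in (0:ℝ)..max t 0, k (max t 0 - s) * (G s (y s) - G s (z s)) := by
      simp only [mul_sub]
      rw [intervalIntegral.integral_sub (hcI y) (hcI z)]
      change F y (max t 0) - F z (max t 0) = _
      simp only [hF]
      ring
    rw [Real.dist_eq, h1]
    refine (hconv _ (L * dist y z) _ ht (fun s _ => (hGL s _ _).trans
      (mul_le_mul_of_nonneg_left 
        ((Real.dist_eq _ _).symm.trans_le (BoundedContinuousFunction.dist_coe_le_dist s)) L.2))
      (by positivity)).trans ?_
    rw [← mul_assoc]
    refine mul_le_mul_of_nonneg_right ?_ dist_nonneg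
    have hL0 : (0:ℝ) ≤ L := L.2
    rw [hE, one_div_mul_eq_div, div_le_iff₀ (by positivity)]
    push_cast
    linarith
  set y := hΦ.fixedPoint Φ with hy
  have hfix : ∀ t, 0 ≤ t → y t = F y t := by
    intro t ht
    have h1 : Φ y = y := hΦ.fixedPoint_isFixedPt
    have h2 : Φ y t = F y (max t 0) := rfl
    rw [h1, max_eq_left ht] at h2
    exact h2
  refine ⟨fun t => Real.exp (l * t) * y t, by fun_prop, fun t ht => ?_⟩
  simp only
  rw [hfix t ht]
  simp only [hF]
  rw [mul_add, ← mul_assoc, ← Real.exp_add, add_neg_cancel, Real.exp_zero, one_mul,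
    ← intervalIntegral.integral_const_mul]
  congr 1
  refine intervalIntegral.integral_congr fun s _ => ?_
  simp only [hk, hG]
  have : Real.exp (l * t) * Real.exp (-(l * (t - s))) * Real.exp (-(l * s)) = 1 := by
    rw [← Real.exp_add, ← Real.exp_add, ← Real.exp_zero]; ring_nf
  linear_combination (κ (t - s) * φ (Real.exp (l * s) * y s)) * this

end VolterraKernel

namespace VolterraKernel

variable {κ : ℝ → ℝ}

lemma continuousOn_integral (hκ : VolterraKernel κ) :
    ContinuousOn (fun t => ∫ u in (0:ℝ)..t, κ u) (Ici 0) := by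
  have := hκ.continuousOn_conv (g := fun _ => 1) continuousOn_const
  simpa using this

lemma hasDerivAt_integral (hκ : VolterraKernel κ) (hc : ContinuousOn κ (Ioi 0)) {t : ℝ}
    (ht : 0 < t) : HasDerivAt (fun t => ∫ u in (0:ℝ)..t, κ u) (κ t) t :=
  intervalIntegral.integral_hasDerivAt_right (hκ.intervalIntegrable t ht.le)
    (hc.stronglyMeasurableAtFilter isOpen_Ioi t ht) (hc.continuousAt (Ioi_mem_nhds ht))

lemma monotoneOn_integral (hκ : VolterraKernel κ) :
    MonotoneOn (fun t => ∫ u in (0:ℝ)..t, κ u) (Ici 0) :=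
  fun _ hb _ _ hbc => hκ.integral_mono_right hb hbc

/-- Rearrangement: convolving a decreasing kernel with an increasing function dominates, in
increments, the integral of their pointwise product. -/
lemma conv_add_integral_mul_le (hκ : VolterraKernel κ) (hdec : AntitoneOn κ (Ioi 0)) {φ : ℝ → ℝ}
    (hφ : ContinuousOn φ (Ici 0)) (hmono : MonotoneOn φ (Ici 0)) {t t' : ℝ} (ht : 0 < t)
    (htt' : t ≤ t') (ht' : t' ≤ 2 * t) :
    (∫ s in (0:ℝ)..t, κ (t - s) * φ s) + ∫ s in t..t', κ s * φ s
      ≤ ∫ s in (0:ℝ)..t', κ (t' - s) * φ s := by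
  rw [integral_conv_comm, integral_conv_comm]
  have c0 : ∀ {p q : ℝ}, 0 ≤ p → 0 ≤ q → ContinuousOn φ (uIcc p q) := fun hp hq =>
    hφ.mono fun y hy => (le_min hp hq).trans hy.1
  have c1 : ∀ {T p q : ℝ}, p ≤ T → q ≤ T → ContinuousOn (fun u => φ (T - u)) (uIcc p q) :=
    fun hp hq => hφ.comp (by fun_prop) fun y hy => sub_nonneg.2 (hy.2.trans (max_le hp hq))
  have t0 : 0 ≤ t' := ht.le.trans htt'
  have K0 := hκ.intervalIntegrable t ht.le
  have K1 := hκ.intervalIntegrable_of_nonneg ht.le t0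
  have i1 := (c1 t0 htt' : ContinuousOn (fun u => φ (t' - u)) (uIcc 0 t))
  have i2 := (c1 ht.le le_rfl : ContinuousOn (fun u => φ (t - u)) (uIcc 0 t))
  have i3 := (c1 htt' le_rfl : ContinuousOn (fun u => φ (t' - u)) (uIcc t t'))
  have i4 := c0 ht.le t0
  have A : ∫ u in (0:ℝ)..t, κ t * (φ (t' - u) - φ (t - u))
      ≤ ∫ u in (0:ℝ)..t, κ u * (φ (t' - u) - φ (t - u)) := by
    refine intervalIntegral.integral_mono_on_of_le_Ioo ht.le
      ((i1.sub i2).intervalIntegrable.const_mul _) (K0.mul_continuousOn (i1.sub i2))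
      fun u hu => ?_
    refine mul_le_mul_of_nonneg_right (hdec hu.1 ht hu.2.le) (sub_nonneg.2 (hmono ?_ ?_ ?_))
    · simpa using hu.2.le
    · simpa using hu.2.le.trans htt'
    · linarith
  have B : ∫ u in t..t', κ t * (φ (t' - u) - φ u) ≤ ∫ u in t..t', κ u * (φ (t' - u) - φ u) := by
    refine intervalIntegral.integral_mono_on_of_le_Ioo htt'
      ((i3.sub i4).intervalIntegrable.const_mul _) (K1.mul_continuousOn (i3.sub i4))
      fun u hu => ?_
    refine mul_le_mul_of_nonpos_right (hdec ht (ht.trans hu.1) hu.1.le)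
      (sub_nonpos.2 (hmono ?_ ?_ ?_))
    · simpa using hu.2.le
    · exact ht.le.trans hu.1.le
    · linarith [hu.1]
  rw [intervalIntegral.integral_const_mul, intervalIntegral.integral_sub i1.intervalIntegrable
    i2.intervalIntegrable] at A
  rw [intervalIntegral.integral_const_mul, intervalIntegral.integral_sub i3.intervalIntegrable
    i4.intervalIntegrable] at B
  simp only [mul_sub (κ _)] at A B
  rw [intervalIntegral.integral_sub (K0.mul_continuousOn i1) (K0.mul_continuousOn i2)] at A
  rw [intervalIntegral.integral_sub (K1.mul_continuousOn i3) (K1.mul_continuousOn i4)] at B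
  have s1 := intervalIntegral.integral_add_adjacent_intervals (K0.mul_continuousOn i1)
    (K1.mul_continuousOn i3)
  have s2 : (∫ u in (0:ℝ)..t, φ (t' - u)) + ∫ u in t..t', φ (t' - u) = ∫ u in (0:ℝ)..t', φ u := by
    rw [intervalIntegral.integral_add_adjacent_intervals i1.intervalIntegrable
      i3.intervalIntegrable]
    simp
  have s3 : ∫ u in (0:ℝ)..t, φ (t - u) = ∫ u in (0:ℝ)..t, φ u := by simp
  have s4 := intervalIntegral.integral_add_adjacent_intervals (μ := volume)
    (c0 le_rfl ht.le).intervalIntegrable i4.intervalIntegrable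
  have s5 : κ t * ∫ u in (0:ℝ)..t, φ (t' - u) = κ t * ((∫ u in (0:ℝ)..t, φ (t - u)) +
      (∫ u in t..t', φ u) - ∫ u in t..t', φ (t' - u)) := by
    congr 1
    linarith
  linarith

end VolterraKernel

/-- The time the flow of the autonomous equation with vector field `h` needs to go from `c` to `w`. -/
noncomputable def travelTime (h : ℝ → ℝ) (c w : ℝ) : ℝ := -∫ ζ in w..c, (h ζ)⁻¹

section TravelTime

variable {h : ℝ → ℝ} {b c : ℝ}

lemma travelTime_continuousOn_inv (hcont : ContinuousOn h (Ioc b c))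
    (hneg : ∀ w ∈ Ioc b c, h w < 0) {v w : ℝ} (hv : v ∈ Ioc b c) (hw : w ∈ Ioc b c) :
    ContinuousOn (fun ζ => (h ζ)⁻¹) (uIcc v w) :=
  have hsub : uIcc v w ⊆ Ioc b c := fun _ hy => ⟨(lt_min hv.1 hw.1).trans_le hy.1,
    hy.2.trans (max_le hv.2 hw.2)⟩
  (hcont.mono hsub).inv₀ fun y hy => (hneg y (hsub hy)).ne

lemma travelTime_strictAntiOn (hcont : ContinuousOn h (Ioc b c))
    (hneg : ∀ w ∈ Ioc b c, h w < 0) : StrictAntiOn (travelTime h c) (Ioc b c) := by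
  intro v hv w hw hvw
  have hc : c ∈ Ioc b c := ⟨hv.1.trans_le hv.2, le_rfl⟩
  have j1 := (travelTime_continuousOn_inv hcont hneg hv hw).intervalIntegrable (μ := volume)
  have j2 := (travelTime_continuousOn_inv hcont hneg hw hc).intervalIntegrable (μ := volume)
  have h1 := intervalIntegral.integral_add_adjacent_intervals j1 j2
  have h2 : 0 < ∫ ζ in v..w, -(h ζ)⁻¹ :=
    intervalIntegral.intervalIntegral_pos_of_pos_on j1.neg
      (fun y hy => neg_pos.2 (inv_lt_zero.2
        (hneg y ⟨hv.1.trans hy.1, hy.2.le.trans hw.2⟩))) hvw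
  rw [intervalIntegral.integral_neg] at h2
  simp only [travelTime]
  linarith

lemma travelTime_self : travelTime h c c = 0 := by simp [travelTime]

lemma travelTime_hasDerivAt (hcont : ContinuousOn h (Ioc b c))
    (hneg : ∀ w ∈ Ioc b c, h w < 0) {w : ℝ} (hw : w ∈ Ioo b c) :
    HasDerivAt (travelTime h c) (h w)⁻¹ w := by
  have hc : c ∈ Ioc b c := ⟨hw.1.trans hw.2, le_rfl⟩
  have hci : ContinuousOn (fun ζ => (h ζ)⁻¹) (Ioo b c) :=
    (hcont.mono Ioo_subset_Ioc_self).inv₀ fun y hy => (hneg y (Ioo_subset_Ioc_self hy)).ne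
  have := (intervalIntegral.integral_hasDerivAt_left
    (travelTime_continuousOn_inv hcont hneg (Ioo_subset_Ioc_self hw) hc).intervalIntegrable
    (hci.stronglyMeasurableAtFilter isOpen_Ioo w hw)
    (hci.continuousAt (isOpen_Ioo.mem_nhds hw))).neg
  rw [neg_neg] at this
  exact this

lemma travelTime_surjOn (hbc : b < c) (hcont : ContinuousOn h (Ioc b c))
    (hneg : ∀ w ∈ Ioc b c, h w < 0) {C : ℝ} (hC : 0 < C)
    (hlin : ∀ w ∈ Ioc b c, -(C * (w - b)) ≤ h w) :
    SurjOn (travelTime h c) (Ioc b c) (Ici 0) := by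
  intro x hx
  have hx0 : 0 ≤ x := hx
  have hcb : 0 < c - b := sub_pos.2 hbc
  have hE := Real.exp_pos (-(C * x))
  have hE1 : Real.exp (-(C * x)) ≤ 1 := Real.exp_le_one_iff.2 (by
    have := mul_nonneg hC.le hx0; linarith)
  set v := b + (c - b) * Real.exp (-(C * x)) with hv
  have hvb : b < v := by rw [hv]; linarith [mul_pos hcb hE]
  have hvc : v ≤ c := by rw [hv]; nlinarith
  have hvm : v ∈ Ioc b c := ⟨hvb, hvc⟩
  have hc : c ∈ Ioc b c := ⟨hbc, le_rfl⟩
  have hci := travelTime_continuousOn_inv hcont hneg hvm hc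
  have hge : x ≤ travelTime h c v := by
    have hcl : ContinuousOn (fun ζ => C⁻¹ * (ζ - b)⁻¹) (uIcc v c) := by
      refine continuousOn_const.mul (ContinuousOn.inv₀ (by fun_prop) fun y hy => ?_)
      rw [uIcc_of_le hvc] at hy
      exact (sub_pos.2 (hvb.trans_le hy.1)).ne'
    have h1 : ∫ ζ in v..c, C⁻¹ * (ζ - b)⁻¹ ≤ ∫ ζ in v..c, -(h ζ)⁻¹ := by
      refine intervalIntegral.integral_mono_on hvc hcl.intervalIntegrable
        hci.neg.intervalIntegrable fun y hy => ?_
      have hy' : y ∈ Ioc b c := ⟨hvb.trans_le hy.1, hy.2⟩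
      rw [← mul_inv, ← inv_neg]
      exact inv_anti₀ (neg_pos.2 (hneg y hy')) (by linarith [hlin y hy'])
    have h2 : ∫ ζ in v..c, C⁻¹ * (ζ - b)⁻¹ = x := by
      rw [intervalIntegral.integral_const_mul,
        intervalIntegral.integral_comp_sub_right (fun y => y⁻¹) b,
        integral_inv_of_pos (sub_pos.2 hvb) hcb, hv, add_sub_cancel_left,
        div_mul_cancel_left₀ hcb.ne', Real.log_inv, Real.log_exp, neg_neg]
      field_simp
    rw [intervalIntegral.integral_neg, h2] at h1
    exact h1
  have hcontQ : ContinuousOn (travelTime h c) (Icc v c) := by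
    have := intervalIntegral.continuousOn_primitive_interval_left (μ := volume)
      (f := fun ζ => (h ζ)⁻¹) (a := v) (b := c) (hci.integrableOn_uIcc)
    rw [uIcc_of_le hvc] at this
    exact this.neg
  obtain ⟨w, hw, hwx⟩ := intermediate_value_Icc' hvc hcontQ
    (show x ∈ Icc (travelTime h c c) (travelTime h c v) from ⟨travelTime_self.trans_le hx0, hge⟩)
  exact ⟨w, ⟨hvb.trans_le hw.1, hw.2⟩, hwx⟩

lemma travelTime_invFunOn_strictAntiOn (hcont : ContinuousOn h (Ioc b c))
    (hneg : ∀ w ∈ Ioc b c, h w < 0) (hsurj : SurjOn (travelTime h c) (Ioc b c) (Ici 0)) :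
    StrictAntiOn (Function.invFunOn (travelTime h c) (Ioc b c)) (Ici 0) := by
  intro x hx y hy hxy
  have h1 := Function.invFunOn_mem (hsurj hx)
  have h2 := Function.invFunOn_mem (hsurj hy)
  rwa [← (travelTime_strictAntiOn hcont hneg).lt_iff_gt h1 h2, Function.invFunOn_eq (hsurj hx),
    Function.invFunOn_eq (hsurj hy)]

lemma travelTime_invFunOn_mem_Ioo (hcont : ContinuousOn h (Ioc b c))
    (hneg : ∀ w ∈ Ioc b c, h w < 0) (hsurj : SurjOn (travelTime h c) (Ioc b c) (Ici 0))
    {x : ℝ} (hx : 0 < x) : Function.invFunOn (travelTime h c) (Ioc b c) x ∈ Ioo b c := by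
  have h0 := Function.invFunOn_mem (hsurj (self_mem_Ici (a := (0:ℝ))))
  have h1 := Function.invFunOn_mem (hsurj (show x ∈ Ici 0 from hx.le))
  exact ⟨h1.1, (travelTime_invFunOn_strictAntiOn hcont hneg hsurj (self_mem_Ici (a := (0:ℝ)))
    (show x ∈ Ici 0 from hx.le) hx).trans_le h0.2⟩

/-- The inverse of the travel time solves the autonomous equation. -/
lemma travelTime_invFunOn_hasDerivAt (hcont : ContinuousOn h (Ioc b c))
    (hneg : ∀ w ∈ Ioc b c, h w < 0) (hsurj : SurjOn (travelTime h c) (Ioc b c) (Ici 0))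
    {x : ℝ} (hx : 0 < x) :
    HasDerivAt (Function.invFunOn (travelTime h c) (Ioc b c))
      (h (Function.invFunOn (travelTime h c) (Ioc b c) x)) x := by
  set R := Function.invFunOn (travelTime h c) (Ioc b c) with hR
  have hanti := travelTime_strictAntiOn hcont hneg
  have hRx := travelTime_invFunOn_mem_Ioo hcont hneg hsurj hx
  have himage : Ioo (-c) (-b) ⊆ (fun y => -R y) '' Ioi 0 := by
    intro z hz
    have hz' : -z ∈ Ioc b c := ⟨by linarith [hz.2], by linarith [hz.1]⟩
    have hc : c ∈ Ioc b c := ⟨hz'.1.trans_le hz'.2, le_rfl⟩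
    have hpos : 0 < travelTime h c (-z) :=
      travelTime_self.symm.trans_lt (hanti hz' hc (by linarith [hz.1]))
    refine ⟨travelTime h c (-z), hpos, ?_⟩
    have h1 : R (travelTime h c (-z)) = -z :=
      hanti.injOn (Function.invFunOn_mem (hsurj hpos.le)) hz' (Function.invFunOn_eq (hsurj hpos.le))
    simp only [h1, neg_neg]
  have hRc : ContinuousAt R x := by
    have hmono : StrictMonoOn (fun y => -R y) (Ioi 0) := fun y hy z hz hyz =>
      neg_lt_neg (travelTime_invFunOn_strictAntiOn hcont hneg hsurj
        (Ioi_subset_Ici_self hy) (Ioi_subset_Ici_self hz) hyz)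
    have : ContinuousAt (fun y => - -R y) x := (hmono.continuousAt_of_image_mem_nhds
      (Ioi_mem_nhds hx) (mem_of_superset
        (isOpen_Ioo.mem_nhds ⟨neg_lt_neg hRx.2, neg_lt_neg hRx.1⟩) himage)).neg
    simpa only [neg_neg] using this
  have := HasDerivAt.of_local_left_inverse hRc (travelTime_hasDerivAt hcont hneg hRx)
    (inv_ne_zero (hneg _ (Ioo_subset_Ioc_self hRx)).ne)
    (by
      filter_upwards [Ioi_mem_nhds hx] with y hy
      exact Function.invFunOn_eq (hsurj (show y ∈ Ici 0 from (mem_Ioi.1 hy).le)))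
  rwa [inv_inv] at this

end TravelTime

namespace AssumptionH

variable {wmax wstar w0 : ℝ} {H : ℝ → ℝ}

lemma neg (hH : AssumptionH wmax wstar H) {w : ℝ} (hw : wstar < w) (hwm : w ≤ wmax) :
    H w < 0 := by
  obtain ⟨hle, -, hconv, h0, -, -, hmax⟩ := hH
  have hlt : wstar < wmax := hw.trans_le hwm
  have hpos : 0 < wmax - wstar := sub_pos.2 hlt
  have h := hconv.2 (mem_Iic.2 hle) (mem_Iic.2 le_rfl)
    (div_nonneg (sub_nonneg.2 hwm) hpos.le) (div_nonneg (sub_nonneg.2 hw.le) hpos.le)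
    (by field_simp; ring)
  have e : ((wmax - w) / (wmax - wstar)) • wstar + ((w - wstar) / (wmax - wstar)) • wmax = w := by
    simp only [smul_eq_mul]; field_simp; ring
  rw [e, h0, smul_zero, zero_add, smul_eq_mul] at h
  exact h.trans_lt (mul_neg_of_pos_of_neg (div_pos (sub_pos.2 hw) hpos) hmax)

lemma antitoneOn (hH : AssumptionH wmax wstar H) (hw0 : w0 ≤ wmax)
    (hw0min : ∀ w ∈ Iic wmax, H w0 ≤ H w) : AntitoneOn H (Iic w0) := by
  intro x hx y hy hxy
  have h := hH.2.2.1.le_max_of_mem_segment (mem_Iic.2 (le_trans hx hw0)) (mem_Iic.2 hw0)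
    (z := y) (by rw [segment_eq_Icc hx]; exact ⟨hxy, hy⟩)
  rwa [max_eq_left (hw0min x (mem_Iic.2 (le_trans hx hw0)))] at h

lemma exists_lipschitzOnWith (hH : AssumptionH wmax wstar H) (m : ℝ) :
    ∃ C, LipschitzOnWith C H (Icc m wmax) :=
  (hH.2.1.mono Icc_subset_Iic_self).exists_lipschitzOnWith one_ne_zero (convex_Icc _ _)
    isCompact_Icc

end AssumptionH

lemma IsLpKernel.volterraKernel {κ : ℝ → ℝ} (hκ : IsLpKernel 1 κ) : VolterraKernel κ where
  nonneg := hκ.1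
  intervalIntegrable T hT := by
    rcases hT.eq_or_lt with rfl | hT'
    · exact IntervalIntegrable.refl
    · rw [intervalIntegrable_iff_integrableOn_Ioc_of_le hT]
      simpa using hκ.2.2 T hT'

lemma VolterraKernel.solution_unique {wmax wstar : ℝ} {H κ a f f' : ℝ → ℝ}
    (hH : AssumptionH wmax wstar H) (hκ : VolterraKernel κ) (hdec : AntitoneOn κ (Ioi 0))
    (hf : ContinuousOn f (Ici 0)) (hfm : ∀ t ≥ 0, f t ≤ wmax)
    (hfe : ∀ t ≥ 0, f t = a t + ∫ s in (0:ℝ)..t, κ (t - s) * H (f s))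
    (hf' : ContinuousOn f' (Ici 0)) (hfm' : ∀ t ≥ 0, f' t ≤ wmax)
    (hfe' : ∀ t ≥ 0, f' t = a t + ∫ s in (0:ℝ)..t, κ (t - s) * H (f' s)) :
    ∀ t ≥ 0, f' t = f t := by
  intro T hT
  obtain ⟨M, hM⟩ := isCompact_Icc.exists_bound_of_continuousOn
    (hf.mono (show Icc 0 T ⊆ Ici 0 from Icc_subset_Ici_self))
  obtain ⟨M', hM'⟩ := isCompact_Icc.exists_bound_of_continuousOn
    (hf'.mono (show Icc 0 T ⊆ Ici 0 from Icc_subset_Ici_self))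
  set m := min (-M) (-M')
  obtain ⟨L, hL⟩ := hH.exists_lipschitzOnWith m
  have hmem : ∀ s ∈ Icc 0 T, f s ∈ Icc m wmax := fun s hs =>
    ⟨(min_le_left _ _).trans (neg_le_of_abs_le (hM s hs)), hfm s hs.1⟩
  have hmem' : ∀ s ∈ Icc 0 T, f' s ∈ Icc m wmax := fun s hs =>
    ⟨(min_le_right _ _).trans (neg_le_of_abs_le (hM' s hs)), hfm' s hs.1⟩
  have hHc := hH.2.1.continuousOn
  have hc : ContinuousOn (fun s => H (f s)) (Ici 0) := hHc.comp hf fun s hs => hfm s hs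
  have hc' : ContinuousOn (fun s => H (f' s)) (Ici 0) := hHc.comp hf' fun s hs => hfm' s hs
  have hd : ContinuousOn (fun s => |f' s - f s|) (Ici 0) := (hf'.sub hf).abs
  have hsub : ∀ {t : ℝ}, 0 ≤ t → uIcc 0 t ⊆ Ici 0 := fun ht y hy => (le_min le_rfl ht).trans hy.1
  have h0 := hκ.eq_zero_of_le_conv hdec (d := fun s => |f' s - f s|) (T := T) L.2
    (hd.mono Icc_subset_Ici_self) (fun _ _ => abs_nonneg _) (fun t ht => ?_) T ⟨hT, le_rfl⟩
  · exact sub_eq_zero.1 (abs_eq_zero.1 h0)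
  · have e : f' t - f t = ∫ s in (0:ℝ)..t, κ (t - s) * (H (f' s) - H (f s)) := by
      simp only [mul_sub]
      rw [intervalIntegral.integral_sub
        (hκ.intervalIntegrable_conv ht.1 le_rfl (hc'.mono (hsub ht.1)))
        (hκ.intervalIntegrable_conv ht.1 le_rfl (hc.mono (hsub ht.1))),
        hfe' t ht.1, hfe t ht.1]
      ring
    rw [e, ← intervalIntegral.integral_const_mul, ← Real.norm_eq_abs]
    refine intervalIntegral.norm_integral_le_of_norm_le ht.1 (Eventually.of_forall fun s hs => ?_)
      ((hκ.intervalIntegrable_conv ht.1 le_rfl (hd.mono (hsub ht.1))).const_mul _)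
    have hs' : s ∈ Icc 0 T := ⟨hs.1.le, hs.2.trans ht.2⟩
    have hk := hκ.nonneg (t - s) (sub_nonneg.2 hs.2)
    have hl := hL.dist_le_mul _ (hmem' s hs') _ (hmem s hs')
    rw [Real.dist_eq, Real.dist_eq] at hl
    rw [norm_mul, Real.norm_of_nonneg hk, Real.norm_eq_abs, mul_left_comm]
    exact mul_le_mul_of_nonneg_left hl hk

/-- A Volterra equation with increasing forcing term in `(b, c]` and a decreasing Lipschitz
nonlinearity vanishing at `b` has a solution staying in `(b, c]`. -/
lemma VolterraKernel.exists_solution_mem_Ioc {b c : ℝ} {H κ a : ℝ → ℝ} {C : NNReal}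
    (hκ : VolterraKernel κ) (hdec : AntitoneOn κ (Ioi 0)) (hbc : b ≤ c)
    (hHL : LipschitzOnWith C H (Icc b c)) (hHb : H b = 0) (hHanti : AntitoneOn H (Icc b c))
    (ha : ContinuousOn a (Ici 0)) (hamono : MonotoneOn a (Ici 0))
    (haval : ∀ t ≥ 0, a t ∈ Ioc b c) :
    ∃ f : ℝ → ℝ, ContinuousOn f (Ici 0) ∧ (∀ t ≥ 0, f t ∈ Ioc b c) ∧
      ∀ t ≥ 0, f t = a t + ∫ s in (0:ℝ)..t, κ (t - s) * H (f s) := by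
  set φ : ℝ → ℝ := fun x => H (projIcc b c hbc x) with hφ
  have hφL : LipschitzWith C φ := LipschitzWith.of_dist_le_mul fun x y => by
    refine (hHL.dist_le_mul _ (projIcc b c hbc x).2 _ (projIcc b c hbc y).2).trans
      (mul_le_mul_of_nonneg_left ?_ C.2)
    simpa [Subtype.dist_eq] using (LipschitzWith.projIcc hbc).dist_le_mul x y
  have hφnonpos : ∀ x, φ x ≤ 0 := fun x =>
    (hHanti ⟨le_rfl, hbc⟩ (projIcc b c hbc x).2 (projIcc b c hbc x).2.1).trans_eq hHb
  have hφge : ∀ x, H c ≤ φ x := fun x =>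
    hHanti (projIcc b c hbc x).2 ⟨hbc, le_rfl⟩ (projIcc b c hbc x).2.2
  have hφb : φ b = 0 := by simp only [hφ, projIcc_left, hHb]
  obtain ⟨f, hfc, hfe⟩ := hκ.exists_solution hdec (A := max |b| |c|) (B := -H c) ha
    (fun t ht => abs_le_max_abs_abs (haval t ht).1.le (haval t ht).2) hφL
    (fun x => abs_le.2 ⟨by linarith [hφge x], by linarith [hφge x, hφnonpos x]⟩)
  have hφf : Continuous fun s => φ (f s) := hφL.continuous.comp hfc
  have hlow : ∀ t, 0 ≤ t → 0 < f t - b := by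
    refine hκ.pos_of_eq_sub_conv hdec (x := fun t => f t - b) (g := fun t => a t - b)
      (h := fun s => -φ (f s)) C.2 (hfc.sub continuous_const).continuousOn hφf.neg.continuousOn
      ?_ (fun t t' ht htt' _ => ?_) (fun t ht hxt => ⟨neg_nonneg.2 (hφnonpos _), ?_⟩)
      (fun t ht => ?_)
    · have := hfe 0 le_rfl
      rw [intervalIntegral.integral_same, add_zero] at this
      simp only [this]
      exact sub_pos.2 (haval 0 le_rfl).1
    · exact sub_le_sub_right (hamono ht.le (ht.le.trans htt') htt') b
    · have h1 := hφL.dist_le_mul (f t) b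
      rw [hφb, Real.dist_eq, Real.dist_eq, sub_zero, abs_of_nonneg hxt] at h1
      exact (neg_le_abs _).trans h1
    · simp only [mul_neg, intervalIntegral.integral_neg]
      rw [hfe t ht]
      ring
  have hup : ∀ t, 0 ≤ t → f t ≤ c := by
    intro t ht
    have : ∫ s in (0:ℝ)..t, κ (t - s) * φ (f s) ≤ 0 :=
      integral_nonpos_of_nonpos_on ht fun s hs =>
        mul_nonpos_of_nonneg_of_nonpos (hκ.nonneg _ (sub_nonneg.2 hs.2)) (hφnonpos _)
    linarith [hfe t ht, (haval t ht).2]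
  refine ⟨f, hfc.continuousOn, fun t ht => ⟨sub_pos.1 (hlow t ht), hup t ht⟩, fun t ht => ?_⟩
  rw [hfe t ht]
  congr 1
  refine intervalIntegral.integral_congr fun s hs => ?_
  rw [uIcc_of_le ht] at hs
  simp only [hφ, projIcc_of_mem hbc ⟨(sub_pos.1 (hlow s hs.1)).le, hup s hs.1⟩]

/-- Solutions with an increasing forcing term stay above the time-changed autonomous flow. -/
lemma VolterraKernel.invFunOn_travelTime_le {b c : ℝ} {H κ a f : ℝ → ℝ} {C : NNReal}
    (hκ : VolterraKernel κ) (hdec : AntitoneOn κ (Ioi 0)) (hκc : ContinuousOn κ (Ioi 0))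
    (hHL : LipschitzOnWith C H (Icc b c)) (hHb : H b = 0) (hHanti : AntitoneOn H (Icc b c))
    (hHneg : ∀ w ∈ Ioc b c, H w < 0)
    (hamono : MonotoneOn a (Ici 0)) (ha0 : a 0 ∈ Ioc b c)
    (hf : ContinuousOn f (Ici 0)) (hfm : ∀ t ≥ 0, f t ∈ Ioc b c)
    (hfe : ∀ t ≥ 0, f t = a t + ∫ s in (0:ℝ)..t, κ (t - s) * H (f s)) {t : ℝ} (ht : 0 ≤ t) :
    Function.invFunOn (travelTime H (a 0)) (Ioc b (a 0)) (∫ s in (0:ℝ)..t, κ s)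
      ∈ Ioc b (min (a 0) (f t)) := by
  have hsubc : Ioc b (a 0) ⊆ Ioc b c := Ioc_subset_Ioc_right ha0.2
  have hHc := hHL.continuousOn
  have hcont : ContinuousOn H (Ioc b (a 0)) := hHc.mono (hsubc.trans Ioc_subset_Icc_self)
  have hneg : ∀ w ∈ Ioc b (a 0), H w < 0 := fun w hw => hHneg w (hsubc hw)
  have hbc : b ≤ c := ha0.1.le.trans ha0.2
  have hsurj : SurjOn (travelTime H (a 0)) (Ioc b (a 0)) (Ici 0) := by
    refine travelTime_surjOn ha0.1 hcont hneg (C := C + 1) (by positivity) fun w hw => ?_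
    have h1 := hHL.dist_le_mul w (Ioc_subset_Icc_self (hsubc hw)) b ⟨le_rfl, hbc⟩
    rw [hHb, Real.dist_eq, Real.dist_eq, sub_zero, abs_of_nonneg (sub_nonneg.2 hw.1.le)] at h1
    linarith [neg_le_abs (H w), hw.1]
  set R := Function.invFunOn (travelTime H (a 0)) (Ioc b (a 0)) with hR
  set K : ℝ → ℝ := fun t => ∫ s in (0:ℝ)..t, κ s with hK
  have hK0 : ∀ {s}, 0 ≤ s → 0 ≤ K s := fun hs => hκ.integral_nonneg hs
  have hRanti := travelTime_invFunOn_strictAntiOn hcont hneg hsurj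
  have hRmem : ∀ x, 0 ≤ x → R x ∈ Ioc b (a 0) := fun x hx => Function.invFunOn_mem (hsurj hx)
  have key : ∀ η > 0, ∀ t, 0 ≤ t → 0 < f t - R (K t + η) := by
    intro η hη
    have hKη : ∀ {s}, 0 ≤ s → 0 < K s + η := fun hs => add_pos_of_nonneg_of_pos (hK0 hs) hη
    set r : ℝ → ℝ := fun s => R (K s + η) with hr
    have hrm : ∀ s, 0 ≤ s → r s ∈ Icc b c := fun s hs =>
      Ioc_subset_Icc_self (hsubc (hRmem _ (hKη hs).le))
    have hrc : ContinuousOn r (Ici 0) := by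
      intro s hs
      exact (travelTime_invFunOn_hasDerivAt hcont hneg hsurj (hKη hs)).continuousAt
        |>.comp_continuousWithinAt (f := fun s => K s + η)
          ((hκ.continuousOn_integral s hs).add continuousWithinAt_const)
    have hranti : AntitoneOn r (Ici 0) := fun s hs s' hs' hss' =>
      hRanti.antitoneOn (hKη hs).le (hKη hs').le
        (add_le_add_left (hκ.monotoneOn_integral hs hs' hss') η)
    have hφc : ContinuousOn (fun s => H (r s)) (Ici 0) := hHc.comp hrc fun s hs => hrm s hs
    have hφm : MonotoneOn (fun s => H (r s)) (Ici 0) := fun s hs s' hs' hss' =>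
      hHanti (hrm s' hs') (hrm s hs) (hranti hs hs' hss')
    have hHf : ContinuousOn (fun s => H (f s)) (Ici 0) :=
      hHc.comp hf fun s hs => Ioc_subset_Icc_self (hfm s hs)
    have hincr : ∀ s s', 0 < s → s ≤ s' → r s' - r s = ∫ u in s..s', κ u * H (r u) := by
      intro s s' hs hss'
      have hIcc : uIcc s s' ⊆ Ioi 0 := fun y hy =>
        hs.trans_le ((le_min le_rfl hss').trans hy.1)
      refine (intervalIntegral.integral_eq_sub_of_hasDerivAt (fun u hu => ?_)
        ((hκ.intervalIntegrable_of_nonneg hs.le (hs.le.trans hss')).mul_continuousOn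
          (hφc.mono (hIcc.trans Ioi_subset_Ici_self)))).symm
      have hu0 : 0 < u := hIcc hu
      have := (travelTime_invFunOn_hasDerivAt hcont hneg hsurj (hKη hu0.le)).comp u
        ((hκ.hasDerivAt_integral hκc hu0).add_const η)
      rw [mul_comm] at this
      exact this
    refine hκ.pos_of_eq_sub_conv hdec (x := fun t => f t - r t)
      (g := fun t => a t - r t + ∫ s in (0:ℝ)..t, κ (t - s) * H (r s))
      (h := fun s => H (r s) - H (f s)) C.2 (hf.sub hrc) (hφc.sub hHf) ?_
      (fun t t' ht htt' ht' => ?_) (fun t ht hxt => ⟨?_, ?_⟩) (fun t ht => ?_)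
    · have h1 := hfe 0 le_rfl
      rw [intervalIntegral.integral_same, add_zero] at h1
      simp only [h1]
      exact sub_pos.2 (travelTime_invFunOn_mem_Ioo hcont hneg hsurj (hKη le_rfl)).2
    · have h1 := hκ.conv_add_integral_mul_le hdec hφc hφm ht htt' ht'
      have h2 := hincr t t' ht htt'
      have h3 := hamono ht.le (ht.le.trans htt') htt'
      linarith
    · exact sub_nonneg.2 (hHanti (hrm t ht) (Ioc_subset_Icc_self (hfm t ht)) (sub_nonneg.1 hxt))
    · have h1 := hHL.dist_le_mul (f t) (Ioc_subset_Icc_self (hfm t ht)) (r t) (hrm t ht)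
      rw [Real.dist_eq, Real.dist_eq, abs_of_nonneg hxt, abs_sub_comm] at h1
      exact (le_abs_self _).trans h1
    · have hsub : uIcc 0 t ⊆ Ici 0 := fun y hy => (le_min le_rfl ht).trans hy.1
      simp only [mul_sub]
      rw [intervalIntegral.integral_sub
        (hκ.intervalIntegrable_conv ht le_rfl (hφc.mono hsub))
        (hκ.intervalIntegrable_conv ht le_rfl (hHf.mono hsub)), hfe t ht]
      ring
  have hmem := hRmem (K t) (hK0 ht)
  refine ⟨hmem.1, le_min hmem.2 ?_⟩
  by_contra! hlt
  have hft : f t ∈ Ioc b (a 0) := ⟨(hfm t ht).1, hlt.le.trans hmem.2⟩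
  have hanti := travelTime_strictAntiOn hcont hneg
  have h1 : K t < travelTime H (a 0) (f t) := by
    have := hanti hft hmem hlt
    rwa [Function.invFunOn_eq (hsurj (hK0 ht))] at this
  have h2 : (0:ℝ) ≤ travelTime H (a 0) (f t) := (hK0 ht).trans h1.le
  have h3 : R (travelTime H (a 0) (f t)) = f t :=
    hanti.injOn (hRmem _ h2) hft (Function.invFunOn_eq (hsurj h2))
  have h4 := key _ (sub_pos.2 h1) t ht
  rw [add_sub_cancel, h3, sub_self] at h4
  exact lt_irrefl 0 h4

lemma VolterraKernel.conv_neg {κ g : ℝ → ℝ} (hκ : VolterraKernel κ)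
    (hdec : AntitoneOn κ (Ioi 0)) (hne : ∃ t > 0, κ t ≠ 0) (hg : ContinuousOn g (Ici 0))
    (hgneg : ∀ s ≥ 0, g s < 0) {t : ℝ} (ht : 0 < t) :
    ∫ s in (0:ℝ)..t, κ (t - s) * g s < 0 := by
  obtain ⟨δ, hδ, hκδ⟩ := hne
  have hκδ' : 0 < κ δ := lt_of_le_of_ne (hκ.nonneg δ hδ.le) hκδ.symm
  set p := max 0 (t - δ)
  have hp0 : 0 ≤ p := le_max_left _ _
  have hpt : p < t := max_lt ht (by linarith)
  have hc : ∀ {x y : ℝ}, 0 ≤ x → 0 ≤ y → ContinuousOn g (uIcc x y) := fun hx hy =>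
    hg.mono fun z hz => (le_min hx hy).trans hz.1
  have j1 := hκ.intervalIntegrable_conv ht.le hpt.le (hc le_rfl hp0)
  have j2 := hκ.intervalIntegrable_conv hpt.le le_rfl (hc hp0 ht.le)
  rw [← intervalIntegral.integral_add_adjacent_intervals j1 j2]
  have h1 : ∫ s in (0:ℝ)..p, κ (t - s) * g s ≤ 0 :=
    integral_nonpos_of_nonpos_on hp0 fun s hs => mul_nonpos_of_nonneg_of_nonpos
      (hκ.nonneg _ (sub_nonneg.2 (hs.2.trans hpt.le))) (hgneg s hs.1).le
  have h2 : 0 < ∫ s in p..t, -(κ (t - s) * g s) := by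
    refine intervalIntegral.intervalIntegral_pos_of_pos_on j2.neg (fun s hs => ?_) hpt
    have hts : 0 < t - s := sub_pos.2 hs.2
    have hsδ : t - s ≤ δ := by linarith [(le_max_right 0 (t - δ)).trans hs.1.le]
    exact neg_pos.2 (mul_neg_of_pos_of_neg (hκδ'.trans_le (hdec hts hδ hsδ))
      (hgneg s (hp0.trans hs.1.le)))
  rw [intervalIntegral.integral_neg] at h2
  linarith

/-- Theorem (Volterra, case (a)): for `H` satisfying Assumption (H) with leftmost
minimizer `w₀`, a decreasing `L₁`-kernel `κ` not identically zero, and a continuous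
increasing `a : [0,∞) → (w_*, w₀]`, the Volterra equation
`f(t) = a(t) + ∫₀^t κ(t−s) H(f(s)) ds` has a unique global continuous solution,
satisfying `w_* < Q₁⁻¹(∫₀^t κ, a(0)) ≤ f(t) < a(t)` for `t > 0`. -/
theorem volterra_case_a
    (wmax wstar w0 : ℝ) (H : ℝ → ℝ) (hH : AssumptionH wmax wstar H)
    (hw0 : w0 ≤ wmax)
    (hw0min : ∀ w ∈ Set.Iic wmax, H w0 ≤ H w)
    (hw0left : ∀ w ∈ Set.Iic wmax, H w = H w0 → w0 ≤ w)
    (κ : ℝ → ℝ) (hκ : IsLpKernel 1 κ) (hdec : AntitoneOn κ (Set.Ioi 0))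
    (hne : ∃ t > 0, κ t ≠ 0)
    (a : ℝ → ℝ) (hacont : ContinuousOn a (Set.Ici 0))
    (hamono : MonotoneOn a (Set.Ici 0))
    (haval : ∀ t ≥ 0, a t ∈ Set.Ioc wstar w0) :
    let Q1 : ℝ → ℝ := fun w => -∫ ζ in w..(a 0), (H ζ)⁻¹
    let r1 : ℝ → ℝ := fun t =>
      Function.invFunOn Q1 (Set.Ioc wstar (a 0)) (∫ s in (0:ℝ)..t, κ s)
    ∃ f : ℝ → ℝ,
      (ContinuousOn f (Set.Ici 0) ∧ (∀ t ≥ 0, f t ≤ wmax) ∧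
        (∀ t ≥ 0, f t = a t + ∫ s in (0:ℝ)..t, κ (t - s) * H (f s))) ∧
      (∀ f' : ℝ → ℝ,
        (ContinuousOn f' (Set.Ici 0) ∧ (∀ t ≥ 0, f' t ≤ wmax) ∧
          (∀ t ≥ 0, f' t = a t + ∫ s in (0:ℝ)..t, κ (t - s) * H (f' s))) →
        ∀ t ≥ 0, f' t = f t) ∧
      (∀ t > 0, wstar < r1 t ∧ r1 t ≤ f t ∧ f t < a t) := by
  intro Q1 r1
  have hK := hκ.volterraKernel
  have ha0 := haval 0 le_rfl
  have hw : wstar < w0 := ha0.1.trans_le ha0.2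
  obtain ⟨C, hC⟩ := hH.exists_lipschitzOnWith wstar
  have hCL : LipschitzOnWith C H (Icc wstar w0) := hC.mono (Icc_subset_Icc_right hw0)
  have hanti : AntitoneOn H (Icc wstar w0) := (hH.antitoneOn hw0 hw0min).mono Icc_subset_Iic_self
  have hneg : ∀ w ∈ Ioc wstar w0, H w < 0 := fun w hw => hH.neg hw.1 (hw.2.trans hw0)
  have hHs : H wstar = 0 := hH.2.2.2.1
  obtain ⟨f, hf, hfm, hfe⟩ :=
    hK.exists_solution_mem_Ioc hdec hw.le hCL hHs hanti hacont hamono haval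
  have hfw : ∀ t ≥ 0, f t ≤ wmax := fun t ht => (hfm t ht).2.trans hw0
  refine ⟨f, ⟨hf, hfw, hfe⟩,
    fun f' h => hK.solution_unique hH hdec hf hfw hfe h.1 h.2.1 h.2.2, fun t ht => ?_⟩
  have hr := hK.invFunOn_travelTime_le hdec hκ.2.1 hCL hHs hanti hneg hamono ha0 hf hfm hfe ht.le
  refine ⟨hr.1, hr.2.trans (min_le_right _ _), ?_⟩
  have hint := hK.conv_neg hdec hne
    (hCL.continuousOn.comp hf fun s hs => Ioc_subset_Icc_self (hfm s hs))
    (fun s hs => hneg _ (hfm s hs)) ht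
  simp only [Function.comp_apply] at hint
  linarith [hfe t ht.le]
end
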